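/- arXiv:1906.06967 — 3 statements merged into one kernel-verified Lean document; each statement's English description precedes it below -/
import Mathlib

section
/- Let n ≥ 2 and let p₀ be a prime number. Let m ≥ 1 and let g₁,…,g_m ∈ ℤ[x₁₁,…,x_{nn}] be polynomials in the n² matrix entries such that the Krull dimension of ℚ[x₁₁,…,x_{nn}]/(det(x_{ij}) − 1, g₁,…,g_m) is at most n² − 3 (so Z = {det = 1, g₁ = ⋯ = g_m = 0} has codimension at least 2 in SL_n over ℚ). Let S be a finite set of primes with p₀ ∉ S and let ε > 0. Suppose given A_∞ ∈ SL_n(ℝ) with g_i(A_∞) ≠ 0 for some i, and for each p ∈ S a matrix A_p ∈ SL_n(ℚ_p) with g_i(A_p) ≠ 0 for some i. Assume that for every prime p ∉ S ∪ {p₀} there exists B ∈ SL_n(ℤ_p) with max_{1≤i≤m} |g_i(B)|_p = 1. Then there exists γ ∈ SL_n(ℚ) such that: |γ_{jl} − (A_∞)_{jl}| < ε for all j,l; |γ_{jl} − (A_p)_{jl}|_p < ε for every p ∈ S and all j,l; and for every prime p ∉ S ∪ {p₀}, all entries of γ lie in ℤ_p and max_{1≤i≤m} |g_i(γ)|_p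 = 1. -/
open MvPolynomial

lemma ringKrullDim_le_of_isIntegral_of_injective {R S : Type*} [CommRing R] [CommRing S]
    [Algebra R S] [Algebra.IsIntegral R S] [FaithfulSMul R S] :
    ringKrullDim R ≤ ringKrullDim S := by
  refine iSup_le fun l ↦ ?_
  obtain ⟨P, hP, hPl⟩ := (Ideal.nonempty_primesOver (S := S) l.head.asIdeal)
  obtain ⟨L, hL, -⟩ := Ideal.exists_ltSeries_of_hasGoingUp l P
  rw [← hL]
  exact Order.LTSeries.length_le_krullDim L

/-- Elements of a finitely generated algebra over a field which are algebraically independent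
are at most as many as the Krull dimension. -/
lemma AlgebraicIndependent.natCard_le_ringKrullDim {k A ι : Type} [Field k] [CommRing A]
    [Algebra k A] [Algebra.FiniteType k A] [Finite ι] {x : ι → A}
    (hx : AlgebraicIndependent k x) : (Nat.card ι : WithBot ℕ∞) ≤ ringKrullDim A := by
  obtain ⟨P, hP, hPx⟩ := Ideal.exists_comap_eq_of_mem_minimalPrimes_of_injective
    (f := (aeval x : MvPolynomial ι k →ₐ[k] A).toRingHom) hx ⊥
    (by rw [IsDomain.minimalPrimes_eq_singleton_bot]; rfl)
  have hy : AlgebraicIndependent k (Ideal.Quotient.mkₐ k P ∘ x) := by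
    rw [algebraicIndependent_iff]
    intro p hp
    rw [Function.comp_def, ← MvPolynomial.comp_aeval_apply, Ideal.Quotient.mkₐ_eq_mk,
      Ideal.Quotient.eq_zero_iff_mem] at hp
    have : p ∈ Ideal.comap (aeval x : MvPolynomial ι k →ₐ[k] A).toRingHom P := hp
    rwa [hPx] at this
  obtain ⟨s, f, hf, hfi⟩ := exists_integral_inj_algHom_of_fg k (A ⧸ P)
  let := f.toRingHom.toAlgebra
  have : Algebra.IsIntegral (MvPolynomial (Fin s) k) (A ⧸ P) := ⟨hfi⟩
  have : FaithfulSMul (MvPolynomial (Fin s) k) (A ⧸ P) :=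
    (faithfulSMul_iff_algebraMap_injective _ _).2 hf
  have hs : (s : WithBot ℕ∞) ≤ ringKrullDim (A ⧸ P) := by
    refine le_trans ?_ (ringKrullDim_le_of_isIntegral_of_injective (R := MvPolynomial (Fin s) k))
    simp
  have : IsScalarTower k (MvPolynomial (Fin s) k) (A ⧸ P) :=
    IsScalarTower.of_algebraMap_eq fun r ↦ (f.commutes r).symm
  have htr : Algebra.trdeg k (A ⧸ P) = s := by
    have := trdeg_add_eq k (MvPolynomial (Fin s) k) (A := A ⧸ P)
    simpa [_root_.trdeg_eq_zero] using this.symm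
  have := hy.cardinalMk_le_trdeg
  rw [htr, ← Nat.cast_card, Nat.cast_le] at this
  exact (Nat.cast_le.2 this).trans (hs.trans (ringKrullDim_quotient_le P))

/-- The rational number `x` is `p`-integral with residue class `y` modulo `p`. -/
def IsReduction (p : ℕ) [Fact p.Prime] (x : ℚ) (y : ZMod p) : Prop :=
  ∃ z : ℤ_[p], (z : ℚ_[p]) = x ∧ PadicInt.toZMod z = y

section Reduction

variable {p : ℕ} [Fact p.Prime]

lemma exists_padicInt_eq {x : ℚ} (hx : padicNorm p x ≤ 1) : ∃ z : ℤ_[p], (z : ℚ_[p]) = x :=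
  ⟨⟨x, by rw [Padic.eq_padicNorm]; exact_mod_cast hx⟩, rfl⟩

lemma exists_isReduction {x : ℚ} (hx : padicNorm p x ≤ 1) : ∃ y, IsReduction p x y :=
  let ⟨z, hz⟩ := exists_padicInt_eq hx
  ⟨_, z, hz, rfl⟩

lemma IsReduction.padicNorm_le_one {x : ℚ} {y : ZMod p} (h : IsReduction p x y) :
    padicNorm p x ≤ 1 := by
  obtain ⟨z, hz, -⟩ := h
  have := z.norm_le_one
  rw [PadicInt.norm_def, hz, Padic.eq_padicNorm] at this
  exact_mod_cast this

lemma IsReduction.padicNorm_eq_one_iff {x : ℚ} {y : ZMod p} (h : IsReduction p x y) :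
    padicNorm p x = 1 ↔ y ≠ 0 := by
  obtain ⟨z, hz, rfl⟩ := h
  have h1 : ‖z‖ = padicNorm p x := by rw [PadicInt.norm_def, hz, Padic.eq_padicNorm]
  rw [Ne, ← RingHom.mem_ker, PadicInt.ker_toZMod, IsLocalRing.mem_maximalIdeal, mem_nonunits_iff,
    not_not, PadicInt.isUnit_iff, h1]
  norm_cast

lemma isReduction_of_padicNorm_sub_lt_one {x : ℚ} {b : ℤ} (h : padicNorm p (x - b) < 1) :
    IsReduction p x b := by
  obtain ⟨z, hz⟩ := exists_padicInt_eq h.le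
  refine ⟨z + b, by push_cast [hz]; ring, ?_⟩
  have : PadicInt.toZMod z = 0 := by
    by_contra h0
    exact h.ne ((IsReduction.padicNorm_eq_one_iff ⟨z, hz, rfl⟩).2 h0)
  simp [this]

lemma IsReduction.aeval {σ : Type*} {x : σ → ℚ} {y : σ → ZMod p}
    (h : ∀ j, IsReduction p (x j) (y j)) (G : MvPolynomial σ ℤ) :
    IsReduction p (MvPolynomial.aeval x G) (MvPolynomial.aeval y G) := by
  choose z hz hy using h
  refine ⟨MvPolynomial.aeval z G, ?_, ?_⟩
  · have h1 := MvPolynomial.comp_aeval_apply z ((PadicInt.Coe.ringHom (p := p)).toIntAlgHom) G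
    have h2 := MvPolynomial.comp_aeval_apply x ((Rat.castHom ℚ_[p]).toIntAlgHom) G
    refine h1.trans (Eq.trans ?_ h2.symm)
    congr 2
    exact funext hz
  · have h1 := MvPolynomial.comp_aeval_apply z ((PadicInt.toZMod (p := p)).toIntAlgHom) G
    refine h1.trans ?_
    congr 2
    exact funext hy

end Reduction

lemma exists_int_padicNorm_sub_lt {p : ℕ} [Fact p.Prime] {x : ℚ} (hx : padicNorm p x ≤ 1)
    {δ : ℚ} (hδ : 0 < δ) : ∃ b : ℤ, padicNorm p (x - b) < δ := by
  obtain ⟨z, hz⟩ := exists_padicInt_eq hx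
  obtain ⟨b, hb⟩ := (PadicInt.denseRange_intCast (p := p)).exists_dist_lt z
    (ε := δ) (by exact_mod_cast hδ)
  refine ⟨b, ?_⟩
  rw [dist_eq_norm, PadicInt.norm_def] at hb
  push_cast [hz] at hb
  rw [← Rat.cast_intCast, ← Rat.cast_sub, Padic.eq_padicNorm] at hb
  exact_mod_cast hb

lemma padicNorm_pow (p : ℕ) [Fact p.Prime] (x : ℚ) (r : ℕ) :
    padicNorm p (x ^ r) = padicNorm p x ^ r := by
  induction r with
  | zero => simp
  | succ r ih => rw [pow_succ, padicNorm.mul, ih, pow_succ]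

lemma padicNorm_natCast_eq_one_of_ne {p q : ℕ} [Fact p.Prime] (hq : q.Prime) (h : p ≠ q) (r : ℕ) :
    padicNorm p ((q : ℚ) ^ r) = 1 := by
  have : Fact q.Prime := ⟨hq⟩
  rw [padicNorm_pow, padicNorm.padicNorm_of_prime_of_ne h, one_pow]

/-- A rational number close to `c` at `q`, small at the real place and at the primes of `S`, and
integral away from `p₀` and `q`. -/
lemma exists_rat_close_at_prime {p₀ q : ℕ} (hp₀ : p₀.Prime) (hq : q.Prime) (hqp : q ≠ p₀)
    (S : Finset ℕ) (hS : ∀ p ∈ S, p.Prime) (hqS : q ∉ S) (c ε : ℚ) (hε : 0 < ε) :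
    ∃ y : ℚ, |y| < ε ∧ padicNorm q (y - c) < ε ∧
      (∀ (p : ℕ) [Fact p.Prime], p ∈ S → p ≠ p₀ → padicNorm p y < ε) ∧
      ∀ (p : ℕ) [Fact p.Prime], p ≠ q → p ≠ p₀ → padicNorm p y ≤ 1 := by
  have : Fact q.Prime := ⟨hq⟩
  have : Fact p₀.Prime := ⟨hp₀⟩
  obtain ⟨k, hk⟩ := exists_pow_lt_of_lt_one hε (y := (2 : ℚ)⁻¹) (by norm_num)
  set M : ℕ := (∏ p ∈ S, p) ^ k with hM
  have hM0 : (M : ℚ) ≠ 0 := by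
    have : M ≠ 0 := pow_ne_zero _ (Finset.prod_ne_zero_iff.2 fun p hp ↦ (hS p hp).ne_zero)
    exact_mod_cast this
  have hMS : ∀ (p : ℕ) [Fact p.Prime], p ∈ S → padicNorm p M < ε := by
    intro p hpf hp
    refine lt_of_le_of_lt ?_ hk
    have h2 : (2 : ℚ) ≤ p := by exact_mod_cast hpf.out.two_le
    have h1 : padicNorm p ((∏ p ∈ S, p : ℕ) : ℚ) ≤ 2⁻¹ := by
      have : ((p ^ 1 : ℕ) : ℤ) ∣ ((∏ p ∈ S, p : ℕ) : ℤ) := by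
        rw [pow_one]; exact_mod_cast Finset.dvd_prod_of_mem _ hp
      rw [padicNorm.dvd_iff_norm_le] at this
      rw [Nat.cast_one, zpow_neg_one, Int.cast_natCast] at this
      exact this.trans (by gcongr)
    rw [hM, Nat.cast_pow, padicNorm_pow]
    exact pow_le_pow_left₀ (padicNorm.nonneg _) h1 k
  have hq1 : (1 : ℚ) < q := by exact_mod_cast hq.one_lt
  have hq0 : (q : ℚ) ≠ 0 := by positivity
  obtain ⟨e, he⟩ := pow_unbounded_of_one_lt (padicNorm q (c / M)) hq1
  have hqe : (0 : ℚ) < (q : ℚ) ^ e := by positivity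
  have hnq : padicNorm q ((q : ℚ) ^ e) = ((q : ℚ) ^ e)⁻¹ := by
    rw [padicNorm_pow, padicNorm.padicNorm_p_of_prime, inv_pow]
  obtain ⟨v, hv⟩ := exists_int_padicNorm_sub_lt (p := q) (x := (q : ℚ) ^ e * (c / M))
    (by rw [padicNorm.mul, hnq]; exact inv_mul_le_one_of_le₀ he.le hqe.le)
    (δ := ε * ((q : ℚ) ^ e)⁻¹) (by positivity)
  obtain ⟨f, hf⟩ := exists_pow_lt_of_lt_one (x := ε * ((q : ℚ) ^ e)⁻¹) (by positivity)
    (y := (q : ℚ)⁻¹) (inv_lt_one_of_one_lt₀ hq1)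
  have hp1 : (1 : ℚ) < p₀ := by exact_mod_cast hp₀.one_lt
  obtain ⟨l, hl⟩ := pow_unbounded_of_one_lt (|(M : ℚ) * ((q : ℚ) ^ e)⁻¹ * v| / ε) hp1
  set r : ℕ := Nat.totient (q ^ f) * l with hr
  have hlr : l ≤ r := Nat.le_mul_of_pos_left _ (Nat.totient_pos.2 (pow_pos hq.pos _))
  have hpr : (0 : ℚ) < (p₀ : ℚ) ^ r := by positivity
  have hnp : padicNorm q ((p₀ : ℚ) ^ r) = 1 := padicNorm_natCast_eq_one_of_ne hp₀ hqp r
  have hr1 : padicNorm q (1 - (p₀ : ℚ) ^ r) < ε * ((q : ℚ) ^ e)⁻¹ := by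
    have h1 : p₀ ^ r ≡ 1 [MOD q ^ f] := by
      rw [hr, pow_mul]
      simpa using (Nat.ModEq.pow_totient
        (Nat.Coprime.pow_right f ((Nat.coprime_primes hp₀ hq).2 hqp.symm))).pow l
    have h2 : ((q ^ f : ℕ) : ℤ) ∣ 1 - (p₀ : ℤ) ^ r := by
      have := h1.dvd
      push_cast at this ⊢
      exact this
    rw [padicNorm.dvd_iff_norm_le] at h2
    refine lt_of_le_of_lt ?_ hf
    push_cast at h2
    rwa [zpow_neg, zpow_natCast, ← inv_pow] at h2
  refine ⟨M * ((q : ℚ) ^ e)⁻¹ * v * ((p₀ : ℚ) ^ r)⁻¹, ?_, ?_, ?_, ?_⟩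
  · rw [abs_mul, abs_inv, abs_of_pos hpr, ← div_eq_mul_inv, div_lt_iff₀ hpr]
    rw [div_lt_iff₀ hε, mul_comm _ ε] at hl
    exact hl.trans_le (mul_le_mul_of_nonneg_left (pow_le_pow_right₀ hp1.le hlr) hε.le)
  · have h1 : M * ((q : ℚ) ^ e)⁻¹ * v * ((p₀ : ℚ) ^ r)⁻¹ - c = M * ((q : ℚ) ^ e)⁻¹ *
        (v * (1 - (p₀ : ℚ) ^ r) / (p₀ : ℚ) ^ r + -((q : ℚ) ^ e * (c / M) - v)) := by
      field_simp
      ring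
    have h2 : padicNorm q (v * (1 - (p₀ : ℚ) ^ r) / (p₀ : ℚ) ^ r
        + -((q : ℚ) ^ e * (c / M) - v)) < ε * ((q : ℚ) ^ e)⁻¹ := by
      refine padicNorm.nonarchimedean.trans_lt (max_lt ?_ (by rwa [padicNorm.neg]))
      rw [padicNorm.div, hnp, div_one, padicNorm.mul]
      exact (mul_le_of_le_one_left (padicNorm.nonneg _) (padicNorm.of_int v)).trans_lt hr1
    rw [h1, padicNorm.mul, padicNorm.mul, ← inv_pow, padicNorm_pow, ← zpow_neg_one,
      ← zpow_natCast]
    have h3 : padicNorm q ((q : ℚ) ^ (-1 : ℤ)) = q := by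
      rw [zpow_neg_one, ← one_div, padicNorm.div, padicNorm.one, padicNorm.padicNorm_p_of_prime]
      simp
    rw [h3, zpow_natCast]
    calc padicNorm q M * (q : ℚ) ^ e * _ ≤ (q : ℚ) ^ e * _ := by
          gcongr
          · exact padicNorm.nonneg _
          · exact mul_le_of_le_one_left hqe.le (padicNorm.of_nat M)
      _ < (q : ℚ) ^ e * (ε * ((q : ℚ) ^ e)⁻¹) := by gcongr
      _ = ε := by field_simp
  all_goals
    intro p _ hp hpp
    have hpv := padicNorm.of_int (p := p) v
    have hpn : padicNorm p (((p₀ : ℚ) ^ r)⁻¹) = 1 := by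
      rw [← one_div, padicNorm.div, padicNorm_natCast_eq_one_of_ne hp₀ hpp, padicNorm.one, div_one]
    rw [padicNorm.mul, padicNorm.mul, padicNorm.mul, hpn, mul_one]
  · have hpq : padicNorm p (((q : ℚ) ^ e)⁻¹) = 1 := by
      rw [← one_div, padicNorm.div, padicNorm_natCast_eq_one_of_ne hq (fun h ↦ hqS (h ▸ hp)),
        padicNorm.one, div_one]
    rw [hpq, mul_one]
    exact (mul_le_of_le_one_right (padicNorm.nonneg _) hpv).trans_lt (hMS p hp)
  · have hpq : padicNorm p (((q : ℚ) ^ e)⁻¹) = 1 := by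
      rw [← one_div, padicNorm.div, padicNorm_natCast_eq_one_of_ne hq hp, padicNorm.one, div_one]
    rw [hpq, mul_one]
    exact mul_le_one₀ (padicNorm.of_nat M) (padicNorm.nonneg _) hpv

/-- Strong approximation for the affine line over `ℚ` off `p₀`. -/
lemma exists_rat_close {p₀ : ℕ} (hp₀ : p₀.Prime) (S : Finset ℕ) (hS : ∀ p ∈ S, p.Prime)
    (hp₀S : p₀ ∉ S) (ainf : ℚ) (a : ℕ → ℚ) (ε : ℚ) (hε : 0 < ε) :
    ∃ x : ℚ, |x - ainf| < ε ∧ (∀ (p : ℕ) [Fact p.Prime], p ∈ S → padicNorm p (x - a p) < ε) ∧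
      ∀ (p : ℕ) [Fact p.Prime], p ∉ S → p ≠ p₀ → padicNorm p x ≤ 1 := by
  have : Fact p₀.Prime := ⟨hp₀⟩
  induction S using Finset.induction_on generalizing ε with
  | empty =>
    obtain ⟨r, hr⟩ := exists_pow_lt_of_lt_one hε (y := ((p₀ : ℚ)⁻¹))
      (inv_lt_one_of_one_lt₀ (by exact_mod_cast hp₀.one_lt))
    have hpos : (0 : ℚ) < (p₀ : ℚ) ^ r := by have := hp₀.pos; positivity
    refine ⟨⌊ainf * p₀ ^ r⌋ / p₀ ^ r, ?_, by simp, ?_⟩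
    · have h1 := Int.floor_le (ainf * p₀ ^ r)
      have h2 := Int.lt_floor_add_one (ainf * p₀ ^ r)
      have h3 : (⌊ainf * p₀ ^ r⌋ / p₀ ^ r : ℚ) - ainf
          = (⌊ainf * p₀ ^ r⌋ - ainf * p₀ ^ r) * (p₀ : ℚ)⁻¹ ^ r := by
        rw [inv_pow]; field_simp
      have h4 : (0 : ℚ) < (p₀ : ℚ)⁻¹ ^ r := by rw [inv_pow]; positivity
      rw [h3, abs_mul, abs_of_pos h4]
      refine lt_of_le_of_lt (mul_le_of_le_one_left h4.le ?_) hr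
      rw [abs_le]
      constructor <;> linarith
    · intro p _ _ hp
      rw [padicNorm.div, padicNorm_natCast_eq_one_of_ne hp₀ hp, div_one]
      exact padicNorm.of_int _
  | insert q S hqS ih =>
    simp only [Finset.mem_insert, not_or] at hp₀S
    obtain ⟨x, hx1, hx2, hx3⟩ := ih (fun p hp ↦ hS p (Finset.mem_insert_of_mem hp)) hp₀S.2
      (ε / 2) (half_pos hε)
    have hq := hS q (Finset.mem_insert_self _ _)
    have : Fact q.Prime := ⟨hq⟩
    obtain ⟨y, hy1, hy2, hy3, hy4⟩ := exists_rat_close_at_prime hp₀ hq (Ne.symm hp₀S.1) S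
      (fun p hp ↦ hS p (Finset.mem_insert_of_mem hp)) hqS
      (a q - x) (ε / 2) (half_pos hε)
    refine ⟨x + y, ?_, ?_, ?_⟩
    · have : x + y - ainf = (x - ainf) + y := by ring
      rw [this]
      exact (abs_add_le _ _).trans_lt (by linarith)
    · intro p _ hp
      rcases Finset.mem_insert.1 hp with rfl | hp
      · have : x + y - a p = y - (a p - x) := by ring
        rw [this]
        exact hy2.trans (by linarith)
      · have : x + y - a p = (x - a p) + y := by ring
        rw [this]
        refine (padicNorm.nonarchimedean).trans_lt (max_lt ?_ ?_)
        · exact (hx2 p hp).trans (by linarith)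
        · exact (hy3 p hp (fun h ↦ hp₀S.2 (h ▸ hp))).trans (by linarith)
    · intro p _ hp hp'
      simp only [Finset.mem_insert, not_or] at hp
      exact padicNorm.nonarchimedean.trans (max_le (hx3 p hp.2 hp') (hy4 p hp.1 hp'))

section Affine

lemma aeval_cons_eq_eval₂ {R : Type*} [CommRing R] {N : ℕ} (x : R) (y : Fin N → R)
    (g : MvPolynomial (Fin (N + 1)) ℤ) :
    aeval (Fin.cons x y : Fin (N + 1) → R) g =
      ((finSuccEquiv ℤ N g).map (aeval y : MvPolynomial (Fin N) ℤ →ₐ[ℤ] R).toRingHom).eval x := by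
  rw [Polynomial.eval_map]
  induction g using MvPolynomial.induction_on with
  | C r =>
    simp only [eq_intCast, map_intCast]
    exact (map_intCast (Polynomial.eval₂RingHom
      (aeval y : MvPolynomial (Fin N) ℤ →ₐ[ℤ] R).toRingHom x) r).symm
  | add f g hf hg => simp only [map_add, Polynomial.eval₂_add, hf, hg]
  | mul_X f j hf =>
    rw [map_mul, map_mul, Polynomial.eval₂_mul, hf]
    congr 1
    refine Fin.cases ?_ (fun j ↦ ?_) j
    · simp [finSuccEquiv_X_zero]
    · simp [finSuccEquiv_X_succ]

/-- The ideal generated by the coefficients, with respect to the variable `X 0`, of the elements of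
an ideal. -/
noncomputable def coeffIdeal {N : ℕ} (I : Ideal (MvPolynomial (Fin (N + 1)) ℤ)) :
    Ideal (MvPolynomial (Fin N) ℤ) :=
  Ideal.span {c | ∃ g ∈ I, ∃ k, c = (finSuccEquiv ℤ N g).coeff k}

variable {N : ℕ} {I : Ideal (MvPolynomial (Fin (N + 1)) ℤ)}

lemma coeff_mem_coeffIdeal {g : MvPolynomial (Fin (N + 1)) ℤ} (hg : g ∈ I) (k : ℕ) :
    (finSuccEquiv ℤ N g).coeff k ∈ coeffIdeal I :=
  Ideal.subset_span ⟨g, hg, k, rfl⟩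

lemma exists_mem_coeffIdeal_degreeOf_eq_zero {j : Fin N} {h : MvPolynomial (Fin (N + 1)) ℤ}
    (hI : h ∈ I) (h0 : h ≠ 0) (hj : degreeOf j.succ h = 0) :
    ∃ c ∈ coeffIdeal I, c ≠ 0 ∧ degreeOf j c = 0 := by
  have h1 : finSuccEquiv ℤ N h ≠ 0 := by simpa using h0
  refine ⟨_, coeff_mem_coeffIdeal hI _, Polynomial.leadingCoeff_ne_zero.2 h1, ?_⟩
  exact Nat.le_zero.1 ((degreeOf_coeff_finSuccEquiv h j _).trans hj.le)

lemma exists_mem_coeffIdeal_aeval_ne_zero {R : Type*} [CommRing R] {x : R} {y : Fin N → R}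
    {g : MvPolynomial (Fin (N + 1)) ℤ} (hg : g ∈ I)
    (h : aeval (Fin.cons x y : Fin (N + 1) → R) g ≠ 0) :
    ∃ c ∈ coeffIdeal I, aeval y c ≠ 0 := by
  by_contra! hc
  apply h
  rw [aeval_cons_eq_eval₂]
  convert Polynomial.eval_zero
  ext k
  rw [Polynomial.coeff_map]
  exact hc _ (coeff_mem_coeffIdeal hg k)

/-- If the coefficient ideal does not vanish at a point over a large finite field, then the ideal
does not vanish identically on the line above this point. -/
lemma exists_aeval_cons_ne_zero {p : ℕ} [Fact p.Prime] {G : Finset (MvPolynomial (Fin (N + 1)) ℤ)}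
    (hG : Ideal.span (G : Set (MvPolynomial (Fin (N + 1)) ℤ)) = I)
    (hp : ∀ g ∈ G, (finSuccEquiv ℤ N g).natDegree < p) {y : Fin N → ZMod p}
    {c : MvPolynomial (Fin N) ℤ} (hc : c ∈ coeffIdeal I) (hcy : aeval y c ≠ 0) :
    ∃ x : ZMod p, ∃ g ∈ I, aeval (Fin.cons x y : Fin (N + 1) → ZMod p) g ≠ 0 := by
  set F := (Polynomial.mapRingHom
    (aeval y : MvPolynomial (Fin N) ℤ →ₐ[ℤ] ZMod p).toRingHom).comp
      (finSuccEquiv ℤ N).toRingEquiv.toRingHom with hF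
  obtain ⟨g, hgG, hg⟩ : ∃ g ∈ G, F g ≠ 0 := by
    by_contra! h
    have h1 : I ≤ RingHom.ker F := by
      rw [← hG, Ideal.span_le]
      exact fun g hg ↦ h g hg
    have h2 : coeffIdeal I ≤
        RingHom.ker (aeval y : MvPolynomial (Fin N) ℤ →ₐ[ℤ] ZMod p).toRingHom := by
      refine Ideal.span_le.2 ?_
      rintro _ ⟨g, hg, k, rfl⟩
      have h3 : (F g).coeff k = 0 := by rw [RingHom.mem_ker.1 (h1 hg), Polynomial.coeff_zero]
      rwa [hF, RingHom.comp_apply, Polynomial.coe_mapRingHom, Polynomial.coeff_map] at h3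
    exact hcy (h2 hc)
  have hgI : g ∈ I := hG ▸ Ideal.subset_span hgG
  obtain ⟨x, hx⟩ := Polynomial.exists_eval_ne_zero_of_natDegree_lt_card (F g) hg (by
    rw [Cardinal.mk_fintype, ZMod.card, Nat.cast_lt]
    exact Polynomial.natDegree_map_le.trans_lt (hp g hgG))
  exact ⟨x, g, hgI, by rwa [aeval_cons_eq_eval₂]⟩

lemma exists_near_forall_aeval_ne_zero {h : MvPolynomial (Fin N) ℤ} (h0 : h ≠ 0) (a : Fin N → ℚ)
    {ε : ℚ} (hε : 0 < ε) : ∃ a' : Fin N → ℚ, (∀ j, |a' j - a j| < ε) ∧ ∃ δ : ℚ, 0 < δ ∧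
      ∀ y : Fin N → ℚ, (∀ j, |y j - a' j| < δ) → aeval y h ≠ 0 := by
  have hmap : map (Int.castRingHom ℚ) h ≠ 0 := by
    rwa [Ne, map_eq_zero_iff _ (map_injective _ Int.cast_injective)]
  have hae (y : Fin N → ℚ) : aeval y h = eval y (map (Int.castRingHom ℚ) h) := by
    rw [eval_map]; rfl
  obtain ⟨a', ha', hne⟩ : ∃ a' : Fin N → ℚ, (∀ j, a' j ∈ Set.Ioo (a j - ε) (a j + ε)) ∧
      eval a' (map (Int.castRingHom ℚ) h) ≠ 0 := by
    by_contra! hcon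
    refine hmap (funext_set (fun j ↦ Set.Ioo (a j - ε) (a j + ε))
      (fun j ↦ Set.Ioo_infinite (by linarith)) fun x hx ↦ ?_)
    rw [hcon x (fun j ↦ hx j trivial), map_zero]
  refine ⟨a', fun j ↦ ?_, ?_⟩
  · rw [abs_lt]
    constructor <;> linarith [(ha' j).1, (ha' j).2]
  have hopen : IsOpen {y : Fin N → ℚ | eval y (map (Int.castRingHom ℚ) h) ≠ 0} :=
    isOpen_compl_singleton.preimage (continuous_eval _)
  obtain ⟨δ, hδ, hball⟩ := Metric.isOpen_iff.1 hopen a' hne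
  obtain ⟨δ', hδ', hδδ'⟩ := exists_rat_btwn hδ
  have hδ'0 : 0 < δ' := by exact_mod_cast hδ'
  refine ⟨δ', hδ'0, fun y hy ↦ ?_⟩
  rw [hae]
  refine hball ((dist_pi_lt_iff hδ).2 fun j ↦ ?_)
  rw [Rat.dist_eq]
  refine lt_trans ?_ hδδ'
  exact_mod_cast hy j

lemma exists_finset_padicNorm_eq_one {x : ℚ} (hx : x ≠ 0) :
    ∃ T : Finset ℕ, ∀ (p : ℕ) [Fact p.Prime], p ∉ T → padicNorm p x = 1 := by
  refine ⟨(x.num.natAbs * x.den).primeFactors, fun p hp hpT ↦ ?_⟩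
  have h0 : x.num.natAbs * x.den ≠ 0 := by simp [hx]
  have hdvd : ¬ p ∣ x.num.natAbs * x.den := fun h ↦
    hpT (Nat.mem_primeFactors.2 ⟨hp.out, h, h0⟩)
  have h1 : padicNorm p x.num = 1 := (padicNorm.int_eq_one_iff _).2 fun h ↦
    hdvd ((Int.natCast_dvd.1 h).mul_right _)
  have h2 : padicNorm p x.den = 1 := (padicNorm.nat_eq_one_iff _).2 fun h ↦ hdvd (h.mul_left _)
  rw [← Rat.num_div_den x, padicNorm.div, h1, h2, div_one]

/-- Strong approximation off `p₀` for the complement of a closed subset of codimension at least two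
in affine space, where the codimension condition is replaced by the existence, for every variable,
of a nonzero equation not involving this variable. -/
theorem exists_rat_point_close {p₀ : ℕ} (hp₀ : p₀.Prime) (N : ℕ)
    (I : Ideal (MvPolynomial (Fin N) ℤ))
    (hI : ∀ j, ∃ h ∈ I, h ≠ 0 ∧ degreeOf j h = 0) (S : Finset ℕ) (hS : ∀ p ∈ S, p.Prime)
    (hp₀S : p₀ ∉ S) (ainf : Fin N → ℚ) (a : ℕ → Fin N → ℚ) (ε : ℚ) (hε : 0 < ε)
    (hb : ∀ (p : ℕ) [Fact p.Prime], p ∉ S → p ≠ p₀ →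
      ∃ b : Fin N → ZMod p, ∃ g ∈ I, aeval b g ≠ 0) :
    ∃ t : Fin N → ℚ, (∀ j, |t j - ainf j| < ε) ∧
      (∀ (p : ℕ) [Fact p.Prime], p ∈ S → ∀ j, padicNorm p (t j - a p j) < ε) ∧
      ∀ (p : ℕ) [Fact p.Prime], p ∉ S → p ≠ p₀ →
        ∃ τ : Fin N → ZMod p, (∀ j, IsReduction p (t j) (τ j)) ∧ ∃ g ∈ I, aeval τ g ≠ 0 := by
  induction N generalizing S ε with
  | zero =>
    refine ⟨ainf, fun j ↦ j.elim0, fun p _ _ j ↦ j.elim0, fun p _ hpS hp ↦ ?_⟩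
    obtain ⟨b, hb⟩ := hb p hpS hp
    exact ⟨b, fun j ↦ j.elim0, hb⟩
  | succ N ih =>
    obtain ⟨G, hG⟩ : I.FG := IsNoetherian.noetherian I
    set D := G.sup fun g ↦ (finSuccEquiv ℤ N g).natDegree with hD
    obtain ⟨h, hhI, hh, hdeg⟩ := hI 0
    obtain ⟨h₀, hh₀⟩ : ∃ h₀, finSuccEquiv ℤ N h = Polynomial.C h₀ :=
      ⟨_, Polynomial.eq_C_of_natDegree_eq_zero ((natDegree_finSuccEquiv h).trans hdeg)⟩
    have hh₀0 : h₀ ≠ 0 := by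
      rintro rfl
      rw [map_zero, map_eq_zero_iff _ (finSuccEquiv ℤ N).injective] at hh₀
      exact hh hh₀
    have hh₀I : h₀ ∈ coeffIdeal I := by
      have := coeff_mem_coeffIdeal hhI 0
      rwa [hh₀, Polynomial.coeff_C_zero] at this
    have hhe {R : Type} [CommRing R] (x : R) (y : Fin N → R) :
        aeval (Fin.cons x y : Fin (N + 1) → R) h = aeval y h₀ := by
      rw [aeval_cons_eq_eval₂, hh₀, Polynomial.map_C, Polynomial.eval_C]; rfl
    obtain ⟨ainf', hainf', δ, hδ, hδ'⟩ := exists_near_forall_aeval_ne_zero hh₀0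
      (fun j ↦ ainf j.succ) (half_pos hε)
    set S' : Finset ℕ := S ∪ (Finset.range (D + 1)).filter fun p ↦ p.Prime ∧ p ≠ p₀ with hS'
    have hS'p : ∀ p ∈ S', p.Prime := by
      intro p hp
      rcases Finset.mem_union.1 hp with hp | hp
      · exact hS p hp
      · exact (Finset.mem_filter.1 hp).2.1
    have hp₀S' : p₀ ∉ S' := by simp [hS', hp₀S]
    have hbig (p : ℕ) [hp : Fact p.Prime] (hpS : p ∉ S') (hp0 : p ≠ p₀) : D < p := by
      by_contra! hle
      exact hpS (Finset.mem_union_right _ (Finset.mem_filter.2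
        ⟨Finset.mem_range.2 (by omega), hp.out, hp0⟩))
    have hbint (p : ℕ) : ∃ b : Fin (N + 1) → ℤ, ∀ [Fact p.Prime], p ∉ S → p ≠ p₀ →
        ∃ g ∈ I, aeval (fun j ↦ (b j : ZMod p)) g ≠ 0 := by
      by_cases hp : p.Prime ∧ p ∉ S ∧ p ≠ p₀
      · have : Fact p.Prime := ⟨hp.1⟩
        obtain ⟨b, hb⟩ := hb p hp.2.1 hp.2.2
        choose c hc using fun j ↦ ZMod.intCast_surjective (b j)
        exact ⟨c, fun _ _ ↦ by simpa only [hc] using hb⟩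
      · exact ⟨0, fun {hp'} h1 h2 ↦ (hp ⟨hp'.out, h1, h2⟩).elim⟩
    choose b hb' using hbint
    set a' : ℕ → Fin (N + 1) → ℚ := fun p j ↦ if p ∈ S then a p j else b p j with ha'
    obtain ⟨y, hy1, hy2, hy3⟩ := ih (coeffIdeal I)
      (fun j ↦ by
        obtain ⟨f, hf, hf0, hfj⟩ := hI j.succ
        exact exists_mem_coeffIdeal_degreeOf_eq_zero hf hf0 hfj)
      S' hS'p hp₀S' ainf' (fun p j ↦ a' p j.succ) (min (min (ε / 2) δ) 1)
      (lt_min (lt_min (half_pos hε) hδ) one_pos)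
      (fun p _ hpS hp ↦ by
        obtain ⟨b, g, hg, hbg⟩ := hb p (fun h ↦ hpS (Finset.mem_union_left _ h)) hp
        refine ⟨Fin.tail b, exists_mem_coeffIdeal_aeval_ne_zero (x := b 0) hg ?_⟩
        rwa [Fin.cons_self_tail])
    have hhy : aeval y h₀ ≠ 0 := hδ' y fun j ↦
      (hy1 j).trans_le ((min_le_left _ _).trans (min_le_right _ _))
    obtain ⟨T₀, hT₀⟩ := exists_finset_padicNorm_eq_one hhy
    set T := T₀.filter fun p ↦ p.Prime ∧ p ∉ S' ∧ p ≠ p₀ with hT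
    have hxT (p : ℕ) : ∃ x : ℤ, ∀ [Fact p.Prime], p ∉ S' → p ≠ p₀ →
        ∃ τ : Fin N → ZMod p, (∀ j, IsReduction p (y j) (τ j)) ∧
          ∃ g ∈ I, aeval (Fin.cons (x : ZMod p) τ : Fin (N + 1) → ZMod p) g ≠ 0 := by
      by_cases hp : p.Prime ∧ p ∉ S' ∧ p ≠ p₀
      · have : Fact p.Prime := ⟨hp.1⟩
        obtain ⟨τ, hτ, c, hc, hcτ⟩ := hy3 p hp.2.1 hp.2.2
        obtain ⟨x, hx⟩ := exists_aeval_cons_ne_zero hG (fun g hg ↦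
          (Finset.le_sup (f := fun g ↦ (finSuccEquiv ℤ N g).natDegree) hg).trans_lt
            (hbig p hp.2.1 hp.2.2)) hc hcτ
        obtain ⟨x', rfl⟩ := ZMod.intCast_surjective x
        exact ⟨x', fun _ _ ↦ ⟨τ, hτ, hx⟩⟩
      · exact ⟨0, fun {hp'} h1 h2 ↦ (hp ⟨hp'.out, h1, h2⟩).elim⟩
    choose xT hxT using hxT
    have hp₀ST : p₀ ∉ S' ∪ T := by simp [hp₀S', hT]
    obtain ⟨x, hx1, hx2, hx3⟩ := exists_rat_close hp₀ (S' ∪ T)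
      (fun p hp ↦ by
        rcases Finset.mem_union.1 hp with hp | hp
        · exact hS'p p hp
        · exact (Finset.mem_filter.1 hp).2.1)
      hp₀ST (ainf 0) (fun p ↦ if p ∈ S' then a' p 0 else xT p) (min ε 1) (lt_min hε one_pos)
    refine ⟨Fin.cons x y, ?_, ?_, ?_⟩
    · refine Fin.cases ?_ fun j ↦ ?_
      · exact hx1.trans_le (min_le_left _ _)
      · rw [Fin.cons_succ]
        have h1 := (hy1 j).trans_le ((min_le_left _ _).trans (min_le_left _ _))
        have h2 := hainf' j
        rw [abs_lt] at *
        constructor <;> linarith [h1.1, h1.2, h2.1, h2.2]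
    · intro p _ hp
      have hpS' : p ∈ S' := Finset.mem_union_left _ hp
      refine Fin.cases ?_ fun j ↦ ?_
      · have := hx2 p (Finset.mem_union_left _ hpS')
        simp only [hpS', hp, ha', if_true] at this
        exact this.trans_le (min_le_left _ _)
      · have := hy2 p hpS' j
        simp only [hp, ha', if_true] at this
        rw [Fin.cons_succ]
        exact this.trans_le
          ((min_le_left _ _).trans ((min_le_left _ _).trans (half_le_self hε.le)))
    · intro p _ hpS hp0
      by_cases hpS' : p ∈ S'
      · refine ⟨fun j ↦ (b p j : ZMod p), ?_, hb' p hpS hp0⟩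
        refine Fin.cases ?_ fun j ↦ ?_
        · have := hx2 p (Finset.mem_union_left _ hpS')
          simp only [hpS', hpS, ha', if_true, if_false] at this
          exact isReduction_of_padicNorm_sub_lt_one (this.trans_le (min_le_right _ _))
        · have := hy2 p hpS' j
          simp only [hpS, ha', if_false] at this
          rw [Fin.cons_succ]
          exact isReduction_of_padicNorm_sub_lt_one (this.trans_le (min_le_right _ _))
      · by_cases hpT : p ∈ T
        · obtain ⟨τ, hτ, hg⟩ := hxT p hpS' hp0
          refine ⟨_, ?_, hg⟩
          refine Fin.cases ?_ fun j ↦ ?_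
          · have := hx2 p (Finset.mem_union_right _ hpT)
            simp only [hpS', if_false] at this
            exact isReduction_of_padicNorm_sub_lt_one (this.trans_le (min_le_right _ _))
          · simpa using hτ j
        · obtain ⟨τ, hτ, -⟩ := hy3 p hpS' hp0
          have hpT₀ : p ∉ T₀ := fun h ↦
            hpT (Finset.mem_filter.2 ⟨h, Fact.out, hpS', hp0⟩)
          obtain ⟨ξ, hξ⟩ := exists_isReduction (hx3 p (fun h ↦
            (Finset.mem_union.1 h).elim hpS' hpT) hp0)
          refine ⟨Fin.cons ξ τ, ?_, h, hhI, ?_⟩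
          · refine Fin.cases ?_ fun j ↦ ?_
            · simpa using hξ
            · simpa using hτ j
          · rw [hhe]
            exact ((IsReduction.aeval hτ h₀).padicNorm_eq_one_iff).1 (hT₀ p hpT₀)

end Affine

section Parametrization

open Matrix

variable {n : ℕ}

/-- A family of matrices over fields is polynomially parametrized if its members are
specializations of a single integral polynomial matrix of determinant one. -/
def IsPolyParametrized (P : ∀ (K : Type) [Field K], Set (Matrix (Fin n) (Fin n) K)) : Prop :=
  ∃ (σ : Type) (_ : Finite σ) (φ : Matrix (Fin n) (Fin n) (MvPolynomial σ ℤ)), φ.det = 1 ∧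
    ∀ (K : Type) [Field K] (A : Matrix (Fin n) (Fin n) K), A ∈ P K →
      ∃ t : σ → K, φ.map (aeval t) = A

variable {P Q R : ∀ (K : Type) [Field K], Set (Matrix (Fin n) (Fin n) K)}

lemma IsPolyParametrized.of_mul (hP : IsPolyParametrized P) (hQ : IsPolyParametrized Q)
    (h : ∀ (K : Type) [Field K], ∀ A ∈ R K, ∃ B ∈ P K, ∃ C ∈ Q K, A = B * C) :
    IsPolyParametrized R := by
  obtain ⟨σ, _, φ, hφ, hφ'⟩ := hP
  obtain ⟨τ, _, ψ, hψ, hψ'⟩ := hQ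
  refine ⟨σ ⊕ τ, inferInstance, φ.map (rename Sum.inl) * ψ.map (rename Sum.inr), ?_, ?_⟩
  · rw [det_mul, ← AlgHom.mapMatrix_apply, ← AlgHom.mapMatrix_apply, ← AlgHom.map_det,
      ← AlgHom.map_det, hφ, hψ, map_one, map_one, one_mul]
  · intro K _ A hA
    obtain ⟨B, hB, C, hC, rfl⟩ := h K A hA
    obtain ⟨s, rfl⟩ := hφ' K B hB
    obtain ⟨t, rfl⟩ := hψ' K C hC
    refine ⟨Sum.elim s t, ?_⟩
    rw [Matrix.map_mul]
    congr 1 <;> ext i j <;> simp [aeval_rename, Function.comp_def]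

lemma IsPolyParametrized.of_transpose (hP : IsPolyParametrized P)
    (h : ∀ (K : Type) [Field K], ∀ A ∈ R K, Aᵀ ∈ P K) : IsPolyParametrized R := by
  obtain ⟨σ, _, φ, hφ, hφ'⟩ := hP
  refine ⟨σ, inferInstance, φᵀ, by rw [det_transpose, hφ], fun K _ A hA ↦ ?_⟩
  obtain ⟨t, ht⟩ := hφ' K _ (h K A hA)
  exact ⟨t, by rw [← transpose_transpose A, ← ht]; rfl⟩

lemma isPolyParametrized_one : IsPolyParametrized (n := n) fun _ _ ↦ {1} :=
  ⟨PEmpty, inferInstance, 1, det_one, fun K _ A hA ↦ ⟨PEmpty.elim, by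
    rw [Set.mem_singleton_iff.1 hA]; simp⟩⟩

lemma det_one_add_vecMulVec_single {K : Type*} [CommRing K] {u : Fin n → K} {κ : Fin n}
    (hu : u κ = 0) : (1 + vecMulVec u (Pi.single κ 1)).det = 1 := by
  rw [vecMulVec_eq Unit, det_one_add_replicateCol_mul_replicateRow, single_one_dotProduct, hu,
    add_zero]

lemma one_add_vecMulVec_single_mul_apply {K : Type*} [CommRing K] (u : Fin n → K) (κ : Fin n)
    (A : Matrix (Fin n) (Fin n) K) (i j : Fin n) :
    ((1 + vecMulVec u (Pi.single κ 1)) * A) i j = A i j + u i * A κ j := by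
  rw [add_mul, one_mul, vecMulVec_mul, Matrix.add_apply, vecMulVec_apply, single_one_vecMul]
  rfl

lemma one_add_vecMulVec_neg_mul {K : Type*} [CommRing K] {u : Fin n → K} {κ : Fin n}
    (hu : u κ = 0) :
    (1 + vecMulVec (-u) (Pi.single κ 1)) * (1 + vecMulVec u (Pi.single κ 1)) = 1 := by
  ext i j
  rw [one_add_vecMulVec_single_mul_apply]
  simp only [Matrix.add_apply, vecMulVec_apply, hu, Pi.neg_apply]
  by_cases h : j = κ
  · subst h; simp
  · simp [h, Ne.symm h]

lemma isPolyParametrized_column (κ : Fin n) : IsPolyParametrized fun K _ ↦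
    {A : Matrix (Fin n) (Fin n) K | ∃ u : Fin n → K, u κ = 0 ∧
      A = 1 + vecMulVec u (Pi.single κ 1)} := by
  refine ⟨Fin n, inferInstance, 1 + vecMulVec (Function.update X κ 0) (Pi.single κ 1),
    det_one_add_vecMulVec_single (by simp), ?_⟩
  rintro K _ _ ⟨u, hu, rfl⟩
  refine ⟨u, ?_⟩
  ext i j
  simp only [map_apply, Matrix.add_apply, vecMulVec_apply, map_add, map_mul]
  congr 1
  · by_cases h : i = j <;> simp [Matrix.one_apply, h]
  · congr 1
    · by_cases h : i = κ
      · subst h; simp [hu]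
      · simp [h]
    · by_cases h : j = κ
      · subst h; simp
      · simp [h]

lemma isPolyParametrized_row (κ : Fin n) : IsPolyParametrized fun K _ ↦
    {A : Matrix (Fin n) (Fin n) K | ∃ u : Fin n → K, u κ = 0 ∧
      A = (1 + vecMulVec u (Pi.single κ 1))ᵀ} :=
  (isPolyParametrized_column κ).of_transpose fun K _ A ⟨u, hu, hA⟩ ↦
    ⟨u, hu, by rw [hA, transpose_transpose]⟩

lemma IsPolyParametrized.of_column_mul (hQ : IsPolyParametrized Q) (κ : Fin n)
    (h : ∀ (K : Type) [Field K], ∀ A ∈ R K, ∃ u : Fin n → K, u κ = 0 ∧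
      (1 + vecMulVec u (Pi.single κ 1)) * A ∈ Q K) : IsPolyParametrized R :=
  (isPolyParametrized_column κ).of_mul hQ fun K _ A hA ↦ by
    obtain ⟨u, hu, hA⟩ := h K A hA
    refine ⟨_, ⟨-u, by simp [hu], rfl⟩, _, hA, ?_⟩
    rw [← mul_assoc, one_add_vecMulVec_neg_mul hu, one_mul]

lemma IsPolyParametrized.of_row_mul (hQ : IsPolyParametrized Q) (κ : Fin n)
    (h : ∀ (K : Type) [Field K], ∀ A ∈ R K, ∃ u : Fin n → K, u κ = 0 ∧
      (1 + vecMulVec u (Pi.single κ 1))ᵀ * A ∈ Q K) : IsPolyParametrized R :=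
  (isPolyParametrized_row κ).of_mul hQ fun K _ A hA ↦ by
    obtain ⟨u, hu, hA⟩ := h K A hA
    refine ⟨_, ⟨-u, by simp [hu], rfl⟩, _, hA, ?_⟩
    have := one_add_vecMulVec_neg_mul (u := -u) (κ := κ) (by simp [hu])
    rw [neg_neg] at this
    rw [← mul_assoc, ← transpose_mul, this, transpose_one, one_mul]

lemma IsPolyParametrized.of_mul_row (hQ : IsPolyParametrized Q) (κ : Fin n)
    (h : ∀ (K : Type) [Field K], ∀ A ∈ R K, ∃ u : Fin n → K, u κ = 0 ∧
      A * (1 + vecMulVec u (Pi.single κ 1))ᵀ ∈ Q K) : IsPolyParametrized R :=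
  hQ.of_mul (isPolyParametrized_row κ) fun K _ A hA ↦ by
    obtain ⟨u, hu, hA⟩ := h K A hA
    refine ⟨_, hA, _, ⟨-u, by simp [hu], rfl⟩, ?_⟩
    rw [mul_assoc, ← transpose_mul, one_add_vecMulVec_neg_mul hu, transpose_one, mul_one]

/-- Matrices of determinant one whose first `k` rows and columns are those of the identity. -/
def unimodularFrom (k : ℕ) (K : Type) [Field K] : Set (Matrix (Fin n) (Fin n) K) :=
  {A | A.det = 1 ∧ ∀ i j : Fin n, (i.1 < k ∨ j.1 < k) → A i j = (1 : Matrix (Fin n) (Fin n) K) i j}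

lemma eq_one_of_mem_unimodularFrom {K : Type} [Field K] {A : Matrix (Fin n) (Fin n) K}
    (hA : A ∈ unimodularFrom (n - 1) K) : A = 1 := by
  have hd : A = diagonal fun i ↦ A i i := by
    ext i j
    by_cases h : i = j
    · subst h; simp
    · rw [hA.2 i j (by omega), one_apply_ne h, diagonal_apply_ne _ h]
  have hdet := hA.1
  rw [hd, det_diagonal] at hdet
  ext i j
  by_cases h : i = j
  · subst h
    by_cases hi : i.1 < n - 1
    · exact hA.2 i i (Or.inl hi)
    · rw [one_apply_eq, ← hdet]
      refine (Finset.prod_eq_single_of_mem (f := fun i ↦ A i i) i (Finset.mem_univ _)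
        fun j _ hj ↦ ?_).symm
      rw [hA.2 j j (by omega), one_apply_eq]
  · rw [hd, diagonal_apply_ne _ h, one_apply_ne h]

lemma isPolyParametrized_unimodularFrom_of_succ {k : ℕ} (hk : k + 1 < n)
    (h : IsPolyParametrized (n := n) (unimodularFrom (k + 1))) :
    IsPolyParametrized (n := n) (unimodularFrom k) := by
  obtain ⟨κ, hκ⟩ : ∃ κ : Fin n, κ.1 = k := ⟨⟨k, by omega⟩, rfl⟩
  have h3 : IsPolyParametrized (n := n) fun K _ ↦
      {A ∈ unimodularFrom k K | ∀ i, A i κ = (1 : Matrix (Fin n) (Fin n) K) i κ} := by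
    refine h.of_mul_row κ fun K _ A hA ↦ ?_
    refine ⟨fun j ↦ if j = κ then 0 else - A κ j, by simp, ?_, fun i j hij ↦ ?_⟩
    · rw [det_mul, det_transpose, det_one_add_vecMulVec_single (by simp), hA.1.1, mul_one]
    rw [← transpose_apply (_ * _), transpose_mul, transpose_transpose,
      one_add_vecMulVec_single_mul_apply, transpose_apply, transpose_apply, hA.2]
    by_cases hj : j = κ
    · subst hj; simp [hA.2]
    by_cases hi : i = κ
    · subst hi; simp [hj, Ne.symm hj]
    simp only [hj, if_false, one_apply_ne hi, mul_zero, add_zero]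
    have hi' : i.1 ≠ k := fun h ↦ hi (Fin.ext (h.trans hκ.symm))
    have hj' : j.1 ≠ k := fun h ↦ hj (Fin.ext (h.trans hκ.symm))
    exact hA.1.2 i j (by omega)
  have h2 : IsPolyParametrized (n := n) fun K _ ↦
      {A ∈ unimodularFrom k K | A κ κ = 1} := by
    refine h3.of_column_mul κ fun K _ A hA ↦ ?_
    refine ⟨fun i ↦ if i = κ then 0 else - A i κ, by simp, ⟨?_, fun i j hij ↦ ?_⟩, fun i ↦ ?_⟩
    · rw [det_mul, det_one_add_vecMulVec_single (by simp), hA.1.1, mul_one]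
    · rw [one_add_vecMulVec_single_mul_apply, hA.1.2 i j hij]
      by_cases hi : i = κ
      · simp [hi]
      rcases hij with hij | hij
      · simp [hi, hA.1.2 i κ (Or.inl hij)]
      · have : κ ≠ j := fun h ↦ by simp [← h, hκ] at hij
        simp [hA.1.2 κ j (Or.inr hij), this]
    · rw [one_add_vecMulVec_single_mul_apply, hA.2]
      by_cases hi : i = κ
      · subst hi; simp [hA.2]
      · simp [hi]
  have h1 : IsPolyParametrized (n := n) fun K _ ↦
      {A ∈ unimodularFrom k K | ∃ i, i ≠ κ ∧ A i κ ≠ 0} := by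
    refine h2.of_row_mul κ fun K _ A ⟨hA, l, hl, hlA⟩ ↦ ?_
    have hent (i j : Fin n) : (((1 : Matrix (Fin n) (Fin n) K) +
        vecMulVec (Pi.single l ((1 - A κ κ) / A l κ)) (Pi.single κ 1))ᵀ * A) i j =
          A i j + if i = κ then (1 - A κ κ) / A l κ * A l j else 0 := by
      rw [transpose_add, transpose_one, transpose_vecMulVec, add_mul, one_mul, vecMulVec_mul,
        Matrix.add_apply, vecMulVec_apply]
      by_cases hi : i = κ
      · simp [hi, single_vecMul]
      · simp [hi]
    refine ⟨Pi.single l ((1 - A κ κ) / A l κ), by simp [Ne.symm hl], ⟨?_, fun i j hij ↦ ?_⟩, ?_⟩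
    · rw [det_mul, det_transpose, det_one_add_vecMulVec_single (by simp [Ne.symm hl]), hA.1,
        mul_one]
    · rw [hent, hA.2 i j hij]
      by_cases hi : i = κ
      · have hj : j.1 < k := by
          rcases hij with hij | hij
          · simp [hi, hκ] at hij
          · exact hij
        have hlj : l ≠ j := by
          rintro rfl
          exact hlA (by rw [hA.2 l κ (Or.inl hj), one_apply_ne hl])
        simp [hA.2 l j (Or.inr hj), hlj]
      · simp [hi]
    · rw [hent, if_pos rfl]
      field_simp
      ring
  refine h1.of_column_mul κ fun K _ A hA ↦ ?_
  by_cases hex : ∃ i, i ≠ κ ∧ A i κ ≠ 0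
  · refine ⟨0, rfl, ?_⟩
    have : (1 + vecMulVec 0 (Pi.single κ 1)) * A = A := by simp
    rw [this]
    exact ⟨hA, hex⟩
  · push Not at hex
    have hκA : A κ κ ≠ 0 := by
      intro h0
      have : A.det = 0 := det_eq_zero_of_column_eq_zero κ fun i ↦ by
        by_cases hi : i = κ
        · rw [hi, h0]
        · exact hex i hi
      rw [hA.1] at this
      exact one_ne_zero this
    set l : Fin n := ⟨k + 1, hk⟩ with hl
    have hlκ : l ≠ κ := by
      rw [Ne, Fin.ext_iff, hκ]
      simp [hl]
    refine ⟨Pi.single l 1, by simp [Ne.symm hlκ], ⟨?_, fun i j hij ↦ ?_⟩, l, hlκ, ?_⟩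
    · rw [det_mul, det_one_add_vecMulVec_single (by simp [Ne.symm hlκ]), hA.1, mul_one]
    · rw [one_add_vecMulVec_single_mul_apply, hA.2 i j hij]
      by_cases hi : i = l
      · have hj : j.1 < k := by
          rcases hij with hij | hij
          · simp [hi, hl] at hij
          · exact hij
        have hκj : κ ≠ j := fun h ↦ by simp [← h, hκ] at hj
        simp [hA.2 κ j (Or.inr hj), hκj]
      · simp [hi]
    · rw [one_add_vecMulVec_single_mul_apply, hex l hlκ]
      simpa using hκA

/-- There is an integral polynomial matrix of determinant one whose specializations exhaust the
special linear groups over all fields. -/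
theorem exists_polynomial_parametrization (n : ℕ) :
    ∃ (N : ℕ) (φ : Matrix (Fin n) (Fin n) (MvPolynomial (Fin N) ℤ)), φ.det = 1 ∧
      ∀ (K : Type) [Field K] (A : Matrix (Fin n) (Fin n) K), A.det = 1 →
        ∃ t : Fin N → K, φ.map (aeval t) = A := by
  have hstep : ∀ d, d ≤ n - 1 → IsPolyParametrized (n := n) (unimodularFrom (n - 1 - d)) := by
    intro d
    induction d with
    | zero =>
      intro _
      refine isPolyParametrized_one.of_transpose fun K _ A hA ↦ ?_
      rw [eq_one_of_mem_unimodularFrom hA, transpose_one]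
      exact Set.mem_singleton _
    | succ d ih =>
      intro hd
      refine isPolyParametrized_unimodularFrom_of_succ (by omega) ?_
      rw [show n - 1 - (d + 1) + 1 = n - 1 - d by omega]
      exact ih (by omega)
  obtain ⟨σ, _, φ, hφ, hφ'⟩ := hstep (n - 1) le_rfl
  obtain ⟨N, ⟨e⟩⟩ := Finite.exists_equiv_fin σ
  refine ⟨N, φ.map (rename e), ?_, fun K _ A hA ↦ ?_⟩
  · rw [← AlgHom.mapMatrix_apply, ← AlgHom.map_det, hφ, map_one]
  · obtain ⟨t, ht⟩ := hφ' K A ⟨hA, fun i j hij ↦ by omega⟩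
    refine ⟨t ∘ e.symm, ?_⟩
    rw [← ht]
    ext i j
    simp [aeval_rename, Function.comp_def]

end Parametrization

section Genericity

open Matrix

variable {n : ℕ}

lemma exists_eval_ne_zero {σ K : Type*} [Field K] [Infinite K] {F : MvPolynomial σ K} (hF : F ≠ 0) :
    ∃ x : σ → K, aeval x F ≠ 0 := by
  by_contra! h
  exact hF (MvPolynomial.funext fun x ↦ by rw [map_zero, ← h x, ← coe_aeval_eq_eval]; rfl)

lemma exists_int_eval_ne_zero {σ : Type*} {F : MvPolynomial σ ℚ} (hF : F ≠ 0) :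
    ∃ x : σ → ℤ, aeval (fun l ↦ (x l : ℚ)) F ≠ 0 := by
  by_contra! h
  refine hF (funext_set (fun _ ↦ Set.range ((↑) : ℤ → ℚ))
    (fun _ ↦ Set.infinite_range_of_injective Int.cast_injective) fun x hx ↦ ?_)
  choose y hy using fun l ↦ hx l trivial
  rw [map_zero, ← h y, ← coe_aeval_eq_eval]
  simp only [hy]
  rfl

/-- The entries other than a given diagonal one are algebraically independent on the special
linear group. -/
lemma exists_det_eq_one_aeval_ne_zero (κ : Fin n)
    {F : MvPolynomial {ij : Fin n × Fin n // ij ≠ (κ, κ)} ℚ} (hF : F ≠ 0) :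
    ∃ A : Matrix (Fin n) (Fin n) ℚ, A.det = 1 ∧ aeval (fun ij ↦ A ij.1.1 ij.1.2) F ≠ 0 := by
  let B {R : Type} [CommRing R] (x : {ij : Fin n × Fin n // ij ≠ (κ, κ)} → R) :
    Matrix (Fin n) (Fin n) R := of fun i j ↦ if h : (i, j) ≠ (κ, κ) then x ⟨(i, j), h⟩ else 0
  set μ : MvPolynomial {ij : Fin n × Fin n // ij ≠ (κ, κ)} ℚ :=
    ((B X).updateRow κ (Pi.single κ 1)).det with hμ
  have hμe (x : {ij : Fin n × Fin n // ij ≠ (κ, κ)} → ℚ) :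
      aeval x μ = ((B x).updateRow κ (Pi.single κ 1)).det := by
    rw [hμ, AlgHom.map_det, AlgHom.mapMatrix_apply]
    congr 1
    ext i j
    rw [map_apply, updateRow_apply, updateRow_apply]
    split_ifs with hi
    · by_cases hj : j = κ
      · subst hj; simp
      · simp [hj]
    · simp only [B, of_apply]
      split_ifs <;> simp
  have hμ0 : μ ≠ 0 := by
    intro h0
    have h1 := hμe fun ij ↦ (1 : Matrix (Fin n) (Fin n) ℚ) ij.1.1 ij.1.2
    have h2 : (B fun ij ↦ (1 : Matrix (Fin n) (Fin n) ℚ) ij.1.1 ij.1.2).updateRow κ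
        (Pi.single κ 1) = 1 := by
      ext i j
      rw [updateRow_apply]
      split_ifs with hi
      · subst hi
        rw [one_eq_pi_single]
      · simp [B, hi]
    rw [h0, h2, map_zero, det_one] at h1
    exact zero_ne_one h1
  obtain ⟨x, hx⟩ := exists_eval_ne_zero (mul_ne_zero hF hμ0)
  rw [map_mul, hμe] at hx
  have hx1 := left_ne_zero_of_mul hx
  have hx2 := right_ne_zero_of_mul hx
  set c := (1 - (B x).det) / ((B x).updateRow κ (Pi.single κ 1)).det with hc
  refine ⟨(B x).updateRow κ (B x κ + c • Pi.single κ 1), ?_, ?_⟩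
  · rw [det_updateRow_add, updateRow_eq_self, det_updateRow_smul, hc]
    field_simp
    ring
  · have hBx : (fun ij : {ij : Fin n × Fin n // ij ≠ (κ, κ)} ↦
        (B x).updateRow κ (B x κ + c • Pi.single κ 1) ij.1.1 ij.1.2) = x := by
      ext ⟨⟨i, j⟩, hij⟩
      rw [updateRow_apply]
      split_ifs with hi
      · have hi' : i = κ := hi
        subst hi'
        have hj : j ≠ i := fun hj ↦ hij (by rw [hj])
        simp [B, hj]
      · exact dif_pos hij
    rwa [hBx]

lemma exists_int_matrix_aeval_ne_zero {N : ℕ} {φ : Matrix (Fin n) (Fin n) (MvPolynomial (Fin N) ℤ)}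
    (hφ : φ.det = 1)
    (hφ' : ∀ A : Matrix (Fin n) (Fin n) ℚ, A.det = 1 → ∃ t : Fin N → ℚ, φ.map (aeval t) = A)
    (κ : Fin n) {F : MvPolynomial {ij : Fin n × Fin n // ij ≠ (κ, κ)} ℚ} (hF : F ≠ 0) :
    ∃ γ : Matrix (Fin n) (Fin n) ℤ, γ.det = 1 ∧
      aeval (fun ij ↦ (γ ij.1.1 ij.1.2 : ℚ)) F ≠ 0 := by
  obtain ⟨A, hA, hAF⟩ := exists_det_eq_one_aeval_ne_zero κ hF
  obtain ⟨t, rfl⟩ := hφ' A hA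
  set F' : MvPolynomial (Fin N) ℚ :=
    aeval (fun ij ↦ map (Int.castRingHom ℚ) (φ ij.1.1 ij.1.2)) F with hF'
  have hF'e (s : Fin N → ℚ) : aeval s F' = aeval (fun ij ↦ φ.map (aeval s) ij.1.1 ij.1.2) F := by
    rw [hF', comp_aeval_apply]
    congr! 3 with ij
    rw [map_apply, aeval_def, eval₂_map]
    rfl
  have hF'0 : F' ≠ 0 := by
    intro h0
    rw [← hF'e, h0, map_zero] at hAF
    exact hAF rfl
  obtain ⟨s, hs⟩ := exists_int_eval_ne_zero hF'0
  refine ⟨φ.map (aeval s), ?_, ?_⟩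
  · rw [← AlgHom.mapMatrix_apply, ← AlgHom.map_det, hφ, map_one]
  · rw [hF'e] at hs
    convert hs with ij
    simp only [map_apply]
    exact comp_aeval_apply s (Int.castRingHom ℚ).toIntAlgHom _

/-- Clearing denominators in an ideal of polynomials with rational coefficients. -/
lemma exists_mem_map_eq_C_mul {σ : Type*} {I : Ideal (MvPolynomial σ ℤ)} {h : MvPolynomial σ ℚ}
    (hh : h ∈ I.map (map (Int.castRingHom ℚ))) :
    ∃ f ∈ I, ∃ d : ℤ, d ≠ 0 ∧ map (Int.castRingHom ℚ) f = C (d : ℚ) * h := by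
  let := algebraMvPolynomial (σ := σ) (R := ℤ) (S := ℚ)
  have : IsLocalization (Submonoid.map C (nonZeroDivisors ℤ)) (MvPolynomial σ ℚ) :=
    MvPolynomial.isLocalization _ _
  obtain ⟨⟨f, ⟨_, d, hd, rfl⟩⟩, hfd⟩ := (IsLocalization.mem_map_algebraMap_iff
    (Submonoid.map C (nonZeroDivisors ℤ)) (MvPolynomial σ ℚ)).1 hh
  refine ⟨f, f.2, d, nonZeroDivisors.ne_zero hd, ?_⟩
  rw [mul_comm]
  refine hfd.symm.trans ?_
  congr 1
  exact map_C _ _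

lemma exists_mem_degreeOf_eq_zero_of_rat {σ : Type*} {I : Ideal (MvPolynomial σ ℤ)}
    {h : MvPolynomial σ ℚ} (hh : h ∈ I.map (map (Int.castRingHom ℚ))) (h0 : h ≠ 0) {j : σ}
    (hj : degreeOf j h = 0) : ∃ f ∈ I, f ≠ 0 ∧ degreeOf j f = 0 := by
  obtain ⟨f, hf, d, hd, hfd⟩ := exists_mem_map_eq_C_mul hh
  have hinj : Function.Injective (Int.castRingHom ℚ) := Int.cast_injective
  have hd' : (d : ℚ) ≠ 0 := by exact_mod_cast hd
  refine ⟨f, hf, ?_, ?_⟩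
  · rintro rfl
    rw [map_zero, eq_comm, mul_eq_zero, C_eq_zero] at hfd
    exact hfd.elim hd' h0
  · by_contra hfj
    rw [← Ne, ← mem_vars_iff_degreeOf_ne_zero,
      ← vars_map_of_injective f hinj, hfd, vars_C_mul _ hd', mem_vars_iff_degreeOf_ne_zero] at hfj
    exact hfj hj

/-- If a quotient of the coordinate ring of the special linear group has codimension at least two,
then for a universal matrix `Z` over it and a polynomial matrix `φ`, the entries of `Z φ⁻¹`
together with all but one of the parameters are algebraically dependent. -/
lemma exists_algebraic_relation (hn : 2 ≤ n) (κ : Fin n) {N : ℕ} (j : Fin N) {B : Type} [CommRing B]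
    [Algebra ℚ B] [Algebra.FiniteType ℚ B]
    (hB : ringKrullDim B ≤ ((n ^ 2 - 3 : ℕ) : WithBot (WithTop ℕ)))
    (Y : Matrix (Fin n) (Fin n) (MvPolynomial (Fin N) B)) :
    ∃ H : MvPolynomial ({ij : Fin n × Fin n // ij ≠ (κ, κ)} ⊕ {l : Fin N // l ≠ j}) ℚ, H ≠ 0 ∧
      aeval (Sum.elim (fun ij ↦ Y ij.1.1 ij.1.2) fun l ↦ X l.1) H = 0 := by
  have hdep : ¬ AlgebraicIndependent ℚ (Sum.elim
      (fun ij : {ij : Fin n × Fin n // ij ≠ (κ, κ)} ↦ Y ij.1.1 ij.1.2)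
      fun l : {l : Fin N // l ≠ j} ↦ X l.1) := by
    intro hind
    have : IsNoetherianRing B := Algebra.FiniteType.isNoetherianRing ℚ B
    have h1 := hind.natCard_le_ringKrullDim
    rw [MvPolynomial.ringKrullDim_of_isNoetherianRing] at h1
    have h2 : _ ≤ ((n ^ 2 - 3 : ℕ) : WithBot ℕ∞) + _ := h1.trans (add_le_add_left hB _)
    have h3 : Nat.card {ij : Fin n × Fin n // ij ≠ (κ, κ)} = n ^ 2 - 1 := by
      rw [Nat.card_eq_fintype_card, Fintype.card_subtype_compl]
      simp [sq]
    have h4 : Nat.card {l : Fin N // l ≠ j} = N - 1 := by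
      rw [Nat.card_eq_fintype_card, Fintype.card_subtype_compl]
      simp
    rw [Nat.card_sum, h3, h4, Nat.card_fin] at h2
    have h5 : n ^ 2 - 1 + (N - 1) ≤ n ^ 2 - 3 + N := by exact_mod_cast h2
    have := j.pos
    have : 4 ≤ n ^ 2 := by nlinarith
    omega
  rw [algebraicIndependent_iff] at hdep
  push Not at hdep
  obtain ⟨H, hH, hH0⟩ := hdep
  exact ⟨H, hH0, hH⟩

lemma RingHom.map_aeval_rat {R R' σ : Type*} [CommSemiring R] [CommSemiring R'] [Algebra ℚ R]
    [Algebra ℚ R'] (f : R →+* R') (v : σ → R) (H : MvPolynomial σ ℚ) :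
    f (aeval v H) = aeval (fun l ↦ f (v l)) H := by
  rw [aeval_def, aeval_def, hom_eval₂]
  congr 1
  exact RingHom.ext_rat _ _

lemma RingHom.map_aeval_int {R R' σ : Type*} [CommSemiring R] [CommSemiring R'] [Algebra ℤ R]
    [Algebra ℤ R'] (f : R →+* R') (v : σ → R) (H : MvPolynomial σ ℤ) :
    f (aeval v H) = aeval (fun l ↦ f (v l)) H := by
  rw [aeval_def, aeval_def, hom_eval₂]
  congr 1
  exact RingHom.ext_int _ _

lemma aeval_eq_zero_of_map_eq {N : ℕ} {φ : Matrix (Fin n) (Fin n) (MvPolynomial (Fin N) ℤ)}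
    (hφ : φ.det = 1) {B E ι : Type} [CommRing B] [Algebra ℚ B] [CommRing E] [Algebra ℚ E]
    (θ : B →+* E) (u : Fin N → E) {Z : Matrix (Fin n) (Fin n) B} {γ : Matrix (Fin n) (Fin n) ℤ}
    (hZ : Z.map θ = γ.map (Int.castRingHom E) * φ.map (aeval u)) {s : ι → Fin n × Fin n}
    {P : Fin N → Prop} {H : MvPolynomial (ι ⊕ {l : Fin N // P l}) ℚ}
    (hH : aeval (Sum.elim (fun ij ↦ (Z.map C * (φ.map (aeval X)).adjugate :
      Matrix (Fin n) (Fin n) (MvPolynomial (Fin N) B)) (s ij).1 (s ij).2) fun l ↦ X l.1) H = 0) :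
    aeval (Sum.elim (fun ij ↦ (γ (s ij).1 (s ij).2 : E)) fun l ↦ u l.1) H = 0 := by
  set Θ : MvPolynomial (Fin N) B →+* E := eval₂Hom θ u with hΘ
  have hφu : (φ.map (aeval u)).det = 1 := by
    rw [← AlgHom.mapMatrix_apply, ← AlgHom.map_det, hφ, map_one]
  have hΘZ : Θ.mapMatrix (Z.map C) = γ.map (Int.castRingHom E) * φ.map (aeval u) := by
    rw [← hZ]
    ext i j
    simp [hΘ]
  have hΘφ : Θ.mapMatrix (φ.map (aeval X)) = φ.map (aeval u) := by
    ext i j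
    rw [RingHom.mapMatrix_apply, map_apply, map_apply, map_apply, RingHom.map_aeval_int]
    simp [hΘ]
  have hΘY : Θ.mapMatrix (Z.map C * (φ.map (aeval X)).adjugate) = γ.map (Int.castRingHom E) := by
    rw [map_mul, RingHom.map_adjugate, hΘφ, hΘZ, mul_assoc, mul_adjugate, hφu, one_smul, mul_one]
  have h1 := congrArg Θ hH
  rw [RingHom.map_aeval_rat, map_zero] at h1
  rw [← h1]
  congr! 2
  ext (ij | l)
  · exact (congrFun (congrFun hΘY (s ij).1) (s ij).2).symm
  · simp [hΘ]

/-- The translate of a polynomial matrix by an integral matrix. -/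
noncomputable def translateMatrix {N : ℕ} (γ : Matrix (Fin n) (Fin n) ℤ)
    (φ : Matrix (Fin n) (Fin n) (MvPolynomial (Fin N) ℤ)) :
    Matrix (Fin n) (Fin n) (MvPolynomial (Fin N) ℤ) :=
  γ.map C * φ

lemma exists_translate (hn : 2 ≤ n) {m : ℕ} (g : Fin m → MvPolynomial (Fin n × Fin n) ℤ)
    (hdim : ringKrullDim
        (MvPolynomial (Fin n × Fin n) ℚ ⧸
          Ideal.span
            ({(Matrix.of fun i j : Fin n => MvPolynomial.X (i, j)).det - 1} ∪
              Set.range fun i => (g i).map (Int.castRingHom ℚ))) ≤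
      ((n ^ 2 - 3 : ℕ) : WithBot (WithTop ℕ)))
    {N : ℕ} {φ : Matrix (Fin n) (Fin n) (MvPolynomial (Fin N) ℤ)} (hφ : φ.det = 1)
    (hφ' : ∀ A : Matrix (Fin n) (Fin n) ℚ, A.det = 1 → ∃ t : Fin N → ℚ, φ.map (aeval t) = A) :
    ∃ γ : Matrix (Fin n) (Fin n) ℤ, γ.det = 1 ∧ ∀ j : Fin N,
      ∃ h ∈ Ideal.span (Set.range fun i ↦
        aeval (fun ij : Fin n × Fin n ↦ translateMatrix γ φ ij.1 ij.2) (g i)),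
        h ≠ 0 ∧ degreeOf j h = 0 := by
  set J := Ideal.span
    ({(Matrix.of fun i j : Fin n => (MvPolynomial.X (i, j) : MvPolynomial (Fin n × Fin n) ℚ)).det
      - 1} ∪ Set.range fun i => (g i).map (Int.castRingHom ℚ)) with hJ
  set κ : Fin n := ⟨0, by omega⟩
  set Z : Matrix (Fin n) (Fin n) (MvPolynomial (Fin n × Fin n) ℚ ⧸ J) :=
    of fun i j ↦ Ideal.Quotient.mk J (X (i, j)) with hZ
  choose H hH0 hH using fun j : Fin N ↦
    exists_algebraic_relation hn κ j hdim (Z.map C * (φ.map (aeval X)).adjugate)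
  choose x hx using fun j ↦ exists_eval_ne_zero (hH0 j)
  set F : Fin N → MvPolynomial {ij : Fin n × Fin n // ij ≠ (κ, κ)} ℚ := fun j ↦
    aeval (Sum.elim X fun l ↦ C (x j (Sum.inr l))) (H j) with hF
  have hFe (j : Fin N) (y : {ij : Fin n × Fin n // ij ≠ (κ, κ)} → ℚ) :
      aeval y (F j) = aeval (Sum.elim y fun l ↦ x j (Sum.inr l)) (H j) := by
    rw [hF, comp_aeval_apply]
    congr! 2
    ext (_ | _) <;> simp
  have hF0 : ∏ j, F j ≠ 0 := by
    refine Finset.prod_ne_zero_iff.2 fun j _ h0 ↦ hx j ?_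
    have := hFe j fun ij ↦ x j (Sum.inl ij)
    rw [h0, map_zero] at this
    rw [this]
    congr! 2
    ext (_ | _) <;> simp
  obtain ⟨γ, hγ, hγF⟩ := exists_int_matrix_aeval_ne_zero hφ hφ' κ hF0
  refine ⟨γ, hγ, fun j ↦ ?_⟩
  set I := Ideal.span (Set.range fun i ↦
    aeval (fun ij : Fin n × Fin n ↦ translateMatrix γ φ ij.1 ij.2) (g i)) with hI
  set h' : MvPolynomial {l : Fin N // l ≠ j} ℚ :=
    aeval (Sum.elim (fun ij ↦ C (γ ij.1.1 ij.1.2 : ℚ)) X) (H j) with hh'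
  have hh'0 : h' ≠ 0 := by
    intro h0
    have h1 : aeval (fun l ↦ x j (Sum.inr l)) h' =
        aeval (Sum.elim (fun ij ↦ (γ ij.1.1 ij.1.2 : ℚ)) fun l ↦ x j (Sum.inr l)) (H j) := by
      rw [hh', comp_aeval_apply]
      congr! 2
      ext (_ | _) <;> simp
    rw [h0, map_zero, ← hFe] at h1
    rw [map_prod] at hγF
    exact hγF (Finset.prod_eq_zero (Finset.mem_univ j) h1.symm)
  refine exists_mem_degreeOf_eq_zero_of_rat (h := rename Subtype.val h') ?_ ?_ ?_
  · set E := MvPolynomial (Fin N) ℚ ⧸ I.map (map (Int.castRingHom ℚ))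
    set π : MvPolynomial (Fin N) ℚ →+* E := Ideal.Quotient.mk _ with hπ
    set φE : Matrix (Fin n) (Fin n) E := φ.map (aeval fun l ↦ π (X l)) with hφE
    have hφEdet : φE.det = 1 := by
      rw [hφE, ← AlgHom.mapMatrix_apply, ← AlgHom.map_det, hφ, map_one]
    set γE : Matrix (Fin n) (Fin n) E := γ.map (Int.castRingHom E) with hγE
    have hγEdet : γE.det = 1 := by
      rw [hγE, ← RingHom.mapMatrix_apply, ← RingHom.map_det, hγ, map_one]
    set θ₀ : MvPolynomial (Fin n × Fin n) ℚ →+* E :=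
      (aeval (fun ij : Fin n × Fin n ↦ (γE * φE) ij.1 ij.2)).toRingHom with hθ₀
    have hθ₀J : ∀ a ∈ J, θ₀ a = 0 := by
      suffices J ≤ RingHom.ker θ₀ from fun a ha ↦ this ha
      rw [hJ, Ideal.span_le]
      rintro _ (rfl | ⟨i, rfl⟩)
      · rw [SetLike.mem_coe, RingHom.mem_ker, map_sub, map_one, RingHom.map_det, sub_eq_zero]
        trans (γE * φE).det
        · congr 1
          ext i j
          simp [θ₀]
        · rw [det_mul, hφEdet, hγEdet, one_mul]
      · rw [SetLike.mem_coe, RingHom.mem_ker]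
        have h1 : π (map (Int.castRingHom ℚ)
            (aeval (fun ij : Fin n × Fin n ↦ translateMatrix γ φ ij.1 ij.2) (g i))) = 0 :=
          Ideal.Quotient.eq_zero_iff_mem.2 (Ideal.mem_map_of_mem _
            (Ideal.subset_span ⟨i, rfl⟩))
        set Ψ : MvPolynomial (Fin N) ℤ →+* E := π.comp (map (Int.castRingHom ℚ)) with hΨ
        have hΨφ : Ψ.mapMatrix (translateMatrix γ φ) = γE * φE := by
          rw [translateMatrix, map_mul]
          congr 1
          · ext i j
            simp [γE, Ψ]
          · ext i j
            rw [RingHom.mapMatrix_apply, map_apply, hφE, map_apply]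
            conv_lhs => rw [← aeval_X_left_apply (φ i j)]
            rw [RingHom.map_aeval_int]
            simp [Ψ]
        have h2 : Ψ (aeval (fun ij : Fin n × Fin n ↦ translateMatrix γ φ ij.1 ij.2) (g i)) = 0 := h1
        rw [RingHom.map_aeval_int] at h2
        rw [← h2]
        beta_reduce
        conv_lhs => rw [← aeval_X_left_apply (g i)]
        rw [← RingHom.comp_apply, RingHom.map_aeval_int]
        congr! 3 with ij
        rw [RingHom.comp_apply, map_X]
        trans (γE * φE) ij.1 ij.2
        · simp [θ₀]
        · rw [← hΨφ]; rfl
    have hZθ : Z.map (Ideal.Quotient.lift J θ₀ hθ₀J) = γE * φE := by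
      ext i j
      simp [hZ, hθ₀]
    have h1 := aeval_eq_zero_of_map_eq hφ (Ideal.Quotient.lift J θ₀ hθ₀J) (fun l ↦ π (X l)) hZθ
      (hH j)
    refine Ideal.Quotient.eq_zero_iff_mem.1 (Eq.trans ?_ h1)
    change π _ = _
    rw [hh', ← AlgHom.coe_toRingHom (rename _), ← RingHom.comp_apply, RingHom.map_aeval_rat]
    congr! 2
    ext (ij | l) <;> simp
  · rwa [Ne, map_eq_zero_iff _ (rename_injective _ Subtype.val_injective)]
  · classical
    by_contra hj
    rw [← Ne, ← mem_vars_iff_degreeOf_ne_zero] at hj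
    obtain ⟨l, -, hl⟩ := Finset.mem_image.1 (vars_rename _ _ hj)
    exact l.2 hl

end Genericity

section Approximation

open Matrix

variable {n N : ℕ}

lemma map_aeval_translateMatrix (γ : Matrix (Fin n) (Fin n) ℤ)
    (φ : Matrix (Fin n) (Fin n) (MvPolynomial (Fin N) ℤ)) {R : Type*} [CommRing R] (t : Fin N → R) :
    (translateMatrix γ φ).map (aeval t) = γ.map (Int.castRingHom R) * φ.map (aeval t) := by
  have : (γ.map C).map (aeval t : MvPolynomial (Fin N) ℤ →ₐ[ℤ] R) = γ.map (Int.castRingHom R) := by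
    ext i j
    simp
  rw [translateMatrix, Matrix.map_mul, this]

lemma det_translateMatrix {γ : Matrix (Fin n) (Fin n) ℤ} (hγ : γ.det = 1)
    {φ : Matrix (Fin n) (Fin n) (MvPolynomial (Fin N) ℤ)} (hφ : φ.det = 1) :
    (translateMatrix γ φ).det = 1 := by
  rw [translateMatrix, det_mul, hφ, ← RingHom.mapMatrix_apply, ← RingHom.map_det, hγ, map_one,
    one_mul]

lemma exists_map_translateMatrix_eq {γ : Matrix (Fin n) (Fin n) ℤ} (hγ : γ.det = 1)
    {φ : Matrix (Fin n) (Fin n) (MvPolynomial (Fin N) ℤ)} {K : Type*} [Field K]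
    (hφ : ∀ A : Matrix (Fin n) (Fin n) K, A.det = 1 → ∃ t : Fin N → K, φ.map (aeval t) = A)
    {A : Matrix (Fin n) (Fin n) K} (hA : A.det = 1) :
    ∃ t : Fin N → K, (translateMatrix γ φ).map (aeval t) = A := by
  have hγK : (γ.map (Int.castRingHom K)).det = 1 := by
    rw [← RingHom.mapMatrix_apply, ← RingHom.map_det, hγ, map_one]
  obtain ⟨t, ht⟩ := hφ ((γ.map (Int.castRingHom K)).adjugate * A) (by
    rw [det_mul, det_adjugate, hγK, one_pow, one_mul, hA])
  refine ⟨t, ?_⟩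
  rw [map_aeval_translateMatrix, ht, ← mul_assoc, mul_adjugate, hγK, one_smul, one_mul]

lemma exists_rat_approx {L : Type*} [NormedField L] [CharZero L]
    (hL : DenseRange ((↑) : ℚ → L)) (Φ : Matrix (Fin n) (Fin n) (MvPolynomial (Fin N) ℤ))
    (t : Fin N → L) {ε : ℝ} (hε : 0 < ε) :
    ∃ (a : Fin N → ℚ) (δ : ℚ), 0 < δ ∧ ∀ s : Fin N → ℚ,
      (∀ j, ‖((s j - a j : ℚ) : L)‖ < δ) →
        ∀ k l, ‖((aeval s (Φ k l) : ℚ) : L) - aeval t (Φ k l)‖ < ε := by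
  have hcont (f : MvPolynomial (Fin N) ℤ) : Continuous fun s : Fin N → L ↦ aeval s f := by
    have h (s : Fin N → L) : aeval s f = eval s (map (Int.castRingHom L) f) := by
      rw [eval_map]; rfl
    simp only [h]
    exact continuous_eval _
  have hopen : IsOpen {s : Fin N → L | ∀ k l, ‖aeval s (Φ k l) - aeval t (Φ k l)‖ < ε} := by
    simp only [Set.ofPred_forall]
    exact isOpen_iInter_of_finite fun k ↦ isOpen_iInter_of_finite fun l ↦
      isOpen_lt ((hcont _).sub continuous_const).norm continuous_const
  obtain ⟨r, hr, hball⟩ := Metric.isOpen_iff.1 hopen t (by simpa using fun _ _ ↦ hε)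
  obtain ⟨δ, hδ0, hδr⟩ := exists_rat_btwn (half_pos hr)
  choose a ha using fun j ↦ Metric.denseRange_iff.1 hL (t j) (r / 2) (half_pos hr)
  refine ⟨a, δ, by exact_mod_cast hδ0, fun s hs ↦ ?_⟩
  have hmem : (fun j ↦ (s j : L)) ∈ Metric.ball t r := by
    refine (dist_pi_lt_iff hr).2 fun j ↦ ?_
    have h1 := (hs j).trans hδr
    rw [Rat.cast_sub, ← dist_eq_norm] at h1
    have h2 := ha j
    rw [dist_comm] at h2
    linarith [dist_triangle (s j : L) (a j) (t j)]
  intro k l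
  have h3 : ((aeval s (Φ k l) : ℚ) : L) = aeval (fun j ↦ (s j : L)) (Φ k l) :=
    RingHom.map_aeval_int (Rat.castHom L) s (Φ k l)
  rw [h3]
  exact hball hmem k l

lemma exists_pos_le_of_finset (S : Finset ℕ) (δ : ℕ → ℚ) (hδ : ∀ p ∈ S, 0 < δ p) {δ₀ : ℚ}
    (hδ₀ : 0 < δ₀) : ∃ ε : ℚ, 0 < ε ∧ ε ≤ δ₀ ∧ ∀ p ∈ S, ε ≤ δ p := by
  classical
  have hne : (insert δ₀ (S.image δ)).Nonempty := Finset.insert_nonempty _ _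
  refine ⟨(insert δ₀ (S.image δ)).min' hne, ?_, Finset.min'_le _ _ (Finset.mem_insert_self _ _),
    fun p hp ↦ Finset.min'_le _ _ (Finset.mem_insert_of_mem (Finset.mem_image_of_mem _ hp))⟩
  rw [Finset.lt_min'_iff]
  intro x hx
  rcases Finset.mem_insert.1 hx with rfl | hx
  · exact hδ₀
  · obtain ⟨p, hp, rfl⟩ := Finset.mem_image.1 hx
    exact hδ p hp

end Approximation

/-- **Theorem 1.3 for `SL_n` over `ℚ`, off a finite place `p₀`.**  Let `Z ⊂ SL_n`
be a closed subset of codimension at least `2`, cut out by polynomials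
`g₁, …, g_m ∈ ℤ[x₁₁, …, x_nn]`.  Given local points avoiding `Z` at the real place
and at the primes of a finite set `S` (with `p₀ ∉ S`), and integral points with
`max_i |g_i|_p = 1` at all other primes `p ≠ p₀`, there is a rational point
`γ ∈ SL_n(ℚ)` approximating the given local points at `∞` and `S`, and integral
with `max_i |g_i(γ)|_p = 1` at every prime `p ∉ S ∪ {p₀}`. -/
theorem stmt_2 (n : ℕ) (hn : 2 ≤ n) (p₀ : ℕ) (hp₀ : p₀.Prime)
    (m : ℕ) (hm : 1 ≤ m) (g : Fin m → MvPolynomial (Fin n × Fin n) ℤ)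
    -- codimension ≥ 2 : the Krull dimension of ℚ[SL_n]/(g₁,…,g_m) is ≤ n² - 3
    (hdim : ringKrullDim
        (MvPolynomial (Fin n × Fin n) ℚ ⧸
          Ideal.span
            ({(Matrix.of fun i j : Fin n => MvPolynomial.X (i, j)).det - 1} ∪
              Set.range fun i => (g i).map (Int.castRingHom ℚ))) ≤
      ((n ^ 2 - 3 : ℕ) : WithBot (WithTop ℕ)))
    (S : Finset ℕ) (hS : ∀ p ∈ S, p.Prime) (hp₀S : p₀ ∉ S)
    (ε : ℝ) (hε : 0 < ε)
    -- a real point of SL_n avoiding Z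
    (Ainf : Matrix (Fin n) (Fin n) ℝ) (hAinfdet : Ainf.det = 1)
    (hAinfZ : ∃ i, aeval (fun ij : Fin n × Fin n => Ainf ij.1 ij.2) (g i) ≠ 0)
    -- a p-adic point of SL_n avoiding Z, for each p ∈ S
    (A : (p : ℕ) → [Fact p.Prime] → Matrix (Fin n) (Fin n) ℚ_[p])
    (hA : ∀ (p : ℕ) [Fact p.Prime], p ∈ S →
      (A p).det = 1 ∧ ∃ i, aeval (fun ij : Fin n × Fin n => A p ij.1 ij.2) (g i) ≠ 0)
    -- integral points with max |gᵢ|_p = 1 at all primes p ∉ S ∪ {p₀}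
    (hB : ∀ (p : ℕ) [Fact p.Prime], p ∉ S → p ≠ p₀ →
      ∃ B : Matrix (Fin n) (Fin n) ℤ_[p], B.det = 1 ∧
        (∀ i, ‖aeval (fun ij : Fin n × Fin n => B ij.1 ij.2) (g i)‖ ≤ 1) ∧
        (∃ i, ‖aeval (fun ij : Fin n × Fin n => B ij.1 ij.2) (g i)‖ = 1)) :
    ∃ γ : Matrix (Fin n) (Fin n) ℚ, γ.det = 1 ∧
      (∀ j l, |(γ j l : ℝ) - Ainf j l| < ε) ∧
      (∀ (p : ℕ) [Fact p.Prime], p ∈ S →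
        ∀ j l, ‖((γ j l : ℚ_[p]) - A p j l)‖ < ε) ∧
      (∀ (p : ℕ), p.Prime → p ∉ S → p ≠ p₀ →
        (∀ j l, padicNorm p (γ j l) ≤ 1) ∧
        (∀ i, padicNorm p (aeval (fun ij : Fin n × Fin n => γ ij.1 ij.2) (g i)) ≤ 1) ∧
        (∃ i, padicNorm p (aeval (fun ij : Fin n × Fin n => γ ij.1 ij.2) (g i)) = 1)) := by
  obtain ⟨N, φ, hφ, hφ'⟩ := exists_polynomial_parametrization n
  obtain ⟨γ₀, hγ₀, hdeg⟩ := exists_translate hn g hdim hφ (hφ' ℚ)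
  set Φ := translateMatrix γ₀ φ with hΦ
  set G : Fin m → MvPolynomial (Fin N) ℤ := fun i ↦
    aeval (fun ij : Fin n × Fin n ↦ Φ ij.1 ij.2) (g i) with hG
  have hGe {R : Type} [CommRing R] (t : Fin N → R) (i : Fin m) :
      aeval t (G i) = aeval (fun ij : Fin n × Fin n ↦ Φ.map (aeval t) ij.1 ij.2) (g i) :=
    comp_aeval_apply _ (aeval t) (g i)
  obtain ⟨tinf, htinf⟩ := exists_map_translateMatrix_eq hγ₀ (hφ' ℝ) hAinfdet
  obtain ⟨ainf, δinf, hδinf, hinf⟩ := exists_rat_approx Rat.denseRange_cast Φ tinf hε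
  have hloc (p : ℕ) : ∃ (a : Fin N → ℚ) (δ : ℚ), 0 < δ ∧ ∀ [Fact p.Prime], p ∈ S →
      ∀ s : Fin N → ℚ, (∀ j, padicNorm p (s j - a j) < δ) →
        ∀ k l, ‖((aeval s (Φ k l) : ℚ) : ℚ_[p]) - A p k l‖ < ε := by
    by_cases hp : p ∈ S
    · have : Fact p.Prime := ⟨hS p hp⟩
      obtain ⟨t, ht⟩ := exists_map_translateMatrix_eq hγ₀ (hφ' ℚ_[p]) (hA p hp).1
      obtain ⟨a, δ, hδ, h⟩ := exists_rat_approx (Padic.denseRange_ratCast (p := p)) Φ t hε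
      refine ⟨a, δ, hδ, fun _ s hs k l ↦ ?_⟩
      rw [← ht]
      refine h s (fun j ↦ ?_) k l
      rw [Padic.eq_padicNorm]
      exact_mod_cast hs j
    · exact ⟨0, 1, one_pos, fun h ↦ (hp h).elim⟩
  choose a δ hδ hloc using hloc
  obtain ⟨ε', hε', hε'inf, hε'S⟩ := exists_pos_le_of_finset S δ (fun p _ ↦ hδ p) hδinf
  obtain ⟨t, ht1, ht2, ht3⟩ := exists_rat_point_close hp₀ N (Ideal.span (Set.range G)) hdeg S hS
    hp₀S ainf a ε' hε' (by
      intro p _ hpS hp0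
      obtain ⟨B, hBdet, -, i, hi⟩ := hB p hpS hp0
      obtain ⟨τ, hτ⟩ := exists_map_translateMatrix_eq hγ₀ (hφ' (ZMod p))
        (A := PadicInt.toZMod.mapMatrix B) (by rw [← RingHom.map_det, hBdet, map_one])
      refine ⟨τ, G i, Ideal.subset_span ⟨i, rfl⟩, ?_⟩
      have h1 : aeval τ (G i) =
          PadicInt.toZMod (aeval (fun ij : Fin n × Fin n ↦ B ij.1 ij.2) (g i)) := by
        rw [hGe, hτ, RingHom.map_aeval_int]
        rfl
      rw [h1, Ne, ← RingHom.mem_ker, PadicInt.ker_toZMod, IsLocalRing.mem_maximalIdeal,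
        PadicInt.mem_nonunits, hi]
      exact lt_irrefl 1)
  refine ⟨Φ.map (aeval t), ?_, fun k l ↦ ?_, fun p _ hp k l ↦ ?_, fun p hp hpS hp0 ↦ ?_⟩
  · rw [← AlgHom.mapMatrix_apply, ← AlgHom.map_det, det_translateMatrix hγ₀ hφ, map_one]
  · rw [← htinf, ← Real.norm_eq_abs]
    refine hinf t (fun j ↦ ?_) k l
    rw [Real.norm_eq_abs]
    exact_mod_cast (ht1 j).trans_le hε'inf
  · exact hloc p hp t (fun j ↦ (ht2 p hp j).trans_le (hε'S p hp)) k l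
  · have : Fact p.Prime := ⟨hp⟩
    obtain ⟨τ, hτ, f, hf, hfτ⟩ := ht3 p hpS hp0
    refine ⟨fun k l ↦ (IsReduction.aeval hτ (Φ k l)).padicNorm_le_one, fun i ↦ ?_, ?_⟩
    · rw [← hGe]
      exact (IsReduction.aeval hτ (G i)).padicNorm_le_one
    · obtain ⟨i, hi⟩ : ∃ i, aeval τ (G i) ≠ 0 := by
        by_contra! h
        have hle : Ideal.span (Set.range G) ≤
            RingHom.ker (aeval τ : MvPolynomial (Fin N) ℤ →ₐ[ℤ] ZMod p) := by
          rw [Ideal.span_le]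
          rintro _ ⟨i, rfl⟩
          exact h i
        exact hfτ (hle hf)
      refine ⟨i, ?_⟩
      rw [← hGe]
      exact (IsReduction.aeval hτ (G i)).padicNorm_eq_one_iff.2 hi
end

section
/- Let K be a number field with ring of integers O_K, and let A be a commutative O_K-algebra that is finitely generated as an O_K-algebra and such that A ⊗_{O_K} K is nonzero. Let d ∈ ℕ be the Krull dimension of the ring A ⊗_{O_K} K. Then there exists a constant C > 0 such that for every maximal ideal 𝔭 of O_K, the number of O_K-algebra homomorphisms from A to the finite residue field O_K/𝔭 satisfies #Hom_{O_K-alg}(A, O_K/𝔭) ≤ C · (#(O_K/𝔭))^d. -/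
set_option synthInstance.maxHeartbeats 400000

open NumberField TensorProduct

/-- Going up: the Krull dimension does not drop along an injective integral extension. -/
theorem ringKrullDim_le_of_isIntegral_of_injective_s4 {R S : Type*} [CommRing R] [CommRing S]
    {f : R →+* S} (hf : f.IsIntegral) (hinj : Function.Injective f) :
    ringKrullDim R ≤ ringKrullDim S := by
  have hsurj := hf.comap_surjective hinj
  algebraize [f]
  refine iSup_le fun l ↦ ?_
  obtain ⟨P, hP⟩ := hsurj l.head
  have : P.asIdeal.LiesOver l.head.asIdeal := ⟨by rw [← hP]; rfl⟩
  obtain ⟨L, hL, -, -⟩ := Ideal.exists_ltSeries_of_hasGoingUp l P.asIdeal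
  rw [← hL]
  exact le_iSup (fun p : LTSeries (PrimeSpectrum S) ↦ (p.length : WithBot ℕ∞)) L

/-- An element that becomes integral over polynomials in `y` over the fraction field satisfies a
polynomial relation with integral coefficients, one of which is a nonzero constant. -/
theorem exists_polynomial_coeff_eq_C_of_isIntegral {R K A σ : Type*} [CommRing R] [IsDomain R]
    [Field K] [Algebra R K] [IsFractionRing R K] [CommRing A] [Algebra R A]
    (y : σ → A)
    (hy : (MvPolynomial.aeval (R := K) (fun i ↦ (1 : K) ⊗ₜ[R] y i)).IsIntegral) (a : A) :
    ∃ (P : Polynomial (MvPolynomial σ R)) (m : ℕ) (N : R), N ≠ 0 ∧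
      P.coeff m = MvPolynomial.C N ∧
      P.eval₂ (MvPolynomial.aeval y : MvPolynomial σ R →ₐ[R] A).toRingHom a = 0 := by
  obtain ⟨p, hp, hpa⟩ := hy ((1 : K) ⊗ₜ[R] a)
  let := MvPolynomial.algebraMvPolynomial (σ := σ) (R := R) (S := K)
  obtain ⟨b, hb, hbp⟩ := IsLocalization.integerNormalization_spec
    ((nonZeroDivisors R).map (MvPolynomial.C (σ := σ))) p
  have heval := IsLocalization.integerNormalization_eval₂_eq_zero
    ((nonZeroDivisors R).map (MvPolynomial.C (σ := σ))) _ p hpa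
  set Q := IsLocalization.integerNormalization
    ((nonZeroDivisors R).map (MvPolynomial.C (σ := σ))) p
  obtain ⟨N, hN, rfl⟩ := hb
  have hcoeff : Q.coeff p.natDegree = MvPolynomial.C N := by
    apply MvPolynomial.map_injective _ (IsFractionRing.injective R K)
    have := congrArg (fun q ↦ q.coeff p.natDegree) hbp
    simpa [Polynomial.coeff_map, Algebra.smul_def, hp.coeff_natDegree] using this
  have hcomp : (MvPolynomial.aeval (R := K) (fun i ↦ (1 : K) ⊗ₜ[R] y i)).toRingHom.comp
      (algebraMap (MvPolynomial σ R) (MvPolynomial σ K)) =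
      (Algebra.TensorProduct.includeRight : A →ₐ[R] K ⊗[R] A).toRingHom.comp
        (MvPolynomial.aeval y : MvPolynomial σ R →ₐ[R] A).toRingHom := by
    rw [MvPolynomial.algebraMap_def]
    ext i <;> simp
  have hzero : TensorProduct.mk R K A 1
      (Q.eval₂ (MvPolynomial.aeval y : MvPolynomial σ R →ₐ[R] A).toRingHom a) = 0 := by
    have h := Polynomial.hom_eval₂ Q
      (MvPolynomial.aeval y : MvPolynomial σ R →ₐ[R] A).toRingHom
      (Algebra.TensorProduct.includeRight : A →ₐ[R] K ⊗[R] A).toRingHom a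
    rw [← hcomp] at h
    exact h.trans heval
  have hloc : IsLocalizedModule (nonZeroDivisors R) (TensorProduct.mk R K A 1) :=
    (isLocalizedModule_iff_isBaseChange (nonZeroDivisors R) K _).mpr
      (TensorProduct.isBaseChange R A K)
  obtain ⟨c, hc⟩ := (IsLocalizedModule.eq_zero_iff (nonZeroDivisors R) _).mp hzero
  refine ⟨Polynomial.C (MvPolynomial.C (c : R)) * Q, p.natDegree, c * N,
    mul_ne_zero (nonZeroDivisors.ne_zero c.2) (nonZeroDivisors.ne_zero hN), ?_, ?_⟩
  · rw [Polynomial.coeff_C_mul, hcoeff, map_mul]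
  · rw [Polynomial.eval₂_mul, Polynomial.eval₂_C]
    simpa [Algebra.smul_def, Submonoid.smul_def] using hc

/-- Noether normalization of the generic fibre can be carried out by elements of the integral
model. -/
theorem exists_isIntegral_aeval_one_tmul (R K A : Type*) [CommRing R] [IsDomain R]
    [Field K] [Algebra R K] [IsFractionRing R K] [CommRing A] [Algebra R A]
    [Algebra.FiniteType R A] [Nontrivial (K ⊗[R] A)] :
    ∃ (s : ℕ) (y : Fin s → A), (s : WithBot ℕ∞) ≤ ringKrullDim (K ⊗[R] A) ∧
      (MvPolynomial.aeval (R := K) (fun i ↦ (1 : K) ⊗ₜ[R] y i)).IsIntegral := by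
  obtain ⟨s, g, hinj, hint⟩ := exists_integral_inj_algHom_of_fg K (K ⊗[R] A)
  have hloc : IsLocalizedModule (nonZeroDivisors R) (TensorProduct.mk R K A 1) :=
    (isLocalizedModule_iff_isBaseChange (nonZeroDivisors R) K _).mpr
      (TensorProduct.isBaseChange R A K)
  have hsurj (i : Fin s) := IsLocalizedModule.surj (nonZeroDivisors R)
    (TensorProduct.mk R K A 1) (g (MvPolynomial.X i))
  choose z hz using hsurj
  refine ⟨s, fun i ↦ (z i).1, ?_, ?_⟩
  · have := ringKrullDim_le_of_isIntegral_of_injective_s4 hint hinj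
    rw [MvPolynomial.ringKrullDim_of_isNoetherianRing] at this
    simpa using this
  · have hg : g = (MvPolynomial.aeval (R := K) (fun i ↦ (1 : K) ⊗ₜ[R] (z i).1)).comp
        (MvPolynomial.aeval fun i ↦
          (algebraMap R K (z i).2)⁻¹ • (MvPolynomial.X i : MvPolynomial (Fin s) K)) := by
      ext i
      have hne : algebraMap R K (z i).2 ≠ 0 :=
        IsFractionRing.to_map_ne_zero_of_mem_nonZeroDivisors (z i).2.2
      have h : algebraMap R K (z i).2 • g (MvPolynomial.X i) = (1 : K) ⊗ₜ[R] (z i).1 := by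
        rw [algebraMap_smul]
        exact hz i
      simp only [AlgHom.comp_apply, MvPolynomial.aeval_X, map_smul, ← h]
      rw [inv_smul_smul₀ hne]
    rw [hg] at hint
    exact RingHom.IsIntegral.tower_top _ _ hint

/-- Counting points through a generically finite projection to affine space. -/
theorem card_algHom_le_prod_natDegree_mul_card_pow {R A F : Type*} [CommRing R] [CommRing A]
    [Algebra R A] [Field F] [Finite F] [Algebra R F] {s : ℕ} (y : Fin s → A)
    (t : Finset A) (ht : Algebra.adjoin R (t : Set A) = ⊤)
    (P : A → Polynomial (MvPolynomial (Fin s) R)) (m : A → ℕ) (N : A → R)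
    (hcoeff : ∀ a, (P a).coeff (m a) = MvPolynomial.C (N a))
    (heval : ∀ a, (P a).eval₂ (MvPolynomial.aeval y : MvPolynomial (Fin s) R →ₐ[R] A).toRingHom a
      = 0)
    (hN : ∀ a ∈ t, algebraMap R F (N a) ≠ 0) :
    Nat.card (A →ₐ[R] F) ≤ (∏ a ∈ t, (P a).natDegree) * Nat.card F ^ s := by
  classical
  have := Fintype.ofFinite F
  let Q (v : Fin s → F) (a : A) : Polynomial F :=
    (P a).map (MvPolynomial.aeval v : MvPolynomial (Fin s) R →ₐ[R] F).toRingHom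
  have hQ (v : Fin s → F) (a : A) (ha : a ∈ t) : Q v a ≠ 0 := by
    intro h
    apply hN a ha
    have := congrArg (fun q ↦ q.coeff (m a)) h
    simpa [Q, Polynomial.coeff_map, hcoeff] using this
  have hroot (φ : A →ₐ[R] F) (a : A) : (Q (fun i ↦ φ (y i)) a).eval (φ a) = 0 := by
    have h := Polynomial.hom_eval₂ (P a)
      (MvPolynomial.aeval y : MvPolynomial (Fin s) R →ₐ[R] A).toRingHom φ.toRingHom a
    have hcomp : φ.toRingHom.comp (MvPolynomial.aeval y : MvPolynomial (Fin s) R →ₐ[R] A).toRingHom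
        = (MvPolynomial.aeval fun i ↦ φ (y i) : MvPolynomial (Fin s) R →ₐ[R] F).toRingHom := by
      ext i <;> simp
    rw [heval, map_zero, hcomp] at h
    rw [Polynomial.eval_map]
    exact h.symm
  let e : (A →ₐ[R] F) → Σ v : Fin s → F, ∀ a : t, (Q v a).roots.toFinset := fun φ ↦
    ⟨fun i ↦ φ (y i), fun a ↦ ⟨φ a, by
      rw [Multiset.mem_toFinset, Polynomial.mem_roots (hQ _ _ a.2)]
      exact hroot φ a⟩⟩
  have he : Function.Injective e := by
    intro φ ψ h
    have hval (a : t) : φ a = ψ a :=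
      congrArg (fun w : Σ v : Fin s → F, ∀ a : t, (Q v a).roots.toFinset ↦ (w.2 a : F)) h
    exact AlgHom.ext_of_adjoin_eq_top ht fun a ha ↦ hval ⟨a, ha⟩
  calc Nat.card (A →ₐ[R] F)
      ≤ Nat.card (Σ v : Fin s → F, ∀ a : t, (Q v a).roots.toFinset) :=
        Nat.card_le_card_of_injective e he
    _ = ∑ v : Fin s → F, ∏ a : t, (Q v a).roots.toFinset.card := by
        simp only [Nat.card_eq_fintype_card, Fintype.card_sigma, Fintype.card_pi, Fintype.card_coe]
    _ ≤ ∑ _v : Fin s → F, ∏ a : t, (P a).natDegree := by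
        refine Finset.sum_le_sum fun v _ ↦ Finset.prod_le_prod' fun a _ ↦ ?_
        exact (Multiset.toFinset_card_le _).trans
          ((Polynomial.card_roots' _).trans Polynomial.natDegree_map_le)
    _ = (∏ a ∈ t, (P a).natDegree) * Nat.card F ^ s := by
        rw [Finset.prod_coe_sort t fun a ↦ (P a).natDegree]
        simp [Nat.card_eq_fintype_card, mul_comm]

/-- A nonzero element of a Dedekind domain lies in only finitely many prime ideals. -/
theorem finite_setOf_isPrime_mem {R : Type*} [CommRing R] [IsDedekindDomain R]
    {x : R} (hx : x ≠ 0) : {p : Ideal R | p.IsPrime ∧ x ∈ p}.Finite := by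
  have hfin := Ideal.finite_factors (R := R) (I := Ideal.span {x}) (by simpa using hx)
  refine (hfin.image IsDedekindDomain.HeightOneSpectrum.asIdeal).subset ?_
  rintro p ⟨hp, hxp⟩
  refine ⟨⟨p, hp, ?_⟩, ?_, rfl⟩
  · rintro rfl
    exact hx (by simpa using hxp)
  · simpa [Ideal.dvd_span_singleton] using hxp

/-- **Corollary 3.5 (uniform Lang–Weil bound).**  Let `K` be a number field, `A` a
finitely generated `O_K`-algebra with `A ⊗ K ≠ 0`, and `d` the Krull dimension of
`A ⊗ K`.  Then there is a constant `C > 0` such that for every maximal ideal `𝔭`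
of `O_K` the number of `O_K`-algebra homomorphisms `A → O_K/𝔭` is at most
`C · (#(O_K/𝔭))^d`. -/
theorem stmt_4 (K : Type*) [Field K] [NumberField K]
    (A : Type*) [CommRing A] [Algebra (𝓞 K) A] [Algebra.FiniteType (𝓞 K) A]
    [Nontrivial (K ⊗[𝓞 K] A)]
    (d : ℕ) (hd : ringKrullDim (K ⊗[𝓞 K] A) = (d : WithBot (WithTop ℕ))) :
    ∃ C : ℝ, 0 < C ∧ ∀ 𝔭 : Ideal (𝓞 K), 𝔭.IsMaximal →
      (Nat.card (A →ₐ[𝓞 K] (𝓞 K ⧸ 𝔭)) : ℝ) ≤ C * (Nat.card (𝓞 K ⧸ 𝔭) : ℝ) ^ d := by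
  obtain ⟨s, y, hs, hy⟩ := exists_isIntegral_aeval_one_tmul (𝓞 K) K A
  have hsd : s ≤ d := by
    rw [hd] at hs
    exact Nat.cast_le (α := WithBot ℕ∞) |>.mp hs
  obtain ⟨t, ht⟩ := (Algebra.FiniteType.out : (⊤ : Subalgebra (𝓞 K) A).FG)
  choose P m N hN hcoeff heval using exists_polynomial_coeff_eq_C_of_isIntegral (K := K) y hy
  have hbad := finite_setOf_isPrime_mem (Finset.prod_ne_zero_iff.mpr fun a (_ : a ∈ t) ↦ hN a)
  let B : ℕ := ∑ 𝔭 ∈ hbad.toFinset, Nat.card (A →ₐ[𝓞 K] (𝓞 K ⧸ 𝔭))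
  refine ⟨(∏ a ∈ t, (P a).natDegree : ℕ) + B + 1, by positivity, fun 𝔭 h𝔭 ↦ ?_⟩
  let _ : Field (𝓞 K ⧸ 𝔭) := Ideal.Quotient.field 𝔭
  have hcard : 1 ≤ Nat.card (𝓞 K ⧸ 𝔭) := Nat.card_pos
  suffices h : Nat.card (A →ₐ[𝓞 K] (𝓞 K ⧸ 𝔭)) ≤
      ((∏ a ∈ t, (P a).natDegree) + B + 1) * Nat.card (𝓞 K ⧸ 𝔭) ^ d by
    exact_mod_cast h
  by_cases hmem : ∏ a ∈ t, N a ∈ 𝔭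
  · calc Nat.card (A →ₐ[𝓞 K] (𝓞 K ⧸ 𝔭)) ≤ B :=
          Finset.single_le_sum (f := fun 𝔮 : Ideal (𝓞 K) ↦ Nat.card (A →ₐ[𝓞 K] (𝓞 K ⧸ 𝔮)))
            (fun _ _ ↦ Nat.zero_le _) (hbad.mem_toFinset.mpr ⟨h𝔭.isPrime, hmem⟩)
      _ ≤ (∏ a ∈ t, (P a).natDegree) + B + 1 := by lia
      _ ≤ _ := Nat.le_mul_of_pos_right _ (pow_pos hcard d)
  · calc Nat.card (A →ₐ[𝓞 K] (𝓞 K ⧸ 𝔭))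
        ≤ (∏ a ∈ t, (P a).natDegree) * Nat.card (𝓞 K ⧸ 𝔭) ^ s := by
          refine card_algHom_le_prod_natDegree_mul_card_pow y t ht P m N hcoeff heval
            fun a ha h ↦ hmem ?_
          exact 𝔭.mem_of_dvd (Finset.dvd_prod_of_mem N ha) (Ideal.Quotient.eq_zero_iff_mem.mp h)
      _ ≤ ((∏ a ∈ t, (P a).natDegree) + B + 1) * Nat.card (𝓞 K ⧸ 𝔭) ^ d := by
          gcongr
          lia
end

section
/- Let n ≥ 2, let S be a finite set of prime numbers, and let ℤ_S ⊆ ℚ be the ring of S-integers (rationals whose denominators have all prime factors in S). Let f ∈ ℤ_S[x₁₁,…,x_{nn}] be a polynomial in the n² matrix entries whose image in the coordinate ring ℚ[x₁₁,…,x_{nn}]/(det(x_{ij}) − 1) of SL_n is nonzero and squarefree. Assume that for every prime p ∉ S there exists B ∈ SL_n(ℤ_p) with |f(B)|_p = 1. For each p ∈ S let Φ_p ⊆ SL_n(ℚ_p) be a compact open subgroup. Then there exists an integer r ≥ 1 such that for every sufficiently large M > 0 there exists g ∈ SL_n(ℤ_S) with: g ∈ Φ_p for every p ∈ S; f(g)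 ≠ 0; every prime p ∉ S dividing f(g) in ℤ_S satisfies p > M; and the total number of prime factors of f(g) in ℤ_S counted with multiplicity (i.e. the sum over primes p ∉ S of the p-adic valuation of f(g)) is at most r. -/
open MvPolynomial

/-- A family `X K` of matrices over fields `K` is covered if a single matrix of determinant one
with integer polynomial entries, specializing to the identity at the origin, attains all of them. -/
def PolynomiallyCovered {n : Type} [Fintype n] [DecidableEq n]
    (X : ∀ (K : Type) [Field K], Set (Matrix n n K)) : Prop :=
  ∃ Γ : Matrix n n (MvPolynomial ℕ ℤ), Γ.det = 1 ∧
    (aeval (0 : ℕ → ℤ)).mapMatrix Γ = 1 ∧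
    ∀ (K : Type) [Field K], ∀ g ∈ X K, ∃ t : ℕ → K, (aeval t).mapMatrix Γ = g

namespace PolynomiallyCovered

variable {n : Type} [Fintype n] [DecidableEq n]
  {X Y : ∀ (K : Type) [Field K], Set (Matrix n n K)}

lemma mono (hY : PolynomiallyCovered Y) (h : ∀ (K : Type) [Field K], X K ⊆ Y K) :
    PolynomiallyCovered X := by
  obtain ⟨Γ, h1, h2, h3⟩ := hY
  exact ⟨Γ, h1, h2, fun K _ g hg => h3 K g (h K hg)⟩

lemma mapMatrix_rename {R : Type} [CommRing R] (Γ : Matrix n n (MvPolynomial ℕ ℤ)) (φ : ℕ → ℕ)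
    (t : ℕ → R) : (aeval t).mapMatrix ((rename φ : _ →ₐ[ℤ] _).mapMatrix Γ) =
      (aeval (t ∘ φ)).mapMatrix Γ := by
  ext i j
  simp [aeval_rename]

lemma mul (hX : PolynomiallyCovered X) (hY : PolynomiallyCovered Y) :
    PolynomiallyCovered (fun K _ => {g | ∃ x ∈ X K, ∃ y ∈ Y K, g = x * y}) := by
  obtain ⟨Γ, h1, h2, h3⟩ := hX
  obtain ⟨Δ, k1, k2, k3⟩ := hY
  refine ⟨(rename (fun i => 2 * i) : _ →ₐ[ℤ] _).mapMatrix Γ *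
    (rename (fun i => 2 * i + 1) : _ →ₐ[ℤ] _).mapMatrix Δ, ?_, ?_, ?_⟩
  · rw [Matrix.det_mul, ← AlgHom.map_det, ← AlgHom.map_det, h1, k1]
    simp
  · rw [map_mul, mapMatrix_rename, mapMatrix_rename]
    have : ∀ φ : ℕ → ℕ, (0 : ℕ → ℤ) ∘ φ = 0 := fun φ => rfl
    rw [this, this, h2, k2, one_mul]
  · rintro K _ g ⟨x, hx, y, hy, rfl⟩
    obtain ⟨s, hs⟩ := h3 K x hx
    obtain ⟨t, ht⟩ := k3 K y hy
    refine ⟨fun i => if i % 2 = 0 then s (i / 2) else t (i / 2), ?_⟩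
    rw [map_mul, mapMatrix_rename, mapMatrix_rename, ← hs, ← ht]
    congr 3
    · congr 1
      funext i
      simp
    · congr 1
      funext i
      have h : (2 * i + 1) / 2 = i := by omega
      simp [h]

lemma reindex {m : Type} [Fintype m] [DecidableEq m] (e : n ≃ m)
    (hX : PolynomiallyCovered (fun K _ => {g : Matrix n n K | g.det = 1})) :
    PolynomiallyCovered (fun K _ => {g : Matrix m m K | g.det = 1}) := by
  obtain ⟨Γ, h1, h2, h3⟩ := hX
  refine ⟨Matrix.reindex e e Γ, by rw [Matrix.det_reindex_self, h1], ?_, ?_⟩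
  · have := congrArg (Matrix.reindex e e) h2
    simpa [Matrix.submatrix_map] using this
  · intro K _ g hg
    obtain ⟨t, ht⟩ := h3 K (Matrix.reindex e.symm e.symm g) (by
      rw [Set.mem_ofPred_eq, Matrix.det_reindex_self]; exact hg)
    refine ⟨t, ?_⟩
    have := congrArg (Matrix.reindex e e) ht
    simpa [Matrix.submatrix_map] using this

variable (r : ℕ)

lemma upper : PolynomiallyCovered (fun K _ => {g | ∃ B : Matrix (Fin r) Unit K,
    g = Matrix.fromBlocks 1 B 0 1}) := by
  refine ⟨Matrix.fromBlocks 1 (Matrix.of fun i _ => X (i : ℕ)) 0 1, by simp, ?_, ?_⟩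
  · ext i j
    rcases i with i | i <;> rcases j with j | j <;> simp [Matrix.one_apply, apply_ite]
  · rintro K _ g ⟨B, rfl⟩
    refine ⟨fun i => if h : i < r then B ⟨i, h⟩ () else 0, ?_⟩
    ext i j
    rcases i with i | i <;> rcases j with j | j <;> simp [Matrix.one_apply, apply_ite]

lemma lower : PolynomiallyCovered (fun K _ => {g | ∃ C : Matrix Unit (Fin r) K,
    g = Matrix.fromBlocks 1 0 C 1}) := by
  refine ⟨Matrix.fromBlocks 1 0 (Matrix.of fun _ i => X (i : ℕ)) 1, by simp, ?_, ?_⟩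
  · ext i j
    rcases i with i | i <;> rcases j with j | j <;> simp [Matrix.one_apply, apply_ite]
  · rintro K _ g ⟨C, rfl⟩
    refine ⟨fun i => if h : i < r then C () ⟨i, h⟩ else 0, ?_⟩
    ext i j
    rcases i with i | i <;> rcases j with j | j <;> simp [Matrix.one_apply, apply_ite]

variable {r}

lemma block (h : PolynomiallyCovered (fun K _ => {g : Matrix (Fin r) (Fin r) K | g.det = 1})) :
    PolynomiallyCovered (fun K _ => {g | ∃ A : Matrix (Fin r) (Fin r) K, A.det = 1 ∧
      g = Matrix.fromBlocks A 0 0 (1 : Matrix Unit Unit K)}) := by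
  obtain ⟨Γ, h1, h2, h3⟩ := h
  have key : ∀ (R : Type) [CommRing R] (t : ℕ → R), (aeval t).mapMatrix
      (Matrix.fromBlocks Γ 0 0 (1 : Matrix Unit Unit (MvPolynomial ℕ ℤ))) =
      Matrix.fromBlocks ((aeval t).mapMatrix Γ) 0 0 1 := by
    intro R _ t
    ext i j
    rcases i with i | i <;> rcases j with j | j <;> simp
  refine ⟨Matrix.fromBlocks Γ 0 0 1, by simp [h1], ?_, ?_⟩
  · rw [key, h2, Matrix.fromBlocks_one]
  · rintro K _ g ⟨A, hA, rfl⟩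
    obtain ⟨t, ht⟩ := h3 K A hA
    exact ⟨t, by rw [key, ht]⟩

lemma exists_unipotent_corner {K : Type} [Field K] (hr : 0 < r)
    (g : Matrix (Fin r ⊕ Unit) (Fin r ⊕ Unit) K) (hg : g.det = 1) :
    ∃ (V : Matrix (Fin r) Unit K) (U : Matrix Unit (Fin r) K),
      U * (g.toBlocks₁₂ + V * g.toBlocks₂₂) + g.toBlocks₂₂ = 1 := by
  have hV : ∃ (V : Matrix (Fin r) Unit K) (i : Fin r),
      (g.toBlocks₁₂ + V * g.toBlocks₂₂) i () ≠ 0 := by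
    by_cases hB : ∃ i, g.toBlocks₁₂ i () ≠ 0
    · obtain ⟨i, hi⟩ := hB
      exact ⟨0, i, by simpa using hi⟩
    · push Not at hB
      have hD : g.toBlocks₂₂ () () ≠ 0 := by
        intro hD
        have : g.det = 0 := by
          apply Matrix.det_eq_zero_of_column_eq_zero (Sum.inr ())
          rintro (i | i)
          · exact hB i
          · exact hD
        rw [hg] at this
        exact one_ne_zero this
      exact ⟨Matrix.of fun _ _ => 1, ⟨0, hr⟩, by
        simpa [Matrix.mul_apply, hB] using hD⟩
  obtain ⟨V, i, hi⟩ := hV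
  refine ⟨V, Matrix.of fun _ k => if k = i then
    (1 - g.toBlocks₂₂ () ()) / (g.toBlocks₁₂ + V * g.toBlocks₂₂) i () else 0, ?_⟩
  ext a b
  rw [Matrix.add_apply, Matrix.mul_apply]
  simp only [Matrix.of_apply, ite_mul, zero_mul, Finset.sum_ite_eq', Finset.mem_univ, if_true]
  obtain rfl : b = () := rfl
  obtain rfl : a = () := rfl
  rw [div_mul_cancel₀ _ hi]
  simp

lemma specialLinear_succ (hr : 0 < r)
    (h : PolynomiallyCovered (fun K _ => {g : Matrix (Fin r) (Fin r) K | g.det = 1})) :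
    PolynomiallyCovered
      (fun K _ => {g : Matrix (Fin r ⊕ Unit) (Fin r ⊕ Unit) K | g.det = 1}) := by
  refine ((upper r).mul ((lower r).mul ((upper r).mul ((block h).mul (lower r))))).mono ?_
  intro K _ g hg
  obtain ⟨V, U, hVU⟩ := exists_unipotent_corner hr g hg
  set A := g.toBlocks₁₁
  set B := g.toBlocks₁₂
  set C := g.toBlocks₂₁
  set D := g.toBlocks₂₂
  have hgb : g = Matrix.fromBlocks A B C D := (Matrix.fromBlocks_toBlocks g).symm
  set A' := A + V * C
  set B' := B + V * D
  set C' := U * A' + C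
  have e1 : Matrix.fromBlocks 1 V 0 1 * g = Matrix.fromBlocks A' B' C D := by
    rw [hgb, Matrix.fromBlocks_multiply]
    simp [A', B']
  have e2 : Matrix.fromBlocks 1 0 U 1 * (Matrix.fromBlocks 1 V 0 1 * g) =
      Matrix.fromBlocks A' B' C' 1 := by
    rw [e1, Matrix.fromBlocks_multiply]
    simp [C', hVU, B']
  have hdet : (A' - B' * C').det = 1 := by
    rw [← Matrix.det_fromBlocks_one₂₂, ← e2]
    simpa using hg
  refine ⟨_, ⟨-V, rfl⟩, _, ⟨_, ⟨-U, rfl⟩, _, ⟨_, ⟨B', rfl⟩, _,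
    ⟨_, ⟨A' - B' * C', hdet, rfl⟩, _, ⟨C', rfl⟩, rfl⟩, rfl⟩, rfl⟩, ?_⟩
  have e3 : Matrix.fromBlocks 1 B' 0 1 * (Matrix.fromBlocks (A' - B' * C') 0 0 1 *
      Matrix.fromBlocks 1 0 C' 1) = Matrix.fromBlocks A' B' C' (1 : Matrix Unit Unit K) := by
    simp [Matrix.fromBlocks_multiply]
  have e4 : Matrix.fromBlocks (1 : Matrix (Fin r) (Fin r) K) 0 (-U) (1 : Matrix Unit Unit K) *
      Matrix.fromBlocks 1 0 U 1 = 1 := by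
    simp [Matrix.fromBlocks_multiply]
  have e5 : Matrix.fromBlocks (1 : Matrix (Fin r) (Fin r) K) (-V) 0 (1 : Matrix Unit Unit K) *
      Matrix.fromBlocks 1 V 0 1 = 1 := by
    simp [Matrix.fromBlocks_multiply]
  rw [e3, ← e2, ← Matrix.mul_assoc (Matrix.fromBlocks 1 0 (-U) 1), e4, one_mul,
    ← Matrix.mul_assoc, e5, one_mul]

lemma specialLinear (r : ℕ) :
    PolynomiallyCovered (fun K _ => {g : Matrix (Fin (r + 1)) (Fin (r + 1)) K | g.det = 1}) := by
  induction r with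
  | zero =>
    refine ⟨1, by simp, by simp, fun K _ g hg => ⟨0, ?_⟩⟩
    ext i j
    fin_cases i
    fin_cases j
    simpa [eq_comm] using hg
  | succ r ih =>
    exact (specialLinear_succ r.succ_pos ih).reindex
      ((Equiv.sumCongr (Equiv.refl _) finOneEquiv.symm).trans finSumFinEquiv)

end PolynomiallyCovered

section Bonferroni

variable {ι : Type}

/-- The elementary symmetric sum of degree `k` of the values of `g` on `T`. -/
def elemSum (T : Finset ι) (g : ι → ℝ) (k : ℕ) : ℝ :=
  ∑ D ∈ T.powersetCard k, ∏ p ∈ D, g p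

/-- The truncation at degree `k` of the expansion of `∏ p ∈ T, (1 - g p)`. -/
def altSum (T : Finset ι) (g : ι → ℝ) (k : ℕ) : ℝ :=
  ∑ i ∈ Finset.range (k + 1), (-1) ^ i * elemSum T g i

lemma elemSum_zero (T : Finset ι) (g : ι → ℝ) : elemSum T g 0 = 1 := by simp [elemSum]

lemma elemSum_nonneg {T : Finset ι} {g : ι → ℝ} (hg : ∀ p ∈ T, 0 ≤ g p) (k : ℕ) :
    0 ≤ elemSum T g k :=
  Finset.sum_nonneg fun _ hD => Finset.prod_nonneg fun p hp =>
    hg p ((Finset.mem_powersetCard.1 hD).1 hp)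

lemma altSum_zero (T : Finset ι) (g : ι → ℝ) : altSum T g 0 = 1 := by
  simp [altSum, elemSum_zero]

lemma altSum_succ (T : Finset ι) (g : ι → ℝ) (k : ℕ) :
    altSum T g (k + 1) = altSum T g k + (-1) ^ (k + 1) * elemSum T g (k + 1) := by
  rw [altSum, Finset.sum_range_succ, ← altSum]

lemma elemSum_empty_succ (g : ι → ℝ) (k : ℕ) : elemSum ∅ g (k + 1) = 0 := by
  rw [elemSum, Finset.powersetCard_eq_empty.2 (by simp), Finset.sum_empty]

lemma altSum_empty (g : ι → ℝ) (k : ℕ) : altSum ∅ g k = 1 := by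
  induction k with
  | zero => exact altSum_zero _ _
  | succ k ih => rw [altSum_succ, ih, elemSum_empty_succ, mul_zero, add_zero]

lemma add_mul_pow_le_add_pow {s g : ℝ} (hs : 0 ≤ s) (hg : 0 ≤ g) (k : ℕ) :
    s ^ (k + 1) + (k + 1 : ℕ) * g * s ^ k ≤ (g + s) ^ (k + 1) := by
  induction k with
  | zero => simp [add_comm]
  | succ k ih =>
    have h1 := mul_le_mul_of_nonneg_right ih (add_nonneg hg hs)
    have h2 : 0 ≤ (k + 1 : ℝ) * (g * g) * s ^ k := by positivity
    rw [pow_succ (g + s) (k + 1)]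
    push_cast at h1 ⊢
    refine le_trans ?_ h1
    have h3 : (s ^ (k + 1) + (k + 1) * g * s ^ k) * (g + s) =
        s ^ (k + 1 + 1) + (k + 1 + 1) * g * s ^ (k + 1) + (k + 1) * (g * g) * s ^ k := by ring
    rw [h3]
    exact le_add_of_nonneg_right h2

variable [DecidableEq ι]

lemma elemSum_insert_succ {T : Finset ι} {p : ι} (hp : p ∉ T) (g : ι → ℝ) (k : ℕ) :
    elemSum (insert p T) g (k + 1) = elemSum T g (k + 1) + g p * elemSum T g k := by
  have hnot : ∀ D ∈ T.powersetCard k, p ∉ D := fun D hD h =>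
    hp ((Finset.mem_powersetCard.1 hD).1 h)
  unfold elemSum
  rw [Finset.powersetCard_succ_insert hp, Finset.sum_union, Finset.sum_image, Finset.mul_sum]
  · congr 1
    exact Finset.sum_congr rfl fun D hD => Finset.prod_insert (hnot D hD)
  · intro D hD D' hD' h
    rw [← Finset.erase_insert (hnot D hD), ← Finset.erase_insert (hnot D' hD'), h]
  · rw [Finset.disjoint_left]
    intro D hD hD'
    obtain ⟨D', -, rfl⟩ := Finset.mem_image.1 hD'
    exact hp ((Finset.mem_powersetCard.1 hD).1 (Finset.mem_insert_self p D'))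

lemma altSum_insert_succ {T : Finset ι} {p : ι} (hp : p ∉ T) (g : ι → ℝ) (k : ℕ) :
    altSum (insert p T) g (k + 1) = altSum T g (k + 1) - g p * altSum T g k := by
  induction k with
  | zero =>
    simp only [altSum_succ, altSum_zero, elemSum_insert_succ hp, elemSum_zero]
    ring
  | succ k ih =>
    rw [altSum_succ, ih, elemSum_insert_succ hp, altSum_succ T g (k + 1), altSum_succ T g k]
    ring

/-- The Bonferroni inequalities. -/
lemma altSum_bounds {T : Finset ι} {g : ι → ℝ} (hg0 : ∀ p ∈ T, 0 ≤ g p)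
    (hg1 : ∀ p ∈ T, g p ≤ 1) (m : ℕ) :
    altSum T g (2 * m + 1) ≤ ∏ p ∈ T, (1 - g p) ∧ ∏ p ∈ T, (1 - g p) ≤ altSum T g (2 * m) := by
  induction T using Finset.induction_on generalizing m with
  | empty => simp [altSum_empty]
  | insert p T hp ih =>
    have hp0 := hg0 p (Finset.mem_insert_self p T)
    have hp1 := hg1 p (Finset.mem_insert_self p T)
    have ih := ih (fun q hq => hg0 q (Finset.mem_insert_of_mem hq))
      (fun q hq => hg1 q (Finset.mem_insert_of_mem hq))
    rw [Finset.prod_insert hp]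
    constructor
    · rw [altSum_insert_succ hp]
      nlinarith [(ih m).1, (ih m).2]
    · rcases m with _ | m
      · rw [mul_zero, altSum_zero]
        have h1 : ∏ p ∈ T, (1 - g p) ≤ 1 := by simpa [altSum_zero] using (ih 0).2
        have h0 : 0 ≤ ∏ p ∈ T, (1 - g p) := Finset.prod_nonneg fun q hq =>
          sub_nonneg.2 (hg1 q (Finset.mem_insert_of_mem hq))
        nlinarith
      · rw [show 2 * (m + 1) = 2 * m + 1 + 1 by ring, altSum_insert_succ hp]
        have h2 := (ih (m + 1)).2
        rw [show 2 * (m + 1) = 2 * m + 1 + 1 by ring] at h2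
        nlinarith [(ih m).1]

lemma factorial_mul_elemSum_le {T : Finset ι} {g : ι → ℝ} (hg : ∀ p ∈ T, 0 ≤ g p) (k : ℕ) :
    k.factorial * elemSum T g k ≤ (∑ p ∈ T, g p) ^ k := by
  induction T using Finset.induction_on generalizing k with
  | empty =>
    rcases k with _ | k
    · simp [elemSum_zero]
    · simp [elemSum_empty_succ]
  | insert p T hp ih =>
    have hp0 := hg p (Finset.mem_insert_self p T)
    have hT : ∀ q ∈ T, 0 ≤ g q := fun q hq => hg q (Finset.mem_insert_of_mem hq)
    have ih := ih hT
    rcases k with _ | k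
    · simp [elemSum_zero]
    · rw [elemSum_insert_succ hp, Finset.sum_insert hp]
      have hs : 0 ≤ ∑ q ∈ T, g q := Finset.sum_nonneg hT
      set s := ∑ q ∈ T, g q
      have h1 := ih (k + 1)
      have h2 := mul_le_mul_of_nonneg_left (ih k)
        (mul_nonneg (Nat.cast_nonneg (α := ℝ) (k + 1)) hp0)
      have h3 := add_mul_pow_le_add_pow hs hp0 k
      rw [Nat.factorial_succ] at h1 ⊢
      push_cast at h1 h2 h3 ⊢
      nlinarith

lemma sum_elemSum_le {T : Finset ι} {g : ι → ℝ} (hg : ∀ p ∈ T, 0 ≤ g p) (k : ℕ) :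
    ∑ i ∈ Finset.range (k + 1), elemSum T g i ≤ (1 + ∑ p ∈ T, g p) ^ k := by
  have hs : 0 ≤ ∑ q ∈ T, g q := Finset.sum_nonneg hg
  have h : ∀ i, elemSum T g i ≤ (∑ p ∈ T, g p) ^ i := fun i =>
    (le_mul_of_one_le_left (elemSum_nonneg hg i)
      (by exact_mod_cast i.factorial_pos)).trans (factorial_mul_elemSum_le hg i)
  induction k with
  | zero => simp [elemSum_zero]
  | succ k ih =>
    rw [Finset.sum_range_succ]
    have h1 := h (k + 1)
    set s := ∑ q ∈ T, g q
    have h2 : s ^ k ≤ (1 + s) ^ k := pow_le_pow_left₀ hs (by linarith) k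
    calc _ ≤ (1 + s) ^ k + s ^ k * s := by rw [← pow_succ]; exact add_le_add ih h1
      _ ≤ (1 + s) ^ k + (1 + s) ^ k * s := by gcongr
      _ = _ := by ring

end Bonferroni

section MeanApprox

/-- The function `h` has mean `μ` with error at most `E` along every arithmetic progression whose
modulus is coprime to the elements of `P`. -/
def MeanApprox (P : Finset ℕ) (h : ℕ → ℝ) (μ E : ℝ) : Prop :=
  ∀ q : ℕ, 0 < q → (∀ p ∈ P, q.Coprime p) → ∀ a X : ℕ,
    |∑ n ∈ Finset.range X with n ≡ a [MOD q], h n - μ * X / q| ≤ E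

lemma meanApprox_one : MeanApprox ∅ (fun _ => 1) 1 1 := by
  intro q hq _ a X
  have hc : ((Finset.range X).filter (fun n => n ≡ a [MOD q])).card =
      X.count (fun n => n ≡ a [MOD q]) := (Nat.count_eq_card_filter_range _ _).symm
  rw [Finset.sum_const, nsmul_eq_mul, mul_one, one_mul, hc, Nat.count_modEq_card _ hq]
  have hq' : (0 : ℝ) < q := by exact_mod_cast hq
  have hX : (X : ℝ) / q = (X / q : ℕ) + (X % q : ℕ) / (q : ℝ) := by
    rw [eq_comm, ← mul_left_inj' hq'.ne', add_mul, div_mul_cancel₀ _ hq'.ne',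
      div_mul_cancel₀ _ hq'.ne']
    exact_mod_cast Nat.div_add_mod' X q
  have h1 : ((X % q : ℕ) : ℝ) / q ≤ 1 := by
    rw [div_le_one hq']
    exact_mod_cast (Nat.mod_lt X hq).le
  have h0 : (0 : ℝ) ≤ ((X % q : ℕ) : ℝ) / q := by positivity
  rw [hX, abs_le]
  push_cast
  split_ifs <;> constructor <;> simp <;> linarith

namespace MeanApprox

variable {P : Finset ℕ} {h h' : ℕ → ℝ} {μ μ' E E' : ℝ}

lemma mono (H : MeanApprox P h μ E) {Q : Finset ℕ} (hPQ : P ⊆ Q) (hE : E ≤ E') :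
    MeanApprox Q h μ E' := fun q hq hc a X =>
  (H q hq (fun p hp => hc p (hPQ hp)) a X).trans hE

lemma add (H : MeanApprox P h μ E) (H' : MeanApprox P h' μ' E') :
    MeanApprox P (fun n => h n + h' n) (μ + μ') (E + E') := by
  intro q hq hc a X
  have h1 := H q hq hc a X
  have h2 := H' q hq hc a X
  rw [Finset.sum_add_distrib]
  calc _ = |(∑ n ∈ Finset.range X with n ≡ a [MOD q], h n - μ * X / q) +
      (∑ n ∈ Finset.range X with n ≡ a [MOD q], h' n - μ' * X / q)| := by congr 1; ring
    _ ≤ _ := (abs_add_le _ _).trans (add_le_add h1 h2)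

lemma neg (H : MeanApprox P h μ E) : MeanApprox P (fun n => - h n) (-μ) E := by
  intro q hq hc a X
  rw [Finset.sum_neg_distrib, neg_mul, neg_div, ← neg_sub', abs_neg]
  exact H q hq hc a X

lemma sum {ι : Type} {s : Finset ι} {f : ι → ℕ → ℝ} {m e : ι → ℝ}
    (H : ∀ i ∈ s, MeanApprox P (f i) (m i) (e i)) :
    MeanApprox P (fun n => ∑ i ∈ s, f i n) (∑ i ∈ s, m i) (∑ i ∈ s, e i) := by
  intro q hq hc a X
  rw [Finset.sum_comm, Finset.sum_mul, Finset.sum_div, ← Finset.sum_sub_distrib]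
  exact (Finset.abs_sum_le_sum_abs _ _).trans (Finset.sum_le_sum fun i hi => H i hi q hq hc a X)

variable {R : ℕ → ℕ → Prop} [∀ p n, Decidable (R p n)]

variable (R) in
/-- The indicator function of the residue classes to be removed modulo `p`. -/
def residueIndicator (p n : ℕ) : ℝ := if R p n then 1 else 0

variable (R) in
/-- The number of residue classes to be removed modulo `p`. -/
def classCount (p : ℕ) : ℝ := ((Finset.range p).filter (R p)).card

lemma mul_indicator (H : MeanApprox P h μ E) {p : ℕ} (hp : 0 < p) (hP : ∀ q ∈ P, p.Coprime q)
    (hR : ∀ n, R p n ↔ R p (n % p)) :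
    MeanApprox (insert p P) (fun n => h n * residueIndicator R p n)
      (μ * (classCount R p / p)) (E * classCount R p) := by
  intro q hq hc a X
  have hqp : q.Coprime p := hc p (Finset.mem_insert_self _ _)
  have key : ∀ b ∈ (Finset.range p).filter (R p),
      |∑ n ∈ Finset.range X with n ≡ Nat.chineseRemainder hqp a b [MOD q * p], h n
        - μ * X / (q * p : ℕ)| ≤ E := fun b _ =>
    H (q * p) (Nat.mul_pos hq hp) (fun r hr =>
      (Nat.Coprime.mul_left (hc r (Finset.mem_insert_of_mem hr)) (hP r hr))) _ X
  have hsum : ∑ n ∈ Finset.range X with n ≡ a [MOD q], h n * residueIndicator R p n =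
      ∑ b ∈ (Finset.range p).filter (R p),
        ∑ n ∈ Finset.range X with n ≡ Nat.chineseRemainder hqp a b [MOD q * p], h n := by
    have : ∀ b ∈ (Finset.range p).filter (R p),
        ∑ n ∈ Finset.range X with n ≡ Nat.chineseRemainder hqp a b [MOD q * p], h n =
        ∑ n ∈ Finset.range X with n ≡ a [MOD q], if n % p = b then h n else 0 := by
      intro b hb
      rw [Finset.mem_filter, Finset.mem_range] at hb
      rw [← Finset.sum_filter, Finset.filter_filter]
      refine Finset.sum_congr (Finset.filter_congr fun n _ => ?_) fun _ _ => rfl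
      have h1 := (Nat.chineseRemainder hqp a b).2.1
      have h2 := (Nat.chineseRemainder hqp a b).2.2
      rw [← Nat.modEq_and_modEq_iff_modEq_mul hqp]
      have h3 : n % p = b ↔ n ≡ b [MOD p] := by rw [Nat.ModEq, Nat.mod_eq_of_lt hb.1]
      rw [h3]
      exact ⟨fun ⟨u, v⟩ => ⟨u.trans h1, v.trans h2⟩,
        fun ⟨u, v⟩ => ⟨u.trans h1.symm, v.trans h2.symm⟩⟩
    rw [Finset.sum_congr rfl this, Finset.sum_comm]
    refine Finset.sum_congr rfl fun n _ => ?_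
    rw [Finset.sum_ite_eq]
    simp only [residueIndicator, Finset.mem_filter, Finset.mem_range, Nat.mod_lt n hp, true_and,
      ← hR n, mul_ite, mul_one, mul_zero]
  have hmain : μ * (classCount R p / p) * X / q =
      ∑ b ∈ (Finset.range p).filter (R p), μ * X / (q * p : ℕ) := by
    rw [Finset.sum_const, nsmul_eq_mul, ← classCount]
    push_cast
    have : (p : ℝ) ≠ 0 := by exact_mod_cast hp.ne'
    have : (q : ℝ) ≠ 0 := by exact_mod_cast hq.ne'
    field_simp
  rw [hsum, hmain, ← Finset.sum_sub_distrib]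
  refine (Finset.abs_sum_le_sum_abs _ _).trans ((Finset.sum_le_sum key).trans ?_)
  rw [Finset.sum_const, nsmul_eq_mul, ← classCount, mul_comm]

lemma mul_prod_indicator (H : MeanApprox P h μ E) (D : Finset ℕ) (hD : ∀ p ∈ D, p.Prime)
    (hPp : ∀ p ∈ P, p.Prime) (hDP : Disjoint D P)
    (hR : ∀ p ∈ D, ∀ n, R p n ↔ R p (n % p)) :
    MeanApprox (D ∪ P) (fun n => h n * ∏ p ∈ D, residueIndicator R p n)
      (μ * ∏ p ∈ D, (classCount R p / p)) (E * ∏ p ∈ D, classCount R p) := by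
  induction D using Finset.induction_on with
  | empty => simpa using H
  | insert p D hp ih =>
    rw [Finset.disjoint_insert_left] at hDP
    have ih := ih (fun q hq => hD q (Finset.mem_insert_of_mem hq)) hDP.2
      (fun q hq => hR q (Finset.mem_insert_of_mem hq))
    have hpp := hD p (Finset.mem_insert_self p D)
    have := ih.mul_indicator (R := R) hpp.pos (fun q hq => by
      rcases Finset.mem_union.1 hq with hq | hq
      · exact (Nat.coprime_primes hpp (hD q (Finset.mem_insert_of_mem hq))).2
          (by rintro rfl; exact hp hq)
      · exact (Nat.coprime_primes hpp (hPp q hq)).2 (by rintro rfl; exact hDP.1 hq))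
      (hR p (Finset.mem_insert_self p D))
    rw [Finset.insert_union]
    simp only [Finset.prod_insert hp]
    convert this using 1
    · funext n
      ring
    · ring
    · ring

variable {T : Finset ℕ}

lemma mul_elemSum (H : MeanApprox P h μ E) (hT : ∀ p ∈ T, p.Prime)
    (hPp : ∀ p ∈ P, p.Prime) (hTP : Disjoint T P)
    (hR : ∀ p ∈ T, ∀ n, R p n ↔ R p (n % p)) (k : ℕ) :
    MeanApprox (T ∪ P) (fun n => h n * elemSum T (fun p => residueIndicator R p n) k)
      (μ * elemSum T (fun p => classCount R p / p) k) (E * elemSum T (classCount R) k) := by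
  simp only [elemSum, Finset.mul_sum]
  refine MeanApprox.sum fun D hD => ?_
  have hDT := (Finset.mem_powersetCard.1 hD).1
  exact (H.mul_prod_indicator D (fun p hp => hT p (hDT hp)) hPp (hTP.mono_left hDT)
    (fun p hp => hR p (hDT hp))).mono (Finset.union_subset_union_left hDT) le_rfl

lemma mul_altSum (H : MeanApprox P h μ E) (hT : ∀ p ∈ T, p.Prime)
    (hPp : ∀ p ∈ P, p.Prime) (hTP : Disjoint T P)
    (hR : ∀ p ∈ T, ∀ n, R p n ↔ R p (n % p)) (k : ℕ) :
    MeanApprox (T ∪ P) (fun n => h n * altSum T (fun p => residueIndicator R p n) k)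
      (μ * altSum T (fun p => classCount R p / p) k)
      (E * ∑ i ∈ Finset.range (k + 1), elemSum T (classCount R) i) := by
  simp only [altSum, Finset.mul_sum]
  refine MeanApprox.sum fun i _ => ?_
  have := H.mul_elemSum hT hPp hTP hR i
  rcases neg_one_pow_eq_or ℝ i with h1 | h1
  · simpa only [h1, one_mul] using this
  · simpa only [h1, neg_mul, one_mul, mul_neg] using this.neg

end MeanApprox

end MeanApprox

section BrunHooley

open MeanApprox

variable {R : ℕ → ℕ → Prop} [∀ p n, Decidable (R p n)]

lemma indicator_nonneg (p n : ℕ) : 0 ≤ residueIndicator R p n := by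
  unfold residueIndicator; split_ifs <;> norm_num

lemma indicator_le_one (p n : ℕ) : residueIndicator R p n ≤ 1 := by
  unfold residueIndicator; split_ifs <;> norm_num

lemma classCount_nonneg (p : ℕ) : 0 ≤ classCount R p := Nat.cast_nonneg _

/-- The Brun–Hooley construction: upper and lower weights for the integers surviving the removal
of residue classes, built block by block from truncated inclusion–exclusion. -/
lemma exists_block_weights (T : ℕ → Finset ℕ) (m : ℕ → ℕ) (hT : ∀ k, ∀ p ∈ T k, p.Prime)
    (hdisj : ∀ i j, i ≠ j → Disjoint (T i) (T j))
    (hR : ∀ k, ∀ p ∈ T k, ∀ n, R p n ↔ R p (n % p))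
    (hlt : ∀ k, ∀ p ∈ T k, classCount R p < p) (t : ℕ) :
    ∃ (U L : ℕ → ℝ) (u l : ℝ),
      (∀ n, ∏ k ∈ Finset.range t, ∏ p ∈ T k, (1 - residueIndicator R p n) ≤ U n) ∧
      (∀ n, L n ≤ ∏ k ∈ Finset.range t, ∏ p ∈ T k, (1 - residueIndicator R p n)) ∧
      MeanApprox ((Finset.range t).biUnion T) U u
        (∏ k ∈ Finset.range t, (1 + ∑ p ∈ T k, classCount R p) ^ (2 * m k + 1)) ∧
      MeanApprox ((Finset.range t).biUnion T) L l
        (∏ k ∈ Finset.range t, (1 + ∑ p ∈ T k, classCount R p) ^ (2 * m k + 1)) ∧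
      ∏ k ∈ Finset.range t, ∏ p ∈ T k, (1 - classCount R p / p) ≤ u ∧
      (1 - ∑ k ∈ Finset.range t, elemSum (T k) (fun p => classCount R p / p) (2 * m k + 1) /
        ∏ p ∈ T k, (1 - classCount R p / p)) * u ≤ l := by
  have hg0 : ∀ k, ∀ p ∈ T k, 0 ≤ classCount R p / p := fun k p _ =>
    div_nonneg (classCount_nonneg p) p.cast_nonneg
  have hg1 : ∀ k, ∀ p ∈ T k, classCount R p / p < 1 := fun k p hp => by
    rw [div_lt_one (by exact_mod_cast (hT k p hp).pos)]
    exact hlt k p hp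
  have hV : ∀ k, 0 < ∏ p ∈ T k, (1 - classCount R p / p) := fun k =>
    Finset.prod_pos fun p hp => sub_pos.2 (hg1 k p hp)
  have hind : ∀ k n, 0 ≤ ∏ p ∈ T k, (1 - residueIndicator R p n) := fun k n =>
    Finset.prod_nonneg fun p _ => sub_nonneg.2 (indicator_le_one p n)
  induction t with
  | zero =>
    refine ⟨fun _ => 1, fun _ => 1, 1, 1, by simp, by simp, ?_, ?_, by simp, by simp⟩ <;>
    simpa using meanApprox_one
  | succ t ih =>
    obtain ⟨U, L, u, l, hU, hL, hUa, hLa, hu, hl⟩ := ih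
    set P := (Finset.range t).biUnion T with hP
    have hPp : ∀ p ∈ P, p.Prime := fun p hp => by
      obtain ⟨k, -, hk⟩ := Finset.mem_biUnion.1 hp
      exact hT k p hk
    have hTP : Disjoint (T t) P := by
      rw [hP, Finset.disjoint_biUnion_right]
      intro k hk
      exact hdisj t k (Finset.mem_range.1 hk).ne'
    have hPsucc : (Finset.range (t + 1)).biUnion T = T t ∪ P := by
      rw [Finset.range_add_one, Finset.biUnion_insert]
    set Err := ∏ k ∈ Finset.range t, (1 + ∑ p ∈ T k, classCount R p) ^ (2 * m k + 1)
    have hErr : 0 ≤ Err := Finset.prod_nonneg fun k _ => pow_nonneg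
      (add_nonneg zero_le_one (Finset.sum_nonneg fun p _ => classCount_nonneg p)) _
    have hcc : ∀ p ∈ T t, 0 ≤ classCount R p := fun p _ => classCount_nonneg p
    have hb : ∑ i ∈ Finset.range (2 * m t + 1), elemSum (T t) (classCount R) i +
        elemSum (T t) (classCount R) (2 * m t + 1) ≤
        (1 + ∑ p ∈ T t, classCount R p) ^ (2 * m t + 1) := by
      rw [← Finset.sum_range_succ]
      exact sum_elemSum_le hcc _
    have hb0 := elemSum_nonneg hcc (2 * m t + 1)
    have hYV := altSum_bounds (hg0 t) (fun p hp => (hg1 t p hp).le) (m t)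
    have hu0 : 0 ≤ u := le_trans (Finset.prod_nonneg fun k _ => (hV k).le) hu
    have hpt := fun n => altSum_bounds (T := T t) (g := fun p => residueIndicator R p n)
      (fun p _ => indicator_nonneg p n) (fun p _ => indicator_le_one p n) (m t)
    have he := fun n => elemSum_nonneg (T := T t) (g := fun p => residueIndicator R p n)
      (fun p _ => indicator_nonneg p n) (2 * m t + 1)
    have hodd : (-1 : ℝ) ^ (2 * m t + 1) = -1 := by rw [pow_succ, pow_mul]; simp
    have hprod0 : ∀ n, 0 ≤ ∏ k ∈ Finset.range t, ∏ p ∈ T k, (1 - residueIndicator R p n) := fun n =>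
      Finset.prod_nonneg fun k _ => hind k n
    have hmU := hUa.mul_altSum (R := R) (hT t) hPp hTP (hR t) (2 * m t)
    have hmL := (hLa.mul_altSum (R := R) (hT t) hPp hTP (hR t) (2 * m t)).add
      (hUa.mul_elemSum (R := R) (hT t) hPp hTP (hR t) (2 * m t + 1)).neg
    refine ⟨_, _, _, _, ?_, ?_, hmU.mono hPsucc.ge ?_, hmL.mono hPsucc.ge ?_, ?_, ?_⟩
    · intro n
      rw [Finset.prod_range_succ]
      exact mul_le_mul (hU n) (hpt n).2 (hind t n) ((hprod0 n).trans (hU n))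
    · intro n
      rw [Finset.prod_range_succ]
      have h1 := (hpt n).1
      rw [altSum_succ, hodd] at h1
      have h2 := (hpt n).2
      have h3 := he n
      have h4 := hind t n
      have h5 := hprod0 n
      have h6 := hU n
      have h7 := hL n
      set a := ∏ k ∈ Finset.range t, ∏ p ∈ T k, (1 - residueIndicator R p n)
      set x := ∏ p ∈ T t, (1 - residueIndicator R p n)
      set y := altSum (T t) (fun p => residueIndicator R p n) (2 * m t)
      set e := elemSum (T t) (fun p => residueIndicator R p n) (2 * m t + 1)
      have h8 : L n * y ≤ a * y := mul_le_mul_of_nonneg_right h7 (h4.trans h2)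
      have h9 : a * (y - x) ≤ a * e := mul_le_mul_of_nonneg_left (by linarith) h5
      have h10 : a * e ≤ U n * e := mul_le_mul_of_nonneg_right h6 h3
      linarith
    · rw [Finset.prod_range_succ]
      exact mul_le_mul_of_nonneg_left (by linarith) hErr
    · rw [Finset.prod_range_succ, ← mul_add]
      exact mul_le_mul_of_nonneg_left hb hErr
    · rw [Finset.prod_range_succ]
      exact mul_le_mul hu hYV.2 (hV t).le hu0
    · rw [Finset.sum_range_succ]
      have h1 := hYV.2
      have h0 := hV t
      have h2 := elemSum_nonneg (hg0 t) (2 * m t + 1)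
      set V := ∏ p ∈ T t, (1 - classCount R p / p)
      set y := altSum (T t) (fun p => classCount R p / p) (2 * m t)
      set e := elemSum (T t) (fun p => classCount R p / p) (2 * m t + 1)
      set ε := ∑ k ∈ Finset.range t, elemSum (T k) (fun p => classCount R p / p) (2 * m k + 1) /
        ∏ p ∈ T k, (1 - classCount R p / p)
      have h3 : e ≤ e / V * y := by
        calc e = e / V * V := by field_simp
          _ ≤ _ := mul_le_mul_of_nonneg_left h1 (div_nonneg h2 h0.le)
      have h4 := mul_le_mul_of_nonneg_left h3 hu0
      have h5 := mul_le_mul_of_nonneg_right hl (h0.le.trans h1)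
      linarith

lemma exists_survivor_of_blocks (T : ℕ → Finset ℕ) (m : ℕ → ℕ) (hT : ∀ k, ∀ p ∈ T k, p.Prime)
    (hdisj : ∀ i j, i ≠ j → Disjoint (T i) (T j))
    (hR : ∀ k, ∀ p ∈ T k, ∀ n, R p n ↔ R p (n % p))
    (hlt : ∀ k, ∀ p ∈ T k, classCount R p < p) (t X : ℕ)
    (hε : ∑ k ∈ Finset.range t, elemSum (T k) (fun p => classCount R p / p) (2 * m k + 1) /
        ∏ p ∈ T k, (1 - classCount R p / p) ≤ 1 / 2)
    (hX : ∏ k ∈ Finset.range t, (1 + ∑ p ∈ T k, classCount R p) ^ (2 * m k + 1) <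
      (∏ k ∈ Finset.range t, ∏ p ∈ T k, (1 - classCount R p / p)) / 2 * X) :
    ∃ n < X, ∀ k < t, ∀ p ∈ T k, ¬ R p n := by
  obtain ⟨U, L, u, l, -, hL, -, hLa, hu, hl⟩ := exists_block_weights T m hT hdisj hR hlt t
  have h1 := hLa 1 one_pos (fun p _ => Nat.coprime_one_left p) 0 X
  simp only [Nat.modEq_one, Finset.filter_true, Nat.cast_one, div_one] at h1
  have hu0 : 0 ≤ u := le_trans (Finset.prod_nonneg fun k _ => Finset.prod_nonneg fun p hp => by
    rw [sub_nonneg, div_le_one (by exact_mod_cast (hT k p hp).pos)]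
    exact (hlt k p hp).le) hu
  have hlu : (∏ k ∈ Finset.range t, ∏ p ∈ T k, (1 - classCount R p / p)) / 2 ≤ l := by
    nlinarith
  have hpos : 0 < ∑ n ∈ Finset.range X, L n := by
    have h2 := (abs_le.1 h1).1
    have h3 := mul_le_mul_of_nonneg_right hlu (Nat.cast_nonneg (α := ℝ) X)
    linarith
  obtain ⟨n, hn, hn0⟩ := Finset.exists_lt_of_sum_lt (s := Finset.range X) (f := fun _ => (0 : ℝ))
    (g := L) (by simpa using hpos)
  refine ⟨n, Finset.mem_range.1 hn, fun k hk p hp hRp => ?_⟩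
  have h4 : ∏ k ∈ Finset.range t, ∏ p ∈ T k, (1 - residueIndicator R p n) = 0 :=
    Finset.prod_eq_zero (Finset.mem_range.2 hk)
      (Finset.prod_eq_zero hp (by simp [residueIndicator, hRp]))
  have h5 := hL n
  linarith

end BrunHooley

section PrimeReciprocals

lemma card_primes_dyadic_mul_le (i : ℕ) :
    ((Finset.Ico (2 ^ i) (2 ^ (i + 1))).filter Nat.Prime).card * i ≤ 2 ^ (i + 2) := by
  set T := (Finset.Ico (2 ^ i) (2 ^ (i + 1))).filter Nat.Prime
  have h1 : (2 ^ i) ^ T.card ≤ ∏ p ∈ T, p :=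
    Finset.pow_card_le_prod T (fun p => p) _ fun p hp =>
      (Finset.mem_Ico.1 (Finset.mem_filter.1 hp).1).1
  have h2 : ∏ p ∈ T, p ≤ primorial (2 ^ (i + 1)) := by
    refine Finset.prod_le_prod_of_subset_of_one_le' (fun p hp => ?_) fun p hp _ =>
      (Finset.mem_filter.1 hp).2.pos
    obtain ⟨h1, h2⟩ := Finset.mem_filter.1 hp
    exact Finset.mem_filter.2 ⟨Finset.mem_range.2 (by have := (Finset.mem_Ico.1 h1).2; omega), h2⟩
  have h3 := (h1.trans h2).trans (primorial_le_four_pow _)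
  rw [← pow_mul, show (4 : ℕ) = 2 ^ 2 by rfl, ← pow_mul,
    Nat.pow_le_pow_iff_right (by norm_num)] at h3
  calc _ = i * T.card := mul_comm _ _
    _ ≤ _ := h3
    _ = _ := by ring

lemma sum_prime_reciprocals_dyadic_le {i : ℕ} (hi : 0 < i) :
    ∑ p ∈ (Finset.Ico (2 ^ i) (2 ^ (i + 1))).filter Nat.Prime, (1 / p : ℝ) ≤ 4 / i := by
  have hi' : (0 : ℝ) < i := by exact_mod_cast hi
  have h := card_primes_dyadic_mul_le i
  calc _ ≤ ∑ p ∈ (Finset.Ico (2 ^ i) (2 ^ (i + 1))).filter Nat.Prime, (1 / 2 ^ i : ℝ) := by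
        refine Finset.sum_le_sum fun p hp => ?_
        have : 2 ^ i ≤ p := (Finset.mem_Ico.1 (Finset.mem_filter.1 hp).1).1
        exact one_div_le_one_div_of_le (by positivity) (by exact_mod_cast this)
    _ ≤ _ := by
        rw [Finset.sum_const, nsmul_eq_mul, mul_one_div, div_le_div_iff₀ (by positivity) hi']
        have : (2 : ℝ) ^ (i + 2) = 4 * 2 ^ i := by ring
        rw [← this]
        exact_mod_cast h

lemma sum_prime_reciprocals_le {a b : ℕ} (ha : 0 < a) (hab : a ≤ b) :
    ∑ p ∈ (Finset.Ico (2 ^ a) (2 ^ b)).filter Nat.Prime, (1 / p : ℝ) ≤ (b - a) * (4 / a) := by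
  induction b, hab using Nat.le_induction with
  | base => simp
  | succ b hab ih =>
    have h1 := sum_prime_reciprocals_dyadic_le (ha.trans_le hab)
    have ha' : (0 : ℝ) < a := by exact_mod_cast ha
    have h2 : (4 / b : ℝ) ≤ 4 / a :=
      div_le_div_of_nonneg_left (by norm_num) ha' (by exact_mod_cast hab)
    rw [Finset.sum_filter] at *
    rw [← Finset.sum_Ico_consecutive _ (Nat.pow_le_pow_right two_pos hab)
      (Nat.pow_le_pow_right two_pos b.le_succ)]
    push_cast
    linarith

lemma sum_prime_reciprocals_double_exp_le (k : ℕ) :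
    ∑ p ∈ (Finset.Ico (2 ^ 2 ^ k) (2 ^ 2 ^ (k + 1))).filter Nat.Prime, (1 / p : ℝ) ≤ 4 := by
  refine (sum_prime_reciprocals_le (by positivity)
    (Nat.pow_le_pow_right two_pos k.le_succ)).trans (le_of_eq ?_)
  push_cast
  have : (2 : ℝ) ^ k ≠ 0 := by positivity
  field_simp
  rw [Nat.succ_eq_add_one, pow_succ]
  ring

end PrimeReciprocals

section Sieve

open MeanApprox

lemma exp_neg_two_mul_le {x : ℝ} (h0 : 0 ≤ x) (h1 : x ≤ 1 / 2) : Real.exp (-(2 * x)) ≤ 1 - x := by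
  rw [Real.exp_neg, inv_le_comm₀ (Real.exp_pos _) (by linarith)]
  refine le_trans ?_ (Real.add_one_le_exp (2 * x))
  rw [inv_le_iff_one_le_mul₀ (by linarith)]
  nlinarith

lemma sum_range_half_pow (t : ℕ) :
    ∑ j ∈ Finset.range t, (1 / 2 : ℝ) ^ (t - j) = 1 - (1 / 2) ^ t := by
  induction t with
  | zero => simp
  | succ t ih =>
    rw [Finset.sum_range_succ']
    simp only [Nat.add_sub_add_right, ih]
    rw [Nat.sub_zero, pow_succ]
    ring

lemma sum_range_two_pow_mul (B t : ℕ) :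
    ∑ j ∈ Finset.range t, 2 ^ j * (2 * (B + (t - j)) + 1) + (2 * B + 2 * t + 5) =
      2 ^ t * (2 * B + 5) := by
  induction t with
  | zero => simp
  | succ t ih =>
    rw [Finset.sum_range_succ']
    simp only [Nat.add_sub_add_right, pow_succ, Nat.sub_zero, pow_zero]
    have : ∑ j ∈ Finset.range t, 2 ^ j * 2 * (2 * (B + (t - j)) + 1) =
        2 * ∑ j ∈ Finset.range t, 2 ^ j * (2 * (B + (t - j)) + 1) := by
      rw [Finset.mul_sum]
      exact Finset.sum_congr rfl fun j _ => by ring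
    rw [this]
    linarith

lemma exists_factorial_bound (L : ℝ) :
    ∃ B : ℕ, ∀ b ≥ B, Real.exp (2 * L) * (L ^ b / b.factorial) ≤ (1 / 2) ^ b := by
  have h := (FloorSemiring.tendsto_pow_div_factorial_atTop (2 * L)).const_mul (Real.exp (2 * L))
  rw [mul_zero] at h
  obtain ⟨B, hB⟩ := Filter.eventually_atTop.1 (h.eventually_le_const one_pos)
  refine ⟨B, fun b hb => ?_⟩
  have h1 := mul_le_mul_of_nonneg_right (hB b hb) (by positivity : (0 : ℝ) ≤ (1 / 2) ^ b)
  rw [one_mul] at h1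
  refine le_trans (le_of_eq ?_) h1
  rw [mul_pow, one_div, inv_pow]
  field_simp

lemma exists_exp_lt_two_pow (L : ℝ) :
    ∃ t₀ : ℕ, ∀ t ≥ t₀, 2 * Real.exp (2 * L * t) < 2 ^ 2 ^ t := by
  have h := (tendsto_pow_const_div_const_pow_of_one_lt 1 (one_lt_two (α := ℝ))).const_mul
    (4 * (1 + |2 * L|))
  rw [mul_zero] at h
  obtain ⟨t₀, ht₀⟩ := Filter.eventually_atTop.1 (h.eventually_lt_const one_pos)
  refine ⟨max t₀ 1, fun t ht => ?_⟩
  have h1 := ht₀ t ((le_max_left _ _).trans ht)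
  have ht1 : (1 : ℝ) ≤ t := by exact_mod_cast (le_max_right _ _).trans ht
  rw [pow_one, ← mul_div_assoc, div_lt_one (by positivity)] at h1
  have hlog : 1 / 2 < Real.log 2 := by linarith [Real.log_two_gt_d9]
  have hpow : (2 : ℝ) ^ 2 ^ t = Real.exp (2 ^ t * Real.log 2) := by
    rw [mul_comm, Real.exp_mul, Real.exp_log two_pos, ← Real.rpow_natCast]
    norm_cast
  have h2 : 2 * Real.exp (2 * L * t) ≤ Real.exp (1 + 2 * L * t) := by
    rw [Real.exp_add]
    gcongr
    linarith [Real.add_one_le_exp (1 : ℝ)]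
  rw [hpow]
  refine h2.trans_lt (Real.exp_lt_exp.2 ?_)
  have h3 : 2 * L * t ≤ |2 * L| * t := mul_le_mul_of_nonneg_right (le_abs_self _) (by linarith)
  have h4 : (0 : ℝ) < 2 ^ t := by positivity
  have h5 := mul_lt_mul_of_pos_left hlog h4
  nlinarith [abs_nonneg (2 * L)]

/-- A lower bound sieve of bounded dimension: if at most `κ` residue classes are removed modulo
each prime `p ≥ 2 ^ 2 ^ k₀`, then some integer below a fixed power of the sifting limit survives. -/
theorem exists_survivor {κ k₀ : ℕ} (hκ : 2 * κ ≤ 2 ^ 2 ^ k₀) :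
    ∃ C t₀ : ℕ, ∀ t ≥ t₀, ∀ (R : ℕ → ℕ → Prop) [∀ p n, Decidable (R p n)],
      (∀ p n, R p n ↔ R p (n % p)) →
      (∀ p, p.Prime → 2 ^ 2 ^ k₀ ≤ p → ((Finset.range p).filter (R p)).card ≤ κ) →
      ∃ n < 2 ^ (C * 2 ^ t), ∀ p, p.Prime → 2 ^ 2 ^ k₀ ≤ p → p < 2 ^ 2 ^ (k₀ + t) → ¬ R p n := by
  set L : ℝ := κ * 4
  obtain ⟨B, hB⟩ := exists_factorial_bound L
  obtain ⟨t₀, ht₀⟩ := exists_exp_lt_two_pow L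
  refine ⟨2 ^ (k₀ + 2) * (2 * B + 5) + 1, t₀, fun t ht R _ hR hcard => ?_⟩
  let T : ℕ → Finset ℕ := fun j =>
    (Finset.Ico (2 ^ 2 ^ (k₀ + j)) (2 ^ 2 ^ (k₀ + j + 1))).filter Nat.Prime
  have hTmem : ∀ j, ∀ p ∈ T j, 2 ^ 2 ^ (k₀ + j) ≤ p ∧ p < 2 ^ 2 ^ (k₀ + j + 1) ∧ p.Prime := by
    intro j p hp
    obtain ⟨h1, h2⟩ := Finset.mem_filter.1 hp
    exact ⟨(Finset.mem_Ico.1 h1).1, (Finset.mem_Ico.1 h1).2, h2⟩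
  have hdbl : ∀ i j : ℕ, i ≤ j → 2 ^ 2 ^ (k₀ + i) ≤ 2 ^ 2 ^ (k₀ + j) := fun i j hij =>
    Nat.pow_le_pow_right two_pos (Nat.pow_le_pow_right two_pos (by omega))
  have hlarge : ∀ j, ∀ p ∈ T j, 2 ^ 2 ^ k₀ ≤ p := fun j p hp =>
    (hdbl 0 j j.zero_le).trans (hTmem j p hp).1
  have hcc : ∀ j, ∀ p ∈ T j, classCount R p ≤ κ := fun j p hp => by
    exact Nat.cast_le.2 (hcard p (hTmem j p hp).2.2 (hlarge j p hp))
  have hp0 : ∀ j, ∀ p ∈ T j, (0 : ℝ) < p := fun j p hp => by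
    exact_mod_cast (hTmem j p hp).2.2.pos
  have hhalf : ∀ j, ∀ p ∈ T j, classCount R p / p ≤ 1 / 2 := fun j p hp => by
    rw [div_le_div_iff₀ (hp0 j p hp) two_pos, one_mul]
    have h1 : ((2 * κ : ℕ) : ℝ) ≤ p := by exact_mod_cast hκ.trans (hlarge j p hp)
    push_cast at h1
    linarith [hcc j p hp]
  have hg0 : ∀ j, ∀ p ∈ T j, 0 ≤ classCount R p / p := fun j p hp =>
    div_nonneg (classCount_nonneg p) (hp0 j p hp).le
  have hgsum : ∀ j, ∑ p ∈ T j, classCount R p / p ≤ L := fun j => by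
    calc _ ≤ ∑ p ∈ T j, κ * (1 / p : ℝ) := Finset.sum_le_sum fun p hp => by
          rw [mul_one_div]
          exact div_le_div_of_nonneg_right (hcc j p hp) (hp0 j p hp).le
      _ ≤ _ := by
          rw [← Finset.mul_sum]
          exact mul_le_mul_of_nonneg_left (sum_prime_reciprocals_double_exp_le _) κ.cast_nonneg
  have hV : ∀ j, Real.exp (-(2 * L)) ≤ ∏ p ∈ T j, (1 - classCount R p / p) := fun j => by
    calc _ ≤ Real.exp (∑ p ∈ T j, -(2 * (classCount R p / p))) := by
          rw [Finset.sum_neg_distrib, ← Finset.mul_sum]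
          exact Real.exp_le_exp.2 (by linarith [hgsum j])
      _ ≤ _ := by
          rw [Real.exp_sum]
          exact Finset.prod_le_prod (fun p _ => (Real.exp_pos _).le) fun p hp =>
            exp_neg_two_mul_le (hg0 j p hp) (hhalf j p hp)
  have hmain : ∃ n < 2 ^ ((2 ^ (k₀ + 2) * (2 * B + 5) + 1) * 2 ^ t), ∀ j < t, ∀ p ∈ T j,
      ¬ R p n := by
    refine exists_survivor_of_blocks (R := R) T (fun j => B + (t - j))
      (fun j p hp => (hTmem j p hp).2.2)
      (fun i j hij => by
        rw [Finset.disjoint_left]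
        intro p hi hj
        have h1 := hTmem i p hi
        have h2 := hTmem j p hj
        rcases lt_or_gt_of_ne hij with h | h
        · have := hdbl (i + 1) j h
          rw [← add_assoc] at this
          omega
        · have := hdbl (j + 1) i h
          rw [← add_assoc] at this
          omega)
      (fun j p _ n => hR p n)
      (fun j p hp => by
        have h1 := hhalf j p hp
        rw [div_le_div_iff₀ (hp0 j p hp) two_pos, one_mul] at h1
        linarith [hp0 j p hp]) t (2 ^ ((2 ^ (k₀ + 2) * (2 * B + 5) + 1) * 2 ^ t)) ?_ ?_
    · calc _ ≤ ∑ j ∈ Finset.range t, (1 / 2 : ℝ) ^ (t - j) * (1 / 2) := by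
            refine Finset.sum_le_sum fun j _ => ?_
            have hVj := hV j
            have hb := hB (2 * (B + (t - j)) + 1) (by omega)
            have hE := factorial_mul_elemSum_le (hg0 j) (2 * (B + (t - j)) + 1)
            have hs : (∑ p ∈ T j, classCount R p / p) ^ (2 * (B + (t - j)) + 1) ≤
                L ^ (2 * (B + (t - j)) + 1) :=
              pow_le_pow_left₀ (Finset.sum_nonneg (hg0 j)) (hgsum j) _
            set b := 2 * (B + (t - j)) + 1 with hbdef
            have hfac : (0 : ℝ) < b.factorial := by exact_mod_cast b.factorial_pos
            have hE' : elemSum (T j) (fun p => classCount R p / p) b ≤ L ^ b / b.factorial := by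
              rw [le_div_iff₀ hfac, mul_comm]
              exact hE.trans hs
            calc _ ≤ (L ^ b / b.factorial) / Real.exp (-(2 * L)) :=
                  div_le_div₀ ((elemSum_nonneg (hg0 j) b).trans hE') hE' (Real.exp_pos _) hVj
              _ = Real.exp (2 * L) * (L ^ b / b.factorial) := by
                  rw [Real.exp_neg, div_inv_eq_mul, mul_comm]
              _ ≤ (1 / 2) ^ b := hb
              _ ≤ (1 / 2) ^ (t - j + 1) :=
                  pow_le_pow_of_le_one (by norm_num) (by norm_num) (by omega)
              _ = _ := pow_succ _ _
        _ ≤ 1 / 2 := by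
            rw [← Finset.sum_mul, sum_range_half_pow]
            have : (0 : ℝ) ≤ (1 / 2) ^ t := by positivity
            linarith
    · have hA : ∀ j, 1 + ∑ p ∈ T j, classCount R p ≤ 2 ^ 2 ^ (k₀ + j + 2) := fun j => by
        have h1 : ∑ p ∈ T j, classCount R p ≤ κ * 2 ^ 2 ^ (k₀ + j + 1) := by
          calc _ ≤ ∑ p ∈ T j, (κ : ℝ) := Finset.sum_le_sum (hcc j)
            _ = (T j).card * κ := by rw [Finset.sum_const, nsmul_eq_mul]
            _ ≤ 2 ^ 2 ^ (k₀ + j + 1) * κ := by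
              refine mul_le_mul_of_nonneg_right ?_ κ.cast_nonneg
              have : (T j).card ≤ 2 ^ 2 ^ (k₀ + j + 1) :=
                (Finset.card_filter_le _ _).trans (by rw [Nat.card_Ico]; exact Nat.sub_le _ _)
              exact_mod_cast this
            _ = _ := mul_comm _ _
        have h2 : ((2 * κ : ℕ) : ℝ) ≤ 2 ^ 2 ^ (k₀ + j + 1) := by
          exact_mod_cast hκ.trans (hdbl 0 (j + 1) (Nat.zero_le _))
        have h3 : (2 : ℝ) ^ 2 ^ (k₀ + j + 2) =
            2 ^ 2 ^ (k₀ + j + 1) * 2 ^ 2 ^ (k₀ + j + 1) := by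
          rw [← pow_add, ← two_mul, ← pow_succ']
        have h4 : (2 : ℝ) ≤ 2 ^ 2 ^ (k₀ + j + 1) := le_self_pow₀ (by norm_num) (by positivity)
        push_cast at h2
        rw [h3]
        nlinarith
      have hprod : ∏ j ∈ Finset.range t,
          (1 + ∑ p ∈ T j, classCount R p) ^ (2 * (B + (t - j)) + 1) ≤
          2 ^ (2 ^ (k₀ + 2) * (2 * B + 5) * 2 ^ t) := by
        calc _ ≤ ∏ j ∈ Finset.range t,
              ((2 : ℝ) ^ 2 ^ (k₀ + j + 2)) ^ (2 * (B + (t - j)) + 1) :=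
              Finset.prod_le_prod (fun j _ => pow_nonneg (add_nonneg zero_le_one
                (Finset.sum_nonneg fun p _ => classCount_nonneg p)) _) fun j _ =>
                pow_le_pow_left₀ (add_nonneg zero_le_one
                  (Finset.sum_nonneg fun p _ => classCount_nonneg p)) (hA j) _
          _ = 2 ^ (2 ^ (k₀ + 2) * ∑ j ∈ Finset.range t, 2 ^ j * (2 * (B + (t - j)) + 1)) := by
              rw [Finset.mul_sum, ← Finset.prod_pow_eq_pow_sum]
              refine Finset.prod_congr rfl fun j _ => ?_
              rw [← pow_mul]
              congr 1
              ring
          _ ≤ _ := by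
              refine pow_le_pow_right₀ one_le_two ?_
              rw [mul_assoc]
              refine Nat.mul_le_mul_left _ ?_
              have := sum_range_two_pow_mul B t
              rw [mul_comm (2 * B + 5)]
              omega
      have hVprod : Real.exp (-(2 * L * t)) ≤
          ∏ j ∈ Finset.range t, ∏ p ∈ T j, (1 - classCount R p / p) := by
        calc _ = ∏ j ∈ Finset.range t, Real.exp (-(2 * L)) := by
              rw [Finset.prod_const, Finset.card_range, ← Real.exp_nat_mul]
              congr 1
              ring
          _ ≤ _ := Finset.prod_le_prod (fun _ _ => (Real.exp_pos _).le) fun j _ => hV j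
      have hexp := ht₀ t ht
      refine hprod.trans_lt ?_
      have h1 : ((2 ^ ((2 ^ (k₀ + 2) * (2 * B + 5) + 1) * 2 ^ t) : ℕ) : ℝ) =
          2 ^ (2 ^ (k₀ + 2) * (2 * B + 5) * 2 ^ t) * 2 ^ 2 ^ t := by
        push_cast
        rw [add_mul, one_mul, pow_add]
      have h2 : (1 : ℝ) < Real.exp (-(2 * L * t)) / 2 * 2 ^ 2 ^ t := by
        rw [Real.exp_neg]
        have := Real.exp_pos (2 * L * t)
        field_simp
        linarith
      rw [h1]
      set Q : ℝ := 2 ^ (2 ^ (k₀ + 2) * (2 * B + 5) * 2 ^ t)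
      have hQ : 0 < Q := by positivity
      calc Q = Q * 1 := (mul_one Q).symm
        _ < Q * (Real.exp (-(2 * L * t)) / 2 * 2 ^ 2 ^ t) := mul_lt_mul_of_pos_left h2 hQ
        _ = Real.exp (-(2 * L * t)) / 2 * (Q * 2 ^ 2 ^ t) := by ring
        _ ≤ _ := by gcongr
  obtain ⟨n, hn, hsurv⟩ := hmain
  refine ⟨n, hn, fun p hp h1 h2 => ?_⟩
  have hex : ∃ j, p < 2 ^ 2 ^ (k₀ + j) := ⟨t, h2⟩
  classical
  set j := Nat.find hex with hj
  have hj1 : p < 2 ^ 2 ^ (k₀ + j) := Nat.find_spec hex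
  have hj0 : j ≠ 0 := fun h => by
    rw [h] at hj1
    exact absurd h1 (not_le.2 hj1)
  obtain ⟨i, hi⟩ := Nat.exists_eq_succ_of_ne_zero hj0
  have hjt : j ≤ t := Nat.find_min' hex h2
  have hmin : ¬ p < 2 ^ 2 ^ (k₀ + i) := Nat.find_min hex (by omega)
  refine hsurv i (by omega) p (Finset.mem_filter.2 ⟨Finset.mem_Ico.2 ⟨not_lt.1 hmin, ?_⟩, hp⟩)
  rw [hi] at hj1
  exact hj1

end Sieve

section Kronecker

lemma eq_of_sum_range_mul_pow_eq {D : ℕ} (N : ℕ) {a b : ℕ → ℕ} (ha : ∀ i, a i < D)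
    (hb : ∀ i, b i < D)
    (h : ∑ i ∈ Finset.range N, a i * D ^ i = ∑ i ∈ Finset.range N, b i * D ^ i) :
    ∀ i < N, a i = b i := by
  induction N generalizing a b with
  | zero => simp
  | succ N ih =>
    have hsplit : ∀ c : ℕ → ℕ, ∑ i ∈ Finset.range (N + 1), c i * D ^ i =
        c 0 + D * ∑ i ∈ Finset.range N, c (i + 1) * D ^ i := fun c => by
      rw [Finset.sum_range_succ', Finset.mul_sum, pow_zero, mul_one, add_comm]
      congr 1
      exact Finset.sum_congr rfl fun i _ => by ring
    rw [hsplit a, hsplit b] at h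
    have h0 : a 0 = b 0 := by
      have := congrArg (· % D) h
      simpa [Nat.add_mul_mod_self_left, Nat.mod_eq_of_lt (ha 0), Nat.mod_eq_of_lt (hb 0)] using this
    rw [h0, Nat.add_left_cancel_iff] at h
    have h1 := ih (fun i => ha (i + 1)) (fun i => hb (i + 1))
      (Nat.eq_of_mul_eq_mul_left ((Nat.zero_le _).trans_lt (ha 0)) h)
    rintro (_ | i) hi
    · exact h0
    · exact h1 i (by omega)

/-- The degree in `X` of a monomial after the Kronecker substitution `X_l ↦ X ^ (D ^ l)`. -/
def kroneckerDegree (D : ℕ) (m : ℕ →₀ ℕ) : ℕ := ∑ l ∈ m.support, m l * D ^ l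

lemma kroneckerDegree_eq_sum_range (D : ℕ) {m : ℕ →₀ ℕ} {N : ℕ}
    (hN : m.support ⊆ Finset.range N) :
    kroneckerDegree D m = ∑ l ∈ Finset.range N, m l * D ^ l :=
  Finset.sum_subset hN fun l _ hl => by rw [Finsupp.notMem_support_iff.1 hl, zero_mul]

lemma kroneckerDegree_injective {D : ℕ} {m m' : ℕ →₀ ℕ} (hm : ∀ l, m l < D)
    (hm' : ∀ l, m' l < D) (h : kroneckerDegree D m = kroneckerDegree D m') : m = m' := by
  obtain ⟨N, hN⟩ := (m.support ∪ m'.support).exists_nat_subset_range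
  rw [kroneckerDegree_eq_sum_range D (Finset.subset_union_left.trans hN),
    kroneckerDegree_eq_sum_range D (Finset.subset_union_right.trans hN)] at h
  ext l
  by_cases hl : l < N
  · exact eq_of_sum_range_mul_pow_eq N hm hm' h l hl
  · have h1 : l ∉ m.support := fun hm =>
      hl (Finset.mem_range.1 (hN (Finset.mem_union_left _ hm)))
    have h2 : l ∉ m'.support := fun hm =>
      hl (Finset.mem_range.1 (hN (Finset.mem_union_right _ hm)))
    rw [Finsupp.notMem_support_iff.1 h1, Finsupp.notMem_support_iff.1 h2]

variable {R : Type} [CommRing R]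

lemma aeval_kronecker (D : ℕ) (P : MvPolynomial ℕ R) :
    aeval (fun l => (Polynomial.X : Polynomial R) ^ D ^ l) P =
      ∑ m ∈ P.support, Polynomial.C (P.coeff m) * Polynomial.X ^ kroneckerDegree D m := by
  rw [aeval_def, eval₂_eq]
  refine Finset.sum_congr rfl fun m _ => ?_
  rw [kroneckerDegree, ← Finset.prod_pow_eq_pow_sum, Polynomial.algebraMap_eq]
  congr 1
  exact Finset.prod_congr rfl fun l _ => by rw [← pow_mul, mul_comm]

lemma aeval_kronecker_ne_zero {D : ℕ} {P : MvPolynomial ℕ R} (hP : P ≠ 0)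
    (hD : P.totalDegree < D) :
    aeval (fun l => (Polynomial.X : Polynomial R) ^ D ^ l) P ≠ 0 := by
  obtain ⟨m₀, hm₀⟩ := MvPolynomial.support_nonempty.2 hP
  have hlt : ∀ m ∈ P.support, ∀ l, m l < D := fun m hm l => by
    refine lt_of_le_of_lt ?_ ((le_totalDegree hm).trans_lt hD)
    by_cases hl : l ∈ m.support
    · exact Finset.single_le_sum (f := m) (fun _ _ => Nat.zero_le _) hl
    · simp [Finsupp.notMem_support_iff.1 hl]
  intro h
  have hc := congrArg (fun q => Polynomial.coeff q (kroneckerDegree D m₀)) h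
  simp only [aeval_kronecker, Polynomial.finsetSum_coeff, Polynomial.coeff_C_mul,
    Polynomial.coeff_X_pow, Polynomial.coeff_zero] at hc
  rw [Finset.sum_eq_single_of_mem m₀ hm₀ fun m hm hne => by
    rw [if_neg fun h => hne (kroneckerDegree_injective (hlt m hm) (hlt m₀ hm₀) h.symm), mul_zero],
    if_pos rfl, mul_one] at hc
  exact mem_support_iff.1 hm₀ hc

/-- The one-variable polynomial obtained by restricting `P` to the curve
`X_l ↦ a_l + N * X ^ (D ^ l)`. -/
noncomputable def kroneckerCurve (P : MvPolynomial ℕ R) (D : ℕ) (a : ℕ → R) (N : R) :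
    Polynomial R :=
  aeval (fun l => Polynomial.C (a l) + Polynomial.C N * Polynomial.X ^ D ^ l) P

lemma eval_kroneckerCurve (P : MvPolynomial ℕ R) (D : ℕ) (a : ℕ → R) (N s : R) :
    (kroneckerCurve P D a N).eval s = eval (fun l => a l + N * s ^ D ^ l) P := by
  rw [kroneckerCurve, aeval_def, ← Polynomial.coe_evalRingHom, hom_eval₂, eval, coe_eval₂Hom]
  congr 1
  · ext; simp
  · ext; simp

lemma map_kroneckerCurve {R' : Type} [CommRing R'] (φ : R →+* R') (P : MvPolynomial ℕ R) (D : ℕ)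
    (a : ℕ → R) (N : R) :
    (kroneckerCurve P D a N).map φ = kroneckerCurve (map φ P) D (fun l => φ (a l)) (φ N) := by
  rw [kroneckerCurve, kroneckerCurve, aeval_def, aeval_def, ← Polynomial.coe_mapRingHom, hom_eval₂,
    eval₂_map]
  congr 1
  · ext; simp
  · ext; simp

lemma natDegree_kroneckerCurve_le (P : MvPolynomial ℕ R) (D : ℕ) (a : ℕ → R) (N : R) :
    (kroneckerCurve P D a N).natDegree ≤ P.support.sup (kroneckerDegree D) := by
  rw [kroneckerCurve, aeval_def, eval₂_eq]
  refine Polynomial.natDegree_sum_le_of_forall_le _ _ fun m hm => ?_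
  rw [Polynomial.algebraMap_eq]
  refine (Polynomial.natDegree_C_mul_le _ _).trans ((Polynomial.natDegree_prod_le _ _).trans ?_)
  refine le_trans (Finset.sum_le_sum fun l _ => ?_) (Finset.le_sup (f := kroneckerDegree D) hm)
  refine Polynomial.natDegree_pow_le_of_le _ ?_
  refine Polynomial.natDegree_add_le_of_degree_le (by simp) ?_
  exact (Polynomial.natDegree_C_mul_le _ _).trans (Polynomial.natDegree_X_pow_le _)

lemma totalDegree_affine_substitution_le (P : MvPolynomial ℕ R) (a : ℕ → R) (N : R) :
    (bind₁ (fun l => C (a l) + C N * X l) P).totalDegree ≤ P.totalDegree := by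
  rw [← aeval_eq_bind₁, aeval_def, eval₂_eq]
  refine totalDegree_finsetSum_le fun m hm => ?_
  refine le_trans ?_ (le_totalDegree hm)
  rw [algebraMap_eq]
  refine (totalDegree_mul _ _).trans ?_
  rw [totalDegree_C, zero_add]
  refine (totalDegree_finsetProd _ _).trans (Finset.sum_le_sum fun l _ => ?_)
  refine (totalDegree_pow _ _).trans ?_
  refine (Nat.mul_le_mul_left _ ?_).trans (mul_one _).le
  refine (totalDegree_add _ _).trans (max_le (by simp) ((totalDegree_mul _ _).trans ?_))
  rw [totalDegree_C, zero_add]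
  exact (totalDegree_monomial_le _ _).trans (by simp)

lemma kroneckerCurve_ne_zero {K : Type} [Field K] {P : MvPolynomial ℕ K} (hP : P ≠ 0) {D : ℕ}
    (hD : P.totalDegree < D) (a : ℕ → K) {N : K} (hN : N ≠ 0) :
    kroneckerCurve P D a N ≠ 0 := by
  have h1 : kroneckerCurve P D a N = aeval (fun l => (Polynomial.X : Polynomial K) ^ D ^ l)
      (bind₁ (fun l => C (a l) + C N * X l) P) := by
    rw [aeval_bind₁, kroneckerCurve]
    congr 2
    ext l
    simp
  rw [h1]
  refine aeval_kronecker_ne_zero (fun h => hP ?_)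
    ((totalDegree_affine_substitution_le P a N).trans_lt hD)
  have h2 : bind₁ (fun l => C N⁻¹ * (X l - C (a l)))
      (bind₁ (fun l => C (a l) + C N * X l) P) = P := by
    rw [bind₁_bind₁]
    refine Eq.trans ?_ (congrArg (fun φ => φ P) bind₁_X_left)
    congr 2
    ext1 l
    simp [← mul_assoc, ← C_mul, hN]
  rw [← h2, h, map_zero]

end Kronecker

section Roots

lemma card_roots_mod_prime_le {p : ℕ} [Fact p.Prime] {F : Polynomial ℤ}
    (hF : F.map (Int.castRingHom (ZMod p)) ≠ 0) :
    ((Finset.range p).filter fun n : ℕ => (p : ℤ) ∣ F.eval (n : ℤ)).card ≤ F.natDegree := by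
  classical
  have hinj : Set.InjOn (fun n : ℕ => (n : ZMod p))
      ((Finset.range p).filter fun n : ℕ => (p : ℤ) ∣ F.eval (n : ℤ)) := fun x hx y hy hxy => by
    have hx := Finset.mem_range.1 (Finset.mem_filter.1 hx).1
    have hy := Finset.mem_range.1 (Finset.mem_filter.1 hy).1
    have := (ZMod.natCast_eq_natCast_iff' x y p).1 hxy
    rwa [Nat.mod_eq_of_lt hx, Nat.mod_eq_of_lt hy] at this
  rw [← Finset.card_image_of_injOn hinj]
  refine (Polynomial.card_le_degree_of_subset_roots fun x hx => ?_).trans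
    (Polynomial.natDegree_map_le (f := Int.castRingHom (ZMod p)))
  obtain ⟨n, hn, rfl⟩ := Finset.mem_image.1 (Finset.mem_val ▸ hx)
  rw [Polynomial.mem_roots hF, Polynomial.IsRoot]
  have := (ZMod.intCast_zmod_eq_zero_iff_dvd (F.eval (n : ℤ)) p).2 (Finset.mem_filter.1 hn).2
  rw [← this, ← eq_intCast (Int.castRingHom (ZMod p)), ← Polynomial.eval_map_apply]
  simp

lemma exists_abs_eval_le (F : Polynomial ℤ) :
    ∃ c : ℕ, ∀ n Y : ℕ, n ≤ Y → 1 ≤ Y → (F.eval (n : ℤ)).natAbs ≤ c * Y ^ F.natDegree := by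
  refine ⟨∑ i ∈ Finset.range (F.natDegree + 1), (F.coeff i).natAbs, fun n Y hn hY => ?_⟩
  rw [Polynomial.eval_eq_sum_range, Finset.sum_mul]
  refine (Int.natAbs_sum_le _ _).trans (Finset.sum_le_sum fun i hi => ?_)
  rw [Int.natAbs_mul, Int.natAbs_pow, Int.natAbs_natCast]
  refine Nat.mul_le_mul_left _ ((Nat.pow_le_pow_left hn i).trans (Nat.pow_le_pow_right hY ?_))
  have := Finset.mem_range.1 hi
  omega

end Roots

section AlmostPrimeValues

lemma dvd_eval_sub_eval {d : ℤ} {x y : ℕ → ℤ} (h : ∀ l, d ∣ x l - y l) (P : MvPolynomial ℕ ℤ) :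
    d ∣ eval x P - eval y P := by
  have key : ∀ z : ℕ → ℤ, Ideal.Quotient.mk (Ideal.span {d}) (eval z P) =
      eval₂ (Ideal.Quotient.mk (Ideal.span {d})) (fun l => Ideal.Quotient.mk (Ideal.span {d}) (z l))
        P := fun z => by
    rw [eval, coe_eval₂Hom, hom_eval₂]
    rfl
  rw [← Ideal.mem_span_singleton, ← Ideal.Quotient.eq, key, key]
  congr 1
  ext l
  rw [Ideal.Quotient.eq, Ideal.mem_span_singleton]
  exact h l

/-- Simultaneous approximation of integers at finitely many primes by multiples of `N`. -/
lemma exists_multiple_modEq (T : Finset ℕ) (hT : ∀ p ∈ T, p.Prime) {N : ℕ}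
    (hN : ∀ p ∈ T, ¬ p ∣ N) (b : ℕ → ℤ) :
    ∃ a : ℤ, (N : ℤ) ∣ a ∧ ∀ p ∈ T, (p : ℤ) ∣ a - b p := by
  have hinv : ∀ p, ∃ c : ℕ, p ∈ T → (p : ℤ) ∣ N * c - b p := fun p => by
    by_cases hp : p ∈ T
    · have : Fact p.Prime := ⟨hT p hp⟩
      refine ⟨((N : ZMod p)⁻¹ * (b p : ZMod p)).val, fun _ => ?_⟩
      have hN' : (N : ZMod p) ≠ 0 := fun h => hN p hp ((ZMod.natCast_eq_zero_iff _ _).1 h)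
      rw [← ZMod.intCast_zmod_eq_zero_iff_dvd]
      push_cast
      rw [ZMod.natCast_zmod_val, mul_inv_cancel_left₀ hN', sub_self]
    · exact ⟨0, fun h => absurd h hp⟩
  choose c hc using hinv
  obtain ⟨k, hk⟩ := Nat.chineseRemainderOfFinset c id T (fun p hp => (hT p hp).ne_zero)
    (fun p hp q hq hpq => (Nat.coprime_primes (hT p hp) (hT q hq)).2 hpq)
  refine ⟨N * k, dvd_mul_right _ _, fun p hp => ?_⟩
  have h1 : (p : ℤ) ∣ c p - k := Nat.modEq_iff_dvd.1 (hk p hp)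
  have h2 : (N * k - b p : ℤ) = N * c p - b p - N * (c p - k) := by ring
  rw [h2]
  exact dvd_sub (hc p hp) (h1.mul_left _)

lemma sum_factorization_le_of_lt_pow {m A r : ℕ} (hm : m ≠ 0) (T : Finset ℕ)
    (hT : T ⊆ m.primeFactors) (hbig : ∀ p ∈ T, 2 ^ A ≤ p) (hA : A ≠ 0) (hle : m ≤ 2 ^ (A * r)) :
    ∑ p ∈ T, m.factorization p ≤ r := by
  have h1 : 2 ^ (A * ∑ p ∈ T, m.factorization p) ≤ m := by
    calc _ = ∏ p ∈ T, (2 ^ A) ^ m.factorization p := by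
          rw [pow_mul, Finset.prod_pow_eq_pow_sum]
      _ ≤ ∏ p ∈ T, p ^ m.factorization p :=
          Finset.prod_le_prod' fun p hp => Nat.pow_le_pow_left (hbig p hp) _
      _ ≤ ∏ p ∈ m.primeFactors, p ^ m.factorization p :=
          Finset.prod_le_prod_of_subset_of_one_le' hT fun p hp _ =>
            Nat.one_le_pow _ _ (Nat.prime_of_mem_primeFactors hp).pos
      _ = m := Nat.prod_factorization_pow_eq_self hm
  have h2 := (Nat.pow_le_pow_iff_right (by norm_num)).1 (h1.trans hle)
  exact Nat.le_of_mul_le_mul_left h2 (Nat.pos_of_ne_zero hA)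

theorem exists_almost_prime_value (P : MvPolynomial ℕ ℤ) (S : Finset ℕ) {N₀ : ℕ}
    (hN₀S : ∀ p, p.Prime → p ∣ N₀ → p ∈ S)
    (hP : ∀ p, p.Prime → p ∉ S → ∃ t : ℕ → ℤ, ¬ (p : ℤ) ∣ eval t P) :
    ∃ r, 1 ≤ r ∧ ∀ M : ℕ, ∃ t : ℕ → ℤ, (∀ l, (N₀ : ℤ) ∣ t l) ∧ eval t P ≠ 0 ∧
      (∀ p, p.Prime → p ∉ S → (p : ℤ) ∣ eval t P → M < p) ∧
      ∑ p ∈ (eval t P).natAbs.primeFactors.filter (fun p => p ∉ S),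
        (eval t P).natAbs.factorization p ≤ r := by
  classical
  set D := P.totalDegree + 1
  set κ := P.support.sup (kroneckerDegree D)
  set k₀ := 2 * κ
  have hκ : 2 * κ ≤ 2 ^ 2 ^ k₀ :=
    (Nat.lt_two_pow_self (n := 2 * κ)).le.trans (Nat.lt_two_pow_self (n := 2 ^ k₀)).le
  set T := (Finset.range (2 ^ 2 ^ k₀)).filter fun p => p.Prime ∧ p ∉ S
  have hT : ∀ p, p ∈ T ↔ p < 2 ^ 2 ^ k₀ ∧ p.Prime ∧ p ∉ S := fun p => by
    rw [Finset.mem_filter, Finset.mem_range]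
  have hb : ∃ b : ℕ → ℕ → ℤ, ∀ p, p.Prime → p ∉ S → ¬ (p : ℤ) ∣ eval (b p) P := by
    choose! b hb using hP
    exact ⟨b, hb⟩
  obtain ⟨b, hb⟩ := hb
  have ha : ∀ l, ∃ a : ℤ, (N₀ : ℤ) ∣ a ∧ ∀ p ∈ T, (p : ℤ) ∣ a - b p l := fun l =>
    exists_multiple_modEq T (fun p hp => ((hT p).1 hp).2.1)
      (fun p hp h => ((hT p).1 hp).2.2 (hN₀S p ((hT p).1 hp).2.1 h)) fun p => b p l
  choose a haN haT using ha
  set N := N₀ * ∏ p ∈ T, p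
  have hNdvd : ∀ p, p.Prime → p ∉ S → p ∣ N → p ∈ T := fun p hp hpS h => by
    rcases hp.dvd_mul.1 h with h | h
    · exact absurd (hN₀S p hp h) hpS
    · obtain ⟨q, hq, hpq⟩ := (hp.prime.dvd_finsetProd_iff _).1 h
      rwa [(Nat.prime_dvd_prime_iff_eq hp ((hT q).1 hq).2.1).1 hpq]
  set F := kroneckerCurve P D a (N : ℤ)
  have hFeval : ∀ s : ℤ, F.eval s = eval (fun l => a l + N * s ^ D ^ l) P := fun s =>
    eval_kroneckerCurve P D a N s
  have hFdeg : F.natDegree ≤ κ := natDegree_kroneckerCurve_le P D a N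
  have hFmod : ∀ p [Fact p.Prime], p ∉ S → p ∉ T → F.map (Int.castRingHom (ZMod p)) ≠ 0 := by
    intro p hp hpS hpT
    rw [map_kroneckerCurve]
    refine kroneckerCurve_ne_zero (fun h => hb p hp.out hpS ?_) ?_ _ fun h => hpT ?_
    · rw [← ZMod.intCast_zmod_eq_zero_iff_dvd, ← eq_intCast (Int.castRingHom (ZMod p)),
        eval, coe_eval₂Hom, hom_eval₂]
      have := congrArg (eval fun l => Int.castRingHom (ZMod p) (b p l)) h
      rw [eval_map, map_zero] at this
      exact this
    · refine Nat.lt_succ_of_le ?_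
      exact Finset.sup_mono (support_map_subset _ _)
    · rw [eq_intCast, Int.cast_natCast, ZMod.natCast_eq_zero_iff] at h
      exact hNdvd p hp.out hpS h
  have hFsmall : ∀ p ∈ T, ∀ s : ℤ, ¬ (p : ℤ) ∣ F.eval s := fun p hp s h => by
    refine hb p ((hT p).1 hp).2.1 ((hT p).1 hp).2.2 ?_
    have h1 : (p : ℤ) ∣ F.eval s - eval (b p) P := by
      rw [hFeval]
      refine dvd_eval_sub_eval (fun l => ?_) P
      have h2 : (p : ℤ) ∣ N := Int.natCast_dvd_natCast.2 ((Finset.dvd_prod_of_mem _ hp).mul_left _)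
      rw [add_sub_right_comm]
      exact dvd_add (haT l p hp) (h2.mul_right _)
    exact (dvd_sub_right h).1 h1
  obtain ⟨c, hc⟩ := exists_abs_eval_le F
  obtain ⟨C, t₀, hsieve⟩ := exists_survivor hκ
  obtain ⟨ℓ, hℓ, hℓp⟩ := Nat.exists_infinite_primes (2 ^ 2 ^ k₀ + S.sup id + 1)
  have hℓS : ℓ ∉ S := fun h => by
    have := Finset.le_sup (f := id) h
    simp only [id] at this
    omega
  refine ⟨C * κ + 1, by omega, fun M => ?_⟩
  set t := t₀ + M + c + ℓ
  have hself : ∀ k, k ≤ t → k < 2 ^ 2 ^ t := fun k hk => hk.trans_lt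
    ((Nat.lt_two_pow_self (n := t)).trans (Nat.lt_two_pow_self (n := 2 ^ t)))
  have hmono : 2 ^ 2 ^ t ≤ 2 ^ 2 ^ (k₀ + t) :=
    Nat.pow_le_pow_right two_pos (Nat.pow_le_pow_right two_pos (by omega))
  obtain ⟨n, hn, hsurv⟩ := hsieve t (by omega)
    (fun p n => p.Prime ∧ p ∉ S ∧ p ∉ T ∧ (p : ℤ) ∣ F.eval (n : ℤ)) (fun p n => by
      have : (p : ℤ) ∣ F.eval (n : ℤ) - F.eval ((n % p : ℕ) : ℤ) := by
        refine Dvd.dvd.trans ?_ (Polynomial.sub_dvd_eval_sub _ _ F)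
        rw [Int.natCast_mod]
        exact Int.dvd_self_sub_emod
      rw [dvd_iff_dvd_of_dvd_sub this]) (fun p hp _ => by
      have : Fact p.Prime := ⟨hp⟩
      by_cases h : p ∉ S ∧ p ∉ T
      · refine le_trans (Finset.card_le_card ?_)
          ((card_roots_mod_prime_le (hFmod p h.1 h.2)).trans hFdeg)
        exact Finset.monotone_filter_right _ fun n _ h => h.2.2.2
      · rw [Finset.filter_false_of_mem fun n _ h' => h ⟨h'.2.1, h'.2.2.1⟩]
        exact Nat.zero_le _)
  have hgood : ∀ p, p.Prime → p ∉ S → (p : ℤ) ∣ F.eval (n : ℤ) → 2 ^ 2 ^ t ≤ p := by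
    intro p hp hpS hdvd
    have hpT : p ∉ T := fun h => hFsmall p h n hdvd
    refine hmono.trans (not_lt.1 fun hlt => hsurv p hp (not_lt.1 fun h => hpT ?_) hlt
      ⟨hp, hpS, hpT, hdvd⟩)
    exact (hT p).2 ⟨h, hp, hpS⟩
  have hne : F.eval (n : ℤ) ≠ 0 := fun h => by
    have := hgood ℓ hℓp hℓS (h ▸ dvd_zero _)
    have := hself ℓ (by omega)
    omega
  refine ⟨fun l => a l + N * n ^ D ^ l, fun l => ?_, ?_⟩
  · refine dvd_add (haN l) (Dvd.dvd.mul_right ?_ _)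
    exact Int.natCast_dvd_natCast.2 (dvd_mul_right _ _)
  · rw [← hFeval]
    refine ⟨hne, fun p hp hpS hdvd => (hself M (by omega)).trans_le (hgood p hp hpS hdvd), ?_⟩
    refine sum_factorization_le_of_lt_pow (A := 2 ^ t) (Int.natAbs_ne_zero.2 hne) _
      (Finset.filter_subset _ _) (fun p hp => ?_) (by positivity) ?_
    · obtain ⟨h1, h2⟩ := Finset.mem_filter.1 hp
      exact hgood p (Nat.prime_of_mem_primeFactors h1) h2
        (Int.natCast_dvd.2 (Nat.dvd_of_mem_primeFactors h1))
    · calc _ ≤ c * (2 ^ (C * 2 ^ t)) ^ F.natDegree := hc n _ hn.le Nat.one_le_two_pow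
        _ ≤ 2 ^ 2 ^ t * (2 ^ (C * 2 ^ t)) ^ κ :=
            Nat.mul_le_mul (hself c (by omega)).le (Nat.pow_le_pow_right Nat.one_le_two_pow hFdeg)
        _ = _ := by
            rw [← pow_mul, ← pow_add]
            congr 1
            ring

end AlmostPrimeValues

section Reduction

lemma exists_integral_multiple {σ : Type} (S : Finset ℕ) (f : MvPolynomial σ ℚ)
    (hf : ∀ p : ℕ, p.Prime → p ∉ S → ∀ m, padicNorm p (f.coeff m) ≤ 1) :
    ∃ q : ℕ, q ≠ 0 ∧ (∀ p, p.Prime → p ∣ q → p ∈ S) ∧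
      ∃ F : MvPolynomial σ ℤ, map (Int.castRingHom ℚ) F = C (q : ℚ) * f := by
  classical
  refine ⟨∏ m ∈ f.support, (f.coeff m).den, Finset.prod_ne_zero_iff.2 fun m _ => (f.coeff m).den_nz,
    fun p hp hpq => ?_, ?_⟩
  · obtain ⟨m, -, hm⟩ := (hp.prime.dvd_finsetProd_iff _).1 hpq
    by_contra hpS
    have : Fact p.Prime := ⟨hp⟩
    have h := hf p hp hpS m
    have hden : padicNorm p (f.coeff m).den < 1 := (padicNorm.nat_lt_one_iff _).2 hm
    have hnum : padicNorm p (f.coeff m).num < 1 := by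
      rw [← Rat.mul_den_eq_num, padicNorm.mul]
      exact (mul_le_of_le_one_left (padicNorm.nonneg _) h).trans_lt hden
    have hdvd := Int.natCast_dvd.1 ((padicNorm.int_lt_one_iff _).1 hnum)
    exact hp.one_lt.ne' (Nat.eq_one_of_dvd_coprimes (f.coeff m).reduced hdvd hm)
  · refine mem_range_map_iff_coeffs_subset.2 fun x hx => ?_
    obtain ⟨m, hm, rfl⟩ := mem_coeffs_iff.1 hx
    rw [coeff_C_mul]
    by_cases h : f.coeff m = 0
    · exact ⟨0, by simp [h]⟩
    · obtain ⟨k, hk⟩ := Finset.dvd_prod_of_mem (fun m => (f.coeff m).den) (mem_support_iff.2 h)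
      refine ⟨k * (f.coeff m).num, ?_⟩
      rw [hk, eq_intCast]
      push_cast
      rw [mul_comm ((f.coeff m).den : ℚ), mul_assoc, Rat.den_mul_eq_num]

variable {n : Type} [Fintype n] [DecidableEq n]

lemma exists_eval_ne_zero_mod_prime {p : ℕ} [Fact p.Prime] (F : MvPolynomial (n × n) ℤ)
    (B : Matrix n n ℚ_[p]) (hdet : B.det = 1) (hB : ∀ i j, ‖B i j‖ ≤ 1)
    (hF : ‖aeval (fun ij : n × n => B ij.1 ij.2) F‖ = 1) :
    ∃ A : Matrix n n (ZMod p), A.det = 1 ∧ aeval (fun ij : n × n => A ij.1 ij.2) F ≠ 0 := by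
  let B' : Matrix n n ℤ_[p] := Matrix.of fun i j => ⟨B i j, hB i j⟩
  have hB' : B'.map (PadicInt.Coe.ringHom (p := p)) = B := rfl
  have hdet' : B'.det = 1 := by
    refine Subtype.coe_injective ?_
    have := RingHom.map_det (PadicInt.Coe.ringHom (p := p)) B'
    rw [RingHom.mapMatrix_apply, hB', hdet] at this
    exact this
  have hval : ((aeval (fun ij : n × n => B' ij.1 ij.2) F : ℤ_[p]) : ℚ_[p]) =
      aeval (fun ij : n × n => B ij.1 ij.2) F := by
    have := hom_eval₂ F (algebraMap ℤ ℤ_[p]) (PadicInt.Coe.ringHom (p := p))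
      (fun ij : n × n => B' ij.1 ij.2)
    refine this.trans ?_
    rw [aeval_def]
    congr 1
  refine ⟨B'.map PadicInt.toZMod, ?_, fun h => ?_⟩
  · rw [← RingHom.mapMatrix_apply, ← RingHom.map_det, hdet', map_one]
  · have h1 : PadicInt.toZMod (aeval (fun ij : n × n => B' ij.1 ij.2) F) = 0 := by
      rw [← h, aeval_def, aeval_def, hom_eval₂]
      congr 1
      exact RingHom.ext_int _ _
    rw [← RingHom.mem_ker, PadicInt.ker_toZMod, IsLocalRing.mem_maximalIdeal,
      PadicInt.mem_nonunits, PadicInt.norm_def, hval, hF] at h1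
    exact lt_irrefl _ h1

lemma exists_congruence_neighborhood {p : ℕ} [Fact p.Prime] {U : Set (Matrix n n ℚ_[p])}
    (hU : IsOpen U) (h1 : (1 : Matrix n n ℚ_[p]) ∈ U) :
    ∃ m : ℕ, ∀ A : Matrix n n ℤ, (∀ i j, (p ^ m : ℤ) ∣ A i j - (1 : Matrix n n ℤ) i j) →
      A.map (fun x : ℤ => (x : ℚ_[p])) ∈ U := by
  obtain ⟨ε, hε, hball⟩ := (Metric.isOpen_iff (α := n → n → ℚ_[p])).1 hU (1 : Matrix n n ℚ_[p]) h1
  obtain ⟨m, hm⟩ := exists_pow_lt_of_lt_one hε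
    (inv_lt_one_of_one_lt₀ (by exact_mod_cast (Fact.out : p.Prime).one_lt : (1 : ℝ) < p))
  refine ⟨m, fun A hA => hball ?_⟩
  refine Metric.mem_ball.2 ((dist_pi_lt_iff hε).2 fun i => (dist_pi_lt_iff hε).2 fun j => ?_)
  refine lt_of_le_of_lt ?_ hm
  have := (Padic.norm_int_le_pow_iff_dvd (p := p) (A i j - (1 : Matrix n n ℤ) i j) m).2
    (by exact_mod_cast hA i j)
  rw [zpow_neg, zpow_natCast, ← inv_pow] at this
  refine le_trans (le_of_eq ?_) this
  rw [dist_eq_norm]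
  congr 1
  by_cases hij : i = j
  · subst hij
    simp
  · simp [hij]

end Reduction

/-- **Corollary 3.3 for `SL_n` over `ℚ` (affine sieve application).**  Let `S` be a
finite set of primes, `f` a polynomial in the matrix entries with `S`-integral
coefficients whose image in `ℚ[SL_n]` is nonzero and squarefree, taking a `p`-adic
unit value on `SL_n(ℤ_p)` for every `p ∉ S`, and let `Φ_p ⊆ SL_n(ℚ_p)` be compact
open subgroups for `p ∈ S`.  Then there is `r ≥ 1` such that for every sufficiently
large `M` there exists `g ∈ SL_n(ℤ_S)` with `g ∈ Φ_p` for all `p ∈ S`, such that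
`f(g) ≠ 0` has at most `r` prime factors in `ℤ_S` (with multiplicity) and every
prime factor of `f(g)` outside `S` exceeds `M`. -/
theorem stmt_8 (n : ℕ) (hn : 2 ≤ n) (S : Finset ℕ) (hS : ∀ p ∈ S, p.Prime)
    (f : MvPolynomial (Fin n × Fin n) ℚ)
    -- f has S-integral coefficients
    (hfcoeff : ∀ p : ℕ, p.Prime → p ∉ S → ∀ mono, padicNorm p (f.coeff mono) ≤ 1)
    -- the image of f in ℚ[SL_n] is nonzero and squarefree
    (hf0 : Ideal.Quotient.mk
        (Ideal.span {(Matrix.of fun i j : Fin n => MvPolynomial.X (i, j)).det - 1}) f ≠ 0)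
    (hfsq : Squarefree (Ideal.Quotient.mk
        (Ideal.span {(Matrix.of fun i j : Fin n => MvPolynomial.X (i, j)).det - 1}) f))
    -- f takes a unit value on SL_n(ℤ_p) for every p ∉ S
    (hB : ∀ (p : ℕ) [Fact p.Prime], p ∉ S →
      ∃ B : Matrix (Fin n) (Fin n) ℚ_[p], B.det = 1 ∧ (∀ i j, ‖B i j‖ ≤ 1) ∧
        ‖aeval (fun ij : Fin n × Fin n => B ij.1 ij.2) f‖ = 1)
    -- compact open subgroups Φ_p ⊆ SL_n(ℚ_p) for p ∈ S
    (Φ : (p : ℕ) → [Fact p.Prime] → Set (Matrix (Fin n) (Fin n) ℚ_[p]))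
    (hΦ : ∀ (p : ℕ) [Fact p.Prime], p ∈ S →
      (∀ A ∈ Φ p, A.det = 1) ∧
      (1 : Matrix (Fin n) (Fin n) ℚ_[p]) ∈ Φ p ∧
      (∀ A ∈ Φ p, ∀ B ∈ Φ p, A * B ∈ Φ p) ∧
      (∀ A ∈ Φ p, A⁻¹ ∈ Φ p) ∧
      IsCompact (Φ p) ∧
      (∃ U : Set (Matrix (Fin n) (Fin n) ℚ_[p]), IsOpen U ∧
        Φ p = U ∩ {A : Matrix (Fin n) (Fin n) ℚ_[p] | A.det = 1})) :
    ∃ r : ℕ, 1 ≤ r ∧ ∃ M₀ : ℝ, ∀ M : ℝ, M₀ ≤ M →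
      ∃ g : Matrix (Fin n) (Fin n) ℚ,
        g.det = 1 ∧
        -- g ∈ SL_n(ℤ_S)
        (∀ p : ℕ, p.Prime → p ∉ S → ∀ i j, padicNorm p (g i j) ≤ 1) ∧
        -- g ∈ Φ_p for every p ∈ S
        (∀ (p : ℕ) [Fact p.Prime], p ∈ S →
          g.map (fun x : ℚ => (x : ℚ_[p])) ∈ Φ p) ∧
        eval (fun ij : Fin n × Fin n => g ij.1 ij.2) f ≠ 0 ∧
        -- every prime factor of f(g) in ℤ_S is > M
        (∀ p ∈ (eval (fun ij : Fin n × Fin n => g ij.1 ij.2) f).num.natAbs.primeFactors,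
          p ∉ S → M < (p : ℝ)) ∧
        -- f(g) has at most r prime factors in ℤ_S, counted with multiplicity
        (∑ p ∈ (eval (fun ij : Fin n × Fin n => g ij.1 ij.2) f).num.natAbs.primeFactors.filter
            (fun p => p ∉ S),
          (eval (fun ij : Fin n × Fin n => g ij.1 ij.2) f).num.natAbs.factorization p) ≤ r := by
  obtain ⟨k, rfl⟩ : ∃ k, n = k + 1 := ⟨n - 1, by omega⟩
  obtain ⟨Γ, hΓdet, hΓ0, hΓ⟩ := PolynomiallyCovered.specialLinear k
  obtain ⟨q, hq0, hqS, F, hF⟩ := exists_integral_multiple S f hfcoeff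
  have hFf : ∀ {K : Type} [Field K] [Algebra ℚ K] (x : Fin (k + 1) × Fin (k + 1) → K),
      aeval x F = (q : K) * aeval x f := fun {K} _ _ x => by
    have h1 : aeval x (map (Int.castRingHom ℚ) F) = aeval x F := by
      rw [aeval_def, aeval_def, eval₂_map]
      congr 1
      exact RingHom.ext_int _ _
    rw [← h1, hF, map_mul, aeval_C, map_natCast]
  set P : MvPolynomial ℕ ℤ := aeval (fun ij : Fin (k + 1) × Fin (k + 1) => Γ ij.1 ij.2) F
  have hPval : ∀ {K : Type} [CommRing K] (t : ℕ → K), aeval t P =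
      aeval (fun ij : Fin (k + 1) × Fin (k + 1) => (aeval t).mapMatrix Γ ij.1 ij.2) F :=
    fun {K} _ t => by
      rw [← AlgHom.comp_apply, comp_aeval]
      rfl
  have hm : ∃ m : ℕ → ℕ, ∀ (p : ℕ) [Fact p.Prime], p ∈ S →
      ∀ A : Matrix (Fin (k + 1)) (Fin (k + 1)) ℤ, A.det = 1 →
        (∀ i j, (p ^ m p : ℤ) ∣ A i j - (1 : Matrix (Fin (k + 1)) (Fin (k + 1)) ℤ) i j) →
        A.map (fun x : ℤ => (x : ℚ_[p])) ∈ Φ p := by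
    have : ∀ p : ℕ, ∃ m : ℕ, ∀ [Fact p.Prime], p ∈ S →
        ∀ A : Matrix (Fin (k + 1)) (Fin (k + 1)) ℤ, A.det = 1 →
          (∀ i j, (p ^ m : ℤ) ∣ A i j - (1 : Matrix (Fin (k + 1)) (Fin (k + 1)) ℤ) i j) →
          A.map (fun x : ℤ => (x : ℚ_[p])) ∈ Φ p := fun p => by
      by_cases hp : p.Prime ∧ p ∈ S
      · have : Fact p.Prime := ⟨hp.1⟩
        obtain ⟨-, h1, -, -, -, U, hU, hΦU⟩ := hΦ p hp.2
        rw [hΦU] at h1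
        obtain ⟨m, hm⟩ := exists_congruence_neighborhood hU h1.1
        refine ⟨m, fun _ A hA hcongr => ?_⟩
        rw [hΦU]
        refine ⟨hm A hcongr, ?_⟩
        have := RingHom.map_det (Int.castRingHom ℚ_[p]) A
        rw [hA, map_one] at this
        exact this.symm
      · exact ⟨0, fun {hp'} hpS => absurd ⟨hp'.out, hpS⟩ hp⟩
    choose m hm using this
    exact ⟨m, fun p _ => hm p⟩
  obtain ⟨m, hm⟩ := hm
  obtain ⟨r, hr1, hr⟩ := exists_almost_prime_value P S (N₀ := ∏ p ∈ S, p ^ m p)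
    (fun p hp hdvd => by
      obtain ⟨l, hl, hpl⟩ := (hp.prime.dvd_finsetProd_iff _).1 hdvd
      rwa [(Nat.prime_dvd_prime_iff_eq hp (hS l hl)).1 (hp.dvd_of_dvd_pow hpl)])
    (fun p hp hpS => by
      have : Fact p.Prime := ⟨hp⟩
      obtain ⟨B, hBdet, hBint, hBf⟩ := hB p hpS
      obtain ⟨A, hA, hAF⟩ := exists_eval_ne_zero_mod_prime F B hBdet hBint (by
        rw [hFf, norm_mul, hBf, mul_one, Padic.norm_natCast_eq_one_iff]
        exact (Nat.Prime.coprime_iff_not_dvd hp).2 fun h => hpS (hqS p hp h))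
      obtain ⟨t, ht⟩ := hΓ (ZMod p) A hA
      choose b hb using fun l => ZMod.intCast_surjective (t l)
      refine ⟨b, fun h => hAF ?_⟩
      have ht' := hPval t
      rw [ht] at ht'
      rw [← ht', ← (ZMod.intCast_zmod_eq_zero_iff_dvd _ p).2 h,
        ← eq_intCast (Int.castRingHom (ZMod p)), eval, coe_eval₂Hom, hom_eval₂, aeval_def]
      congr 1
      ext l
      exact (hb l).symm)
  refine ⟨r, hr1, 0, fun M _ => ?_⟩
  obtain ⟨t, htN, ht0, htM, htr⟩ := hr ⌈M⌉₊
  set A : Matrix (Fin (k + 1)) (Fin (k + 1)) ℤ := (aeval t).mapMatrix Γ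
  have hAdet : A.det = 1 := by
    rw [← AlgHom.map_det, hΓdet, map_one]
  set z : ℤ := eval t P
  have hz : z = aeval (fun ij : Fin (k + 1) × Fin (k + 1) => A ij.1 ij.2) F := hPval t
  set g : Matrix (Fin (k + 1)) (Fin (k + 1)) ℚ := A.map (fun x : ℤ => (x : ℚ)) with hg
  set v : ℚ := eval (fun ij : Fin (k + 1) × Fin (k + 1) => g ij.1 ij.2) f with hv
  have hq0' : (q : ℚ) ≠ 0 := Nat.cast_ne_zero.2 hq0
  have hqv : (q : ℚ) * v = z := by
    refine (hFf (fun ij => g ij.1 ij.2)).symm.trans ?_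
    rw [hz, aeval_def, aeval_def, ← eq_intCast (Int.castRingHom ℚ), hom_eval₂]
    congr 1
  have hv0 : v ≠ 0 := fun h => ht0 (by
    rw [h, mul_zero] at hqv
    exact_mod_cast hqv.symm)
  have hnum : v.num.natAbs ∣ z.natAbs := by
    refine Int.natAbs_dvd_natAbs.2 ?_
    have : v = Rat.divInt z q := by
      rw [Rat.divInt_eq_div, ← hqv, Int.cast_natCast, mul_div_cancel_left₀ _ hq0']
    rw [this]
    exact Rat.num_dvd _ (by exact_mod_cast hq0)
  have hznat : z.natAbs ≠ 0 := Int.natAbs_ne_zero.2 ht0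
  refine ⟨g, ?_, fun p hp _ i j => ?_, fun p _ hpS => ?_, hv0, fun p hp hpS => ?_, ?_⟩
  · have := RingHom.map_det (Int.castRingHom ℚ) A
    rw [hAdet, map_one] at this
    exact this.symm
  · have : Fact p.Prime := ⟨hp⟩
    exact padicNorm.of_int _
  · have h1 := hm p hpS A hAdet fun i j => by
      have h2 : ((∏ p ∈ S, p ^ m p : ℕ) : ℤ) ∣ A i j - (aeval (0 : ℕ → ℤ)).mapMatrix Γ i j :=
        dvd_eval_sub_eval (fun l => by simpa using htN l) (Γ i j)
      rw [hΓ0] at h2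
      refine Dvd.dvd.trans ?_ h2
      exact_mod_cast Finset.dvd_prod_of_mem (fun p => p ^ m p) hpS
    convert h1 using 1
    ext i j
    simp [hg]
  · have hpp := Nat.prime_of_mem_primeFactors hp
    have h1 := htM p hpp hpS
      (Int.natCast_dvd.2 ((Nat.dvd_of_mem_primeFactors hp).trans hnum))
    exact (Nat.le_ceil M).trans_lt (by exact_mod_cast h1)
  · refine le_trans ?_ htr
    refine (Finset.sum_le_sum fun p _ => (Nat.factorization_le_iff_dvd
      (Int.natAbs_ne_zero.2 (Rat.num_ne_zero.2 hv0)) hznat).2 hnum p).trans ?_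
    exact Finset.sum_le_sum_of_subset
      (Finset.filter_subset_filter _ (Nat.primeFactors_mono hnum hznat))
end
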